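/- arXiv:1901.08315 — 6 statements merged into one kernel-verified Lean document; each statement's English description precedes it below -/
import Mathlib

section
/- Let n ≥ 1, let B be an n×n real symmetric matrix which is negative semidefinite, and let θ ∈ ℂ with Im θ ≤ 0 be such that the real matrix I + (Re θ)·B is positive definite. Then the complex matrix I + θB is invertible, and for every ξ ∈ ℝⁿ the (bilinear, non-conjugated) square sum of η = (I + θB)⁻¹ξ ∈ ℂⁿ satisfies Im(∑_{i=1}^n η_i²) ≤ 0. -/
open Matrix

section

variable {ι : Type*} [Fintype ι]

lemma Matrix.IsSymm.dotProduct_mulVec_comm {B : Matrix ι ι ℝ} (hB : B.IsSymm) (x y : ι → ℝ) :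
    x ⬝ᵥ B *ᵥ y = y ⬝ᵥ B *ᵥ x := by
  rw [dotProduct_mulVec, ← mulVec_transpose, hB.eq, dotProduct_comm]

variable [DecidableEq ι]

lemma re_mulVec_one_add_smul_map (B : Matrix ι ι ℝ) (θ : ℂ) (η : ι → ℂ) (i : ι) :
    (((1 + θ • B.map Complex.ofReal) *ᵥ η) i).re =
      ((1 + θ.re • B) *ᵥ fun j => (η j).re) i - θ.im * (B *ᵥ fun j => (η j).im) i := by
  simp only [add_mulVec, one_mulVec, smul_mulVec, Pi.add_apply, Pi.smul_apply, smul_eq_mul,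
    Complex.add_re, Complex.mul_re]
  simp [mulVec, dotProduct, Complex.re_sum, Complex.im_sum]
  ring

lemma im_mulVec_one_add_smul_map (B : Matrix ι ι ℝ) (θ : ℂ) (η : ι → ℂ) (i : ι) :
    (((1 + θ • B.map Complex.ofReal) *ᵥ η) i).im =
      ((1 + θ.re • B) *ᵥ fun j => (η j).im) i + θ.im * (B *ᵥ fun j => (η j).re) i := by
  simp only [add_mulVec, one_mulVec, smul_mulVec, Pi.add_apply, Pi.smul_apply, smul_eq_mul,
    Complex.add_im, Complex.mul_im]
  simp [mulVec, dotProduct, Complex.re_sum, Complex.im_sum]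
  ring

/-- If `1 + θ.re • B` is positive definite with `B` symmetric, then `1 + θ • B` is invertible. -/
lemma isUnit_one_add_smul_map {B : Matrix ι ι ℝ} (hB : B.IsSymm) {θ : ℂ}
    (hpos : (1 + θ.re • B).PosDef) : IsUnit (1 + θ • B.map Complex.ofReal) := by
  rw [← mulVec_injective_iff_isUnit]
  refine (injective_iff_map_eq_zero (mulVecLin (1 + θ • B.map Complex.ofReal))).2 fun η hη => ?_
  rw [mulVecLin_apply] at hη
  set u : ι → ℝ := fun j => (η j).re with hu
  set v : ι → ℝ := fun j => (η j).im with hv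
  have hre : (1 + θ.re • B) *ᵥ u = θ.im • B *ᵥ v := by
    ext i
    have h := re_mulVec_one_add_smul_map B θ η i
    rw [hη] at h
    simpa [sub_eq_zero] using h.symm
  have him : (1 + θ.re • B) *ᵥ v = -(θ.im • B *ᵥ u) := by
    ext i
    have h := im_mulVec_one_add_smul_map B θ η i
    rw [hη] at h
    exact eq_neg_of_add_eq_zero_left h.symm
  have hsum : u ⬝ᵥ (1 + θ.re • B) *ᵥ u + v ⬝ᵥ (1 + θ.re • B) *ᵥ v = 0 := by
    rw [hre, him, dotProduct_neg, dotProduct_smul, dotProduct_smul,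
      hB.dotProduct_mulVec_comm u v, add_neg_cancel]
  have hnonneg (x : ι → ℝ) : 0 ≤ x ⬝ᵥ (1 + θ.re • B) *ᵥ x := by
    simpa using hpos.posSemidef.dotProduct_mulVec_nonneg x
  have hzero (x : ι → ℝ) (hx : x ⬝ᵥ (1 + θ.re • B) *ᵥ x ≤ 0) : x = 0 := by
    by_contra hne
    have h := hpos.dotProduct_mulVec_pos hne
    rw [star_trivial] at h
    exact hx.not_gt h
  have hu0 : u = 0 := hzero u (by linarith [hnonneg v])
  have hv0 : v = 0 := hzero v (by linarith [hnonneg u])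
  ext i
  exact Complex.ext (congrFun hu0 i) (congrFun hv0 i)

/-- If `B ≤ 0` and `1 + a • B ≥ 0`, then the product `B * (1 + a • B)` is negative semidefinite. -/
lemma dotProduct_one_add_smul_mulVec_nonpos {B : Matrix ι ι ℝ} (hB : B.IsSymm)
    (hneg : ∀ x, x ⬝ᵥ B *ᵥ x ≤ 0) {a : ℝ} (hpos : (1 + a • B).PosSemidef) (w : ι → ℝ) :
    ((1 + a • B) *ᵥ w) ⬝ᵥ B *ᵥ w ≤ 0 := by
  have hexp (x y : ι → ℝ) : ((1 + a • B) *ᵥ x) ⬝ᵥ y = x ⬝ᵥ y + a * (B *ᵥ x) ⬝ᵥ y := by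
    simp [add_mulVec, smul_mulVec, add_dotProduct]
  rw [hexp]
  set y := B *ᵥ w with hy
  have hyy : 0 ≤ y ⬝ᵥ y := by simpa using dotProduct_star_self_nonneg y
  have hw : w ⬝ᵥ y ≤ 0 := hneg w
  rcases le_total a 0 with ha | ha
  · nlinarith
  have hBwy : (w + a • y) ⬝ᵥ B *ᵥ (w + a • y) =
      w ⬝ᵥ y + 2 * a * y ⬝ᵥ y + a ^ 2 * y ⬝ᵥ B *ᵥ y := by
    have h := hB.dotProduct_mulVec_comm w y
    simp only [mulVec_add, mulVec_smul, dotProduct_add, add_dotProduct, smul_dotProduct,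
      dotProduct_smul, smul_eq_mul, h, ← hy]
    ring
  have hA : 0 ≤ y ⬝ᵥ y + a * y ⬝ᵥ B *ᵥ y := by
    have h := hpos.dotProduct_mulVec_nonneg y
    rwa [star_trivial, dotProduct_comm, hexp, dotProduct_comm (B *ᵥ y)] at h
  have h := hneg (w + a • y)
  rw [hBwy] at h
  nlinarith [mul_nonneg ha hA]

lemma im_sum_sq_nonpos {B : Matrix ι ι ℝ} (hB : B.IsSymm) (hneg : ∀ x, x ⬝ᵥ B *ᵥ x ≤ 0)
    {θ : ℂ} (hθ : θ.im ≤ 0) (hpos : (1 + θ.re • B).PosDef) {η : ι → ℂ}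
    (hη : ∀ i, (((1 + θ • B.map Complex.ofReal) *ᵥ η) i).im = 0) :
    (∑ i, η i ^ 2).im ≤ 0 := by
  set u : ι → ℝ := fun j => (η j).re with hu
  set v : ι → ℝ := fun j => (η j).im with hv
  obtain ⟨w, hw⟩ : ∃ w, (1 + θ.re • B) *ᵥ w = u :=
    mulVec_surjective_iff_isUnit.2 hpos.isUnit u
  have hcomm : (1 + θ.re • B) *ᵥ B *ᵥ w = B *ᵥ u := by
    rw [← hw, mulVec_mulVec, mulVec_mulVec]
    congr 1
    simp [add_mul, mul_add]
  have hvw : v = -(θ.im • B *ᵥ w) := by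
    apply mulVec_injective_of_isUnit hpos.isUnit
    ext i
    have h := im_mulVec_one_add_smul_map B θ η i
    rw [hη i] at h
    rw [mulVec_neg, mulVec_smul, hcomm]
    exact eq_neg_of_add_eq_zero_left h.symm
  have hsum : (∑ i, η i ^ 2).im = 2 * u ⬝ᵥ v := by
    simp only [Complex.im_sum, dotProduct, Finset.mul_sum, hu, hv]
    refine Finset.sum_congr rfl fun i _ => ?_
    rw [sq, Complex.mul_im]
    ring
  rw [hsum, hvw, dotProduct_neg, dotProduct_smul, smul_eq_mul, ← hw]
  nlinarith [dotProduct_one_add_smul_mulVec_nonpos hB hneg hpos.posSemidef w]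

end

/-- If `B` is a real symmetric negative semidefinite `n × n` matrix, `θ ∈ ℂ` has
`Im θ ≤ 0`, and the real matrix `I + (Re θ) • B` is positive definite, then the
complex matrix `I + θ • B` is invertible, and for every real vector `ξ` the
non-conjugated square sum of `η = (I + θ • B)⁻¹ ξ` has nonpositive imaginary part. -/
theorem stmt_0 (n : ℕ) (hn : 1 ≤ n) (B : Matrix (Fin n) (Fin n) ℝ)
    (hsymm : B.IsSymm)
    (hneg : ∀ ξ : Fin n → ℝ, ξ ⬝ᵥ B.mulVec ξ ≤ 0)
    (θ : ℂ) (hθ : θ.im ≤ 0)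
    (hpos : ((1 : Matrix (Fin n) (Fin n) ℝ) + θ.re • B).PosDef) :
    IsUnit ((1 : Matrix (Fin n) (Fin n) ℂ) + θ • B.map Complex.ofReal) ∧
      ∀ ξ : Fin n → ℝ,
        (∑ i, (((1 : Matrix (Fin n) (Fin n) ℂ) + θ • B.map Complex.ofReal)⁻¹.mulVec
            (fun j => (ξ j : ℂ)) i) ^ 2).im ≤ 0 := by
  have hunit := isUnit_one_add_smul_map hsymm hpos
  refine ⟨hunit, fun ξ => im_sum_sq_nonpos hsymm hneg hθ hpos fun i => ?_⟩
  rw [mulVec_mulVec, mul_nonsing_inv _ ((isUnit_iff_isUnit_det _).1 hunit), one_mulVec,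
    Complex.ofReal_im]
end

section
/- Let n ≥ 2, K > 0 and ρ ∈ ℝ, and let C(K,ρ) = {x ∈ ℝⁿ : ‖x'‖ ≤ K(x₁ + ρ)}, where x = (x₁, x') ∈ ℝ × ℝ^{n−1}. Then C(K,ρ) is a nonempty closed convex set, and for every x ∉ C(K,ρ), if p denotes the nearest point of C(K,ρ) to x (the metric projection of x onto the closed convex set C(K,ρ)), then x₁ − p₁ ≤ −(1 + K⁻²)^{−1/2}·‖x − p‖. -/
open scoped RealInnerProductSpace

section AxialCone

variable {E : Type*} [NormedAddCommGroup E] [InnerProductSpace ℝ E]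

/-- The component of `x` orthogonal to the line spanned by `e`, when `e` is a unit vector. -/
def transversal (e : E) : E →ₗ[ℝ] E where
  toFun x := x - ⟪e, x⟫ • e
  map_add' x y := by rw [inner_add_right, add_smul]; abel
  map_smul' c x := by
    simp only [inner_smul_right, mul_smul, RingHom.id_apply, smul_sub]

theorem transversal_apply (e x : E) : transversal e x = x - ⟪e, x⟫ • e := rfl

theorem inner_transversal {e : E} (he : ‖e‖ = 1) (x : E) : ⟪e, transversal e x⟫ = 0 := by
  simp [transversal_apply, inner_sub_right, inner_smul_right, he]

theorem transversal_idem {e : E} (he : ‖e‖ = 1) (x : E) :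
    transversal e (transversal e x) = transversal e x := by
  rw [transversal_apply, inner_transversal he, zero_smul, sub_zero]

theorem transversal_self {e : E} (he : ‖e‖ = 1) : transversal e e = 0 := by
  simp [transversal_apply, he]

theorem inner_self_transversal {e : E} (he : ‖e‖ = 1) (x : E) :
    ⟪x, transversal e x⟫ = ‖transversal e x‖ ^ 2 := by
  have hx : x = transversal e x + ⟪e, x⟫ • e := by simp [transversal_apply]
  nth_rewrite 1 [hx]
  rw [inner_add_left, real_inner_smul_left, inner_transversal he, real_inner_self_eq_norm_sq,
    mul_zero, add_zero]

theorem norm_sq_transversal {e : E} (he : ‖e‖ = 1) (x : E) :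
    ‖transversal e x‖ ^ 2 = ‖x‖ ^ 2 - ⟪e, x⟫ ^ 2 := by
  rw [← inner_self_transversal he, transversal_apply, inner_sub_right, inner_smul_right,
    real_inner_self_eq_norm_sq, real_inner_comm]
  ring

/-- The cone with axis `e`, slope `K` and apex `-ρ • e`. -/
def axialCone (e : E) (K ρ : ℝ) : Set E :=
  {x | ‖transversal e x‖ ≤ K * (⟪e, x⟫ + ρ)}

theorem axialCone_nonempty {e : E} (he : ‖e‖ = 1) (K ρ : ℝ) : (axialCone e K ρ).Nonempty :=
  ⟨(-ρ) • e, by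
    simp only [axialCone, Set.mem_ofPred_eq, map_smul, transversal_self he]
    simp [inner_smul_right, he]⟩

theorem isClosed_axialCone (e : E) (K ρ : ℝ) : IsClosed (axialCone e K ρ) := by
  simp only [axialCone, transversal_apply]
  exact isClosed_le (by fun_prop) (by fun_prop)

theorem convex_axialCone (e : E) (K ρ : ℝ) : Convex ℝ (axialCone e K ρ) := by
  intro x hx y hy a b ha hb hab
  simp only [axialCone, Set.mem_ofPred_eq, map_add, map_smul, inner_add_right,
    inner_smul_right] at hx hy ⊢
  calc ‖a • transversal e x + b • transversal e y‖
      ≤ a * ‖transversal e x‖ + b * ‖transversal e y‖ := by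
        refine (norm_add_le _ _).trans_eq ?_
        rw [norm_smul_of_nonneg ha, norm_smul_of_nonneg hb]
    _ ≤ a * (K * (⟪e, x⟫ + ρ)) + b * (K * (⟪e, y⟫ + ρ)) := by gcongr
    _ = K * (a * ⟪e, x⟫ + b * ⟪e, y⟫ + ρ) := by
        linear_combination K * ρ * hab

theorem add_mem_axialCone {e p w : E} {K ρ : ℝ} (hp : p ∈ axialCone e K ρ)
    (hw : w ∈ axialCone e K 0) : p + w ∈ axialCone e K ρ := by
  simp only [axialCone, Set.mem_ofPred_eq, map_add, inner_add_right] at hp hw ⊢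
  linarith [norm_add_le (transversal e p) (transversal e w)]

theorem Convex.inner_sub_nonpos_of_forall_dist_le {s : Set E} (hs : Convex ℝ s) {x p : E}
    (hp : p ∈ s) (hmin : ∀ q ∈ s, dist x p ≤ dist x q) {q : E} (hq : q ∈ s) :
    ⟪x - p, q - p⟫ ≤ 0 := by
  refine (norm_eq_iInf_iff_real_inner_le_zero hs hp).1 (le_antisymm ?_ ?_) q hq
  · have : Nonempty s := ⟨⟨p, hp⟩⟩
    exact le_ciInf fun w => by simpa only [dist_eq_norm] using hmin w w.2
  · exact ciInf_le ⟨0, Set.forall_mem_range.2 fun _ => norm_nonneg _⟩ (⟨p, hp⟩ : s)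

/-- The polar of the cone `axialCone e K 0` is contained in a cone around `-e`. -/
theorem inner_le_of_forall_inner_nonpos {e : E} (he : ‖e‖ = 1) {K : ℝ} (hK : 0 < K) {v : E}
    (hv : ∀ w ∈ axialCone e K 0, ⟪v, w⟫ ≤ 0) : ⟪e, v⟫ ≤ -(K * ‖transversal e v‖) := by
  rcases (norm_nonneg (transversal e v)).eq_or_lt with h | h
  · have := hv e (by simp [axialCone, transversal_self he, he, hK.le])
    rw [real_inner_comm] at this
    simpa [← h] using this
  · have := hv (‖transversal e v‖ • e + K • transversal e v) (by
      simp only [axialCone, Set.mem_ofPred_eq, map_add, map_smul, transversal_self he,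
        transversal_idem he, inner_add_right, inner_smul_right, inner_transversal he,
        norm_smul_of_nonneg hK.le, smul_zero, zero_add, real_inner_self_eq_norm_sq, he]
      simp)
    rw [inner_add_right, inner_smul_right, inner_smul_right, inner_self_transversal he,
      real_inner_comm] at this
    nlinarith

theorem inner_sub_le_of_forall_dist_le {e : E} (he : ‖e‖ = 1) {K ρ : ℝ} (hK : 0 < K) {x p : E}
    (hp : p ∈ axialCone e K ρ) (hmin : ∀ q ∈ axialCone e K ρ, dist x p ≤ dist x q) :
    ⟪e, x - p⟫ ≤ -((1 + (K ^ 2)⁻¹) ^ (-(1 / 2 : ℝ))) * ‖x - p‖ := by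
  have hv : ⟪e, x - p⟫ ≤ -(K * ‖transversal e (x - p)‖) :=
    inner_le_of_forall_inner_nonpos he hK fun w hw => by
      simpa using (convex_axialCone e K ρ).inner_sub_nonpos_of_forall_dist_le hp hmin
        (add_mem_axialCone hp hw)
  have hnorm := norm_sq_transversal he (x - p)
  set v := x - p
  have hpos : 0 < 1 + (K ^ 2)⁻¹ := by positivity
  have hle : ‖v‖ ≤ √(1 + (K ^ 2)⁻¹) * -⟪e, v⟫ := by
    have hKt : 0 ≤ K * ‖transversal e v‖ := by positivity
    refine le_of_sq_le_sq ?_ (mul_nonneg (Real.sqrt_nonneg _) (by linarith))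
    have hsq : (K * ‖transversal e v‖) ^ 2 ≤ ⟪e, v⟫ ^ 2 := by nlinarith
    have hdiv : ‖transversal e v‖ ^ 2 ≤ (K ^ 2)⁻¹ * ⟪e, v⟫ ^ 2 := by
      rw [inv_mul_eq_div, le_div_iff₀ (by positivity)]
      linarith
    rw [mul_pow, Real.sq_sqrt hpos.le]
    linarith
  rw [Real.rpow_neg hpos.le, ← Real.sqrt_eq_rpow, neg_mul, le_neg,
    inv_mul_le_iff₀ (Real.sqrt_pos.2 hpos)]
  exact hle

end AxialCone

theorem EuclideanSpace.norm_transversal_single {ι : Type*} [Fintype ι] [DecidableEq ι] (i : ι)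
    (x : EuclideanSpace ℝ ι) :
    ‖transversal (EuclideanSpace.single i (1 : ℝ)) x‖ =
      √(∑ j ∈ Finset.univ.erase i, x j ^ 2) := by
  rw [← Real.sqrt_sq (norm_nonneg _), norm_sq_transversal (by simp),
    EuclideanSpace.real_norm_sq_eq, ← Finset.add_sum_erase _ _ (Finset.mem_univ i)]
  simp [EuclideanSpace.inner_single_left]

theorem EuclideanSpace.axialCone_single {ι : Type*} [Fintype ι] [DecidableEq ι] (i : ι)
    (K ρ : ℝ) :
    axialCone (EuclideanSpace.single i (1 : ℝ)) K ρ =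
      {x | √(∑ j ∈ Finset.univ.erase i, x j ^ 2) ≤ K * (x i + ρ)} := by
  simp [axialCone, EuclideanSpace.norm_transversal_single, EuclideanSpace.inner_single_left]

/-- The cone `C(K,ρ) = {x : ‖x'‖ ≤ K (x₁ + ρ)}` is a nonempty closed convex set, and if
`p` is the metric projection onto it of a point `x ∉ C(K,ρ)`, then
`x₁ − p₁ ≤ −(1 + K⁻²)^{−1/2} ‖x − p‖`. -/
theorem stmt_2 (n : ℕ) (hn : 2 ≤ n) (K : ℝ) (hK : 0 < K) (ρ : ℝ) :
    (Set.Nonempty {x : EuclideanSpace ℝ (Fin n) |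
        Real.sqrt (∑ i ∈ Finset.univ.erase ⟨0, by omega⟩, x i ^ 2) ≤
          K * (x ⟨0, by omega⟩ + ρ)}) ∧
    IsClosed {x : EuclideanSpace ℝ (Fin n) |
        Real.sqrt (∑ i ∈ Finset.univ.erase ⟨0, by omega⟩, x i ^ 2) ≤
          K * (x ⟨0, by omega⟩ + ρ)} ∧
    Convex ℝ {x : EuclideanSpace ℝ (Fin n) |
        Real.sqrt (∑ i ∈ Finset.univ.erase ⟨0, by omega⟩, x i ^ 2) ≤
          K * (x ⟨0, by omega⟩ + ρ)} ∧
    ∀ x : EuclideanSpace ℝ (Fin n),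
      x ∉ {x : EuclideanSpace ℝ (Fin n) |
        Real.sqrt (∑ i ∈ Finset.univ.erase ⟨0, by omega⟩, x i ^ 2) ≤
          K * (x ⟨0, by omega⟩ + ρ)} →
      ∀ p ∈ {x : EuclideanSpace ℝ (Fin n) |
        Real.sqrt (∑ i ∈ Finset.univ.erase ⟨0, by omega⟩, x i ^ 2) ≤
          K * (x ⟨0, by omega⟩ + ρ)},
        (∀ q ∈ {x : EuclideanSpace ℝ (Fin n) |
          Real.sqrt (∑ i ∈ Finset.univ.erase ⟨0, by omega⟩, x i ^ 2) ≤
            K * (x ⟨0, by omega⟩ + ρ)}, dist x p ≤ dist x q) →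
        x ⟨0, by omega⟩ - p ⟨0, by omega⟩ ≤
          -((1 + (K ^ 2)⁻¹) ^ (-(1 / 2 : ℝ))) * ‖x - p‖ := by
  have he : ‖EuclideanSpace.single (⟨0, by omega⟩ : Fin n) (1 : ℝ)‖ = 1 := by simp
  simp only [← EuclideanSpace.axialCone_single]
  refine ⟨axialCone_nonempty he K ρ, isClosed_axialCone _ K ρ, convex_axialCone _ K ρ,
    fun x _ p hp hmin => ?_⟩
  simpa [EuclideanSpace.inner_single_left] using inner_sub_le_of_forall_dist_le he hK hp hmin
end

section
/- Let n ≥ 1, β > 0, let V : ℝⁿ → ℝ be a smooth function all of whose derivatives (including V itself) are bounded, and let z ∈ ℂ with Im z ≠ 0. Then for every Schwartz function f ∈ 𝒮(ℝⁿ; ℂ) there exists a unique Schwartz function u ∈ 𝒮(ℝⁿ; ℂ) such that −Δu(x) + (βx₁ + V(x) − z)·u(x) = f(x) for all x ∈ ℝⁿ. -/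
/-- The Laplacian of a complex-valued function on `ℝⁿ`, as the sum of the pure second
derivatives in the coordinate directions. -/
noncomputable def laplacian {n : ℕ} (u : EuclideanSpace ℝ (Fin n) → ℂ)
    (x : EuclideanSpace ℝ (Fin n)) : ℂ :=
  ∑ i : Fin n,
    iteratedFDeriv ℝ 2 u x ![EuclideanSpace.single i 1, EuclideanSpace.single i 1]


open SchwartzMap MeasureTheory
open scoped LineDeriv ContDiff FourierTransform

namespace Stark

variable {n : ℕ}

/-- The partial derivative `∂/∂xⱼ` on Schwartz space. -/
noncomputable def partialD (j : Fin n) :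
    𝓢(EuclideanSpace ℝ (Fin n), ℂ) →L[ℂ] 𝓢(EuclideanSpace ℝ (Fin n), ℂ) :=
  LineDeriv.lineDerivOpCLM ℂ 𝓢(EuclideanSpace ℝ (Fin n), ℂ) (EuclideanSpace.single j (1 : ℝ))

/-- Multiplication by the coordinate function `xⱼ` on Schwartz space. -/
noncomputable def coordMul (j : Fin n) :
    𝓢(EuclideanSpace ℝ (Fin n), ℂ) →L[ℂ] 𝓢(EuclideanSpace ℝ (Fin n), ℂ) :=
  smulLeftCLM ℂ (fun x : EuclideanSpace ℝ (Fin n) ↦ ((x j : ℝ) : ℂ))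

/-- The Laplacian on Schwartz space, as a sum of squares of partial derivatives. -/
noncomputable def lap (n : ℕ) :
    𝓢(EuclideanSpace ℝ (Fin n), ℂ) →L[ℂ] 𝓢(EuclideanSpace ℝ (Fin n), ℂ) :=
  ∑ j, (partialD j).comp (partialD j)

/-- The Schrödinger operator `-Δ + G` on Schwartz space. -/
noncomputable def schrodinger (G : EuclideanSpace ℝ (Fin n) → ℂ) :
    𝓢(EuclideanSpace ℝ (Fin n), ℂ) →L[ℂ] 𝓢(EuclideanSpace ℝ (Fin n), ℂ) :=
  -lap n + smulLeftCLM ℂ G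

theorem hasTemperateGrowth_coord (j : Fin n) :
    (fun x : EuclideanSpace ℝ (Fin n) ↦ ((x j : ℝ) : ℂ)).HasTemperateGrowth :=
  (Complex.ofRealCLM.comp (EuclideanSpace.proj (𝕜 := ℝ) j)).hasTemperateGrowth

theorem partialD_apply (j : Fin n) (u : 𝓢(EuclideanSpace ℝ (Fin n), ℂ))
    (x : EuclideanSpace ℝ (Fin n)) :
    partialD j u x = fderiv ℝ u x (EuclideanSpace.single j 1) := rfl

theorem coordMul_apply (j : Fin n) (u : 𝓢(EuclideanSpace ℝ (Fin n), ℂ))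
    (x : EuclideanSpace ℝ (Fin n)) : coordMul j u x = (x j : ℂ) * u x := by
  simp [coordMul, smulLeftCLM_apply_apply (hasTemperateGrowth_coord j)]

theorem lap_eq_sum (u : 𝓢(EuclideanSpace ℝ (Fin n), ℂ)) :
    lap n u = ∑ j, partialD j (partialD j u) := by
  simp [lap]

theorem lap_apply (u : 𝓢(EuclideanSpace ℝ (Fin n), ℂ)) (x : EuclideanSpace ℝ (Fin n)) :
    lap n u x = laplacian u x := by
  rw [lap_eq_sum, laplacian, _root_.sum_apply]
  refine Finset.sum_congr rfl fun j _ ↦ ?_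
  rw [← iteratedLineDerivOp_eq_iteratedFDeriv]
  simp [LineDeriv.iteratedLineDerivOp_succ_left, partialD]

theorem schrodinger_apply (G : EuclideanSpace ℝ (Fin n) → ℂ)
    (u : 𝓢(EuclideanSpace ℝ (Fin n), ℂ)) :
    schrodinger G u = -lap n u + smulLeftCLM ℂ G u := by
  simp [schrodinger]

theorem partialD_comm (i j : Fin n) (u : 𝓢(EuclideanSpace ℝ (Fin n), ℂ)) :
    partialD i (partialD j u) = partialD j (partialD i u) := by
  have key (i j : Fin n) (x : EuclideanSpace ℝ (Fin n)) : partialD i (partialD j u) x =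
      fderiv ℝ (fderiv ℝ u) x (EuclideanSpace.single i 1) (EuclideanSpace.single j 1) := by
    rw [partialD_apply, show ⇑(partialD j u) = fun y ↦ fderiv ℝ u y (EuclideanSpace.single j 1)
      from rfl, fderiv_clm_apply]
    · simp
    · exact ((u.smooth 2).fderiv_right (m := 1) (by norm_num)).differentiable (by simp) x
    · fun_prop
  ext x
  rw [key, key]
  exact (u.smooth 2).contDiffAt.isSymmSndFDerivAt (by simp) _ _

theorem partialD_smulLeft {G G' : EuclideanSpace ℝ (Fin n) → ℂ} (hG : G.HasTemperateGrowth)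
    (hG' : G'.HasTemperateGrowth) (j : Fin n)
    (h : ∀ x, fderiv ℝ G x (EuclideanSpace.single j 1) = G' x)
    (u : 𝓢(EuclideanSpace ℝ (Fin n), ℂ)) :
    partialD j (smulLeftCLM ℂ G u) = smulLeftCLM ℂ G (partialD j u) + smulLeftCLM ℂ G' u := by
  ext x
  rw [_root_.add_apply, smulLeftCLM_apply_apply hG, smulLeftCLM_apply_apply hG',
    partialD_apply, partialD_apply, smulLeftCLM_apply hG]
  simp only [smul_eq_mul]
  rw [fderiv_fun_mul (hG.1.differentiable (by simp) x) u.differentiableAt]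
  simp [h, mul_comm]

theorem fderiv_coord (i j : Fin n) (x : EuclideanSpace ℝ (Fin n)) :
    fderiv ℝ (fun x : EuclideanSpace ℝ (Fin n) ↦ ((x i : ℝ) : ℂ)) x (EuclideanSpace.single j 1)
      = if i = j then 1 else 0 := by
  have := (Complex.ofRealCLM.comp (EuclideanSpace.proj (𝕜 := ℝ) i)).fderiv (x := x)
  rw [show (fun x : EuclideanSpace ℝ (Fin n) ↦ ((x i : ℝ) : ℂ)) =
    (Complex.ofRealCLM.comp (EuclideanSpace.proj (𝕜 := ℝ) i)) from rfl, this]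
  by_cases h : i = j <;> simp [h]

theorem partialD_coordMul (i j : Fin n) (u : 𝓢(EuclideanSpace ℝ (Fin n), ℂ)) :
    partialD i (coordMul j u) = coordMul j (partialD i u) + if j = i then u else 0 := by
  rw [coordMul, partialD_smulLeft (hasTemperateGrowth_coord j)
    (Function.HasTemperateGrowth.const (if j = i then (1 : ℂ) else 0)) i (fderiv_coord j i),
    smulLeftCLM_const]
  by_cases h : j = i <;> simp [h]

theorem coordMul_smulLeft {G : EuclideanSpace ℝ (Fin n) → ℂ} (hG : G.HasTemperateGrowth)
    (j : Fin n) (u : 𝓢(EuclideanSpace ℝ (Fin n), ℂ)) :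
    coordMul j (smulLeftCLM ℂ G u) = smulLeftCLM ℂ G (coordMul j u) := by
  rw [coordMul, smulLeftCLM_smulLeftCLM_apply (hasTemperateGrowth_coord j) hG,
    smulLeftCLM_smulLeftCLM_apply hG (hasTemperateGrowth_coord j), mul_comm]

theorem lap_partialD (j : Fin n) (u : 𝓢(EuclideanSpace ℝ (Fin n), ℂ)) :
    lap n (partialD j u) = partialD j (lap n u) := by
  simp_rw [lap_eq_sum, map_sum]
  refine Finset.sum_congr rfl fun i _ ↦ ?_
  rw [partialD_comm i j, partialD_comm i j]

theorem lap_coordMul (j : Fin n) (u : 𝓢(EuclideanSpace ℝ (Fin n), ℂ)) :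
    lap n (coordMul j u) = coordMul j (lap n u) + (2 : ℂ) • partialD j u := by
  simp_rw [lap_eq_sum, map_sum, partialD_coordMul, map_add, partialD_coordMul,
    Finset.sum_add_distrib, add_assoc]
  congr 1
  have : ∀ i : Fin n, partialD i (if j = i then u else 0) = if j = i then partialD i u else 0 := by
    intro i; split_ifs <;> simp
  simp [this, two_smul]

theorem schrodinger_partialD {G G' : EuclideanSpace ℝ (Fin n) → ℂ} (hG : G.HasTemperateGrowth)
    (hG' : G'.HasTemperateGrowth) (j : Fin n)
    (h : ∀ x, fderiv ℝ G x (EuclideanSpace.single j 1) = G' x)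
    (u : 𝓢(EuclideanSpace ℝ (Fin n), ℂ)) :
    schrodinger G (partialD j u) = partialD j (schrodinger G u) - smulLeftCLM ℂ G' u := by
  rw [schrodinger_apply, schrodinger_apply, map_add, map_neg, lap_partialD,
    partialD_smulLeft hG hG' j h]
  abel

theorem schrodinger_coordMul {G : EuclideanSpace ℝ (Fin n) → ℂ} (hG : G.HasTemperateGrowth)
    (j : Fin n) (u : 𝓢(EuclideanSpace ℝ (Fin n), ℂ)) :
    schrodinger G (coordMul j u) = coordMul j (schrodinger G u) - (2 : ℂ) • partialD j u := by
  rw [schrodinger_apply, schrodinger_apply, map_add, map_neg, lap_coordMul,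
    coordMul_smulLeft hG]
  abel

/-- The embedding of Schwartz space into `L²`. -/
noncomputable def toL2 (n : ℕ) : 𝓢(EuclideanSpace ℝ (Fin n), ℂ) →L[ℂ]
    Lp ℂ 2 (volume : Measure (EuclideanSpace ℝ (Fin n))) :=
  toLpCLM ℂ ℂ 2 (volume : Measure (EuclideanSpace ℝ (Fin n)))

/-- The `L²` norm, as a seminorm on Schwartz space. -/
noncomputable def l2Seminorm (n : ℕ) : Seminorm ℂ 𝓢(EuclideanSpace ℝ (Fin n), ℂ) :=
  (normSeminorm ℂ (Lp ℂ 2 (volume : Measure (EuclideanSpace ℝ (Fin n))))).comp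
    (toL2 n).toLinearMap

theorem l2Seminorm_apply (u : 𝓢(EuclideanSpace ℝ (Fin n), ℂ)) :
    l2Seminorm n u = ‖toL2 n u‖ := rfl

theorem inner_toL2 (u v : 𝓢(EuclideanSpace ℝ (Fin n), ℂ)) :
    inner ℂ (toL2 n u) (toL2 n v) = ∫ x, inner ℂ (u x) (v x) :=
  inner_toL2_toL2_eq u v volume

theorem eq_zero_of_l2Seminorm_le_zero {u : 𝓢(EuclideanSpace ℝ (Fin n), ℂ)}
    (h : l2Seminorm n u ≤ 0) : u = 0 := by
  have h0 : toL2 n u = toL2 n 0 := by rw [map_zero]; exact norm_le_zero_iff.1 h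
  exact injective_toLp 2 (volume : Measure (EuclideanSpace ℝ (Fin n))) h0

theorem l2Seminorm_smulLeft_le {W : EuclideanSpace ℝ (Fin n) → ℂ} (hW : W.HasTemperateGrowth)
    {C : ℝ} (hC : ∀ x, ‖W x‖ ≤ C) (u : 𝓢(EuclideanSpace ℝ (Fin n), ℂ)) :
    l2Seminorm n (smulLeftCLM ℂ W u) ≤ C * l2Seminorm n u := by
  refine Lp.norm_le_mul_norm_of_ae_le_mul ?_
  filter_upwards [coeFn_toLp (smulLeftCLM ℂ W u) 2 volume, coeFn_toLp u 2 volume] with x h1 h2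
  change ‖(smulLeftCLM ℂ W u).toLp 2 volume x‖ ≤ C * ‖u.toLp 2 volume x‖
  rw [h1, h2, smulLeftCLM_apply_apply hW, norm_smul]
  gcongr
  exact hC x

theorem inner_partialD (j : Fin n) (u v : 𝓢(EuclideanSpace ℝ (Fin n), ℂ)) :
    inner ℂ (toL2 n u) (toL2 n (partialD j v)) = -inner ℂ (toL2 n (partialD j u)) (toL2 n v) := by
  rw [inner_toL2, inner_toL2]
  have := integral_bilinear_lineDerivOp_right_eq_neg_left (μ := volume) u v
    ((ContinuousLinearMap.mul ℝ ℂ).comp (Complex.conjCLE : ℂ →L[ℝ] ℂ))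
    (EuclideanSpace.single j (1 : ℝ))
  simpa [RCLike.inner_apply, mul_comm, partialD] using this

/-- The quadratic form of the Laplacian is real. -/
theorem im_inner_lap (u : 𝓢(EuclideanSpace ℝ (Fin n), ℂ)) :
    (inner ℂ (toL2 n u) (toL2 n (lap n u))).im = 0 := by
  rw [lap_eq_sum, map_sum, inner_sum, Complex.im_sum]
  refine Finset.sum_eq_zero fun j _ ↦ ?_
  rw [inner_partialD, Complex.neg_im, neg_eq_zero]
  exact inner_self_im (𝕜 := ℂ) _

theorem integrable_inner (u v : 𝓢(EuclideanSpace ℝ (Fin n), ℂ)) :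
    Integrable fun x ↦ inner ℂ (u x) (v x) :=
  (pairing (ContinuousLinearMap.mul ℝ ℂ)
    (postcompCLM (Complex.conjCLE : ℂ →L[ℝ] ℂ) u) v).integrable.congr
    (Filter.Eventually.of_forall fun x ↦ by simp [RCLike.inner_apply, mul_comm])

theorem norm_toL2_sq (u : 𝓢(EuclideanSpace ℝ (Fin n), ℂ)) :
    ‖toL2 n u‖ ^ 2 = ∫ x, ‖u x‖ ^ 2 := by
  rw [← inner_self_eq_norm_sq (𝕜 := ℂ), inner_toL2, ← integral_re (integrable_inner u u)]
  exact integral_congr_ae (Filter.Eventually.of_forall fun x ↦ inner_self_eq_norm_sq (𝕜 := ℂ) _)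

theorem im_inner_smulLeft {G : EuclideanSpace ℝ (Fin n) → ℂ} (hG : G.HasTemperateGrowth)
    {c : ℝ} (hc : ∀ x, (G x).im = c) (u : 𝓢(EuclideanSpace ℝ (Fin n), ℂ)) :
    (inner ℂ (toL2 n u) (toL2 n (smulLeftCLM ℂ G u))).im = c * ‖toL2 n u‖ ^ 2 := by
  rw [inner_toL2, norm_toL2_sq, ← integral_const_mul]
  have := integral_im (integrable_inner u (smulLeftCLM ℂ G u))
  simp only [RCLike.im_to_complex] at this
  rw [← this]
  refine integral_congr_ae (Filter.Eventually.of_forall fun x ↦ ?_)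
  simp only [smulLeftCLM_apply_apply hG, smul_eq_mul, RCLike.inner_apply]
  rw [mul_assoc, Complex.mul_conj, Complex.im_mul_ofReal, hc, Complex.normSq_eq_norm_sq]

/-- The basic resolvent estimate in `L²`. -/
theorem l2Seminorm_le_schrodinger {G : EuclideanSpace ℝ (Fin n) → ℂ} (hG : G.HasTemperateGrowth)
    {c : ℝ} (hc : ∀ x, (G x).im = c) (u : 𝓢(EuclideanSpace ℝ (Fin n), ℂ)) :
    |c| * l2Seminorm n u ≤ l2Seminorm n (schrodinger G u) := by
  simp only [l2Seminorm_apply]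
  have h : (inner ℂ (toL2 n u) (toL2 n (schrodinger G u))).im = c * ‖toL2 n u‖ ^ 2 := by
    rw [schrodinger_apply, map_add, map_neg, inner_add_right, inner_neg_right, Complex.add_im,
      Complex.neg_im, im_inner_lap, im_inner_smulLeft hG hc]
    simp
  have h2 : |c| * ‖toL2 n u‖ ^ 2 ≤ ‖toL2 n u‖ * ‖toL2 n (schrodinger G u)‖ := by
    calc |c| * ‖toL2 n u‖ ^ 2 = |(inner ℂ (toL2 n u) (toL2 n (schrodinger G u))).im| := by
          rw [h, abs_mul, abs_of_nonneg (sq_nonneg ‖toL2 n u‖)]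
      _ ≤ _ := (Complex.abs_im_le_norm _).trans (norm_inner_le_norm _ _)
  rcases (norm_nonneg (toL2 n u)).eq_or_lt with h0 | h0
  · rw [← h0]; simp
  · refine le_of_mul_le_mul_left ?_ h0
    linarith

/-- Smooth functions all of whose derivatives are bounded. -/
def IsSmoothBounded (W : EuclideanSpace ℝ (Fin n) → ℂ) : Prop :=
  ContDiff ℝ ∞ W ∧ ∀ k : ℕ, ∃ C : ℝ, ∀ x, ‖iteratedFDeriv ℝ k W x‖ ≤ C

theorem IsSmoothBounded.hasTemperateGrowth {W : EuclideanSpace ℝ (Fin n) → ℂ}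
    (hW : IsSmoothBounded W) : W.HasTemperateGrowth :=
  ⟨hW.1, fun k ↦ let ⟨C, hC⟩ := hW.2 k; ⟨0, C, by simpa using hC⟩⟩

theorem IsSmoothBounded.bounded {W : EuclideanSpace ℝ (Fin n) → ℂ}
    (hW : IsSmoothBounded W) : ∃ C : ℝ, 0 ≤ C ∧ ∀ x, ‖W x‖ ≤ C := by
  obtain ⟨C, hC⟩ := hW.2 0
  simp only [norm_iteratedFDeriv_zero] at hC
  exact ⟨C, (norm_nonneg _).trans (hC 0), hC⟩

theorem IsSmoothBounded.const (c : ℂ) :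
    IsSmoothBounded (fun _ : EuclideanSpace ℝ (Fin n) ↦ c) := by
  refine ⟨contDiff_const, fun k ↦ ?_⟩
  rcases k with _ | k
  · exact ⟨‖c‖, by simp⟩
  · exact ⟨0, fun x ↦ by rw [iteratedFDeriv_const_of_ne (by simp)]; simp⟩

theorem IsSmoothBounded.fderiv_apply {W : EuclideanSpace ℝ (Fin n) → ℂ}
    (hW : IsSmoothBounded W) (v : EuclideanSpace ℝ (Fin n)) :
    IsSmoothBounded (fun x ↦ fderiv ℝ W x v) := by
  have hs : ContDiff ℝ ∞ (fderiv ℝ W) := hW.1.fderiv_right (by simp)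
  refine ⟨hs.clm_apply contDiff_const, fun k ↦ ?_⟩
  obtain ⟨C, hC⟩ := hW.2 (k + 1)
  refine ⟨‖v‖ * C, fun x ↦ ?_⟩
  calc _ ≤ ‖v‖ * ‖iteratedFDeriv ℝ k (fderiv ℝ W) x‖ :=
        norm_iteratedFDeriv_clm_apply_const (hs.of_le (by exact_mod_cast le_top)).contDiffAt le_rfl
    _ ≤ _ := by
        rw [norm_iteratedFDeriv_fderiv]
        gcongr
        exact hC x

/-- The seminorm `u ↦ ∑ⱼ p₁(∂ⱼ u) + ∑ⱼ p₀(xⱼ u)`. -/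
noncomputable def graded (p₁ p₀ : Seminorm ℂ 𝓢(EuclideanSpace ℝ (Fin n), ℂ)) :
    Seminorm ℂ 𝓢(EuclideanSpace ℝ (Fin n), ℂ) :=
  ∑ j, p₁.comp (partialD j).toLinearMap + ∑ j, p₀.comp (coordMul j).toLinearMap

theorem graded_apply (p₁ p₀ : Seminorm ℂ 𝓢(EuclideanSpace ℝ (Fin n), ℂ))
    (u : 𝓢(EuclideanSpace ℝ (Fin n), ℂ)) :
    graded p₁ p₀ u = ∑ j, p₁ (partialD j u) + ∑ j, p₀ (coordMul j u) := by
  rw [graded, _root_.add_apply, _root_.sum_apply, _root_.sum_apply]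
  rfl

theorem graded_le {p₁ p₀ q₁ q₀ : Seminorm ℂ 𝓢(EuclideanSpace ℝ (Fin n), ℂ)} {a b : ℝ}
    (ha : 0 ≤ a) (hb : 0 ≤ b) (h₁ : ∀ u, p₁ u ≤ a * q₁ u) (h₀ : ∀ u, p₀ u ≤ b * q₀ u)
    (u : 𝓢(EuclideanSpace ℝ (Fin n), ℂ)) :
    graded p₁ p₀ u ≤ (a + b) * graded q₁ q₀ u := by
  have s₁ : 0 ≤ ∑ j, q₁ (partialD j u) := Finset.sum_nonneg fun j _ ↦ apply_nonneg _ _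
  have s₀ : 0 ≤ ∑ j, q₀ (coordMul j u) := Finset.sum_nonneg fun j _ ↦ apply_nonneg _ _
  have t₁ : ∑ j, p₁ (partialD j u) ≤ a * ∑ j, q₁ (partialD j u) := by
    rw [Finset.mul_sum]; exact Finset.sum_le_sum fun j _ ↦ h₁ _
  have t₀ : ∑ j, p₀ (coordMul j u) ≤ b * ∑ j, q₀ (coordMul j u) := by
    rw [Finset.mul_sum]; exact Finset.sum_le_sum fun j _ ↦ h₀ _
  rw [graded_apply, graded_apply]
  nlinarith [mul_nonneg ha s₀, mul_nonneg hb s₁]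

/-- The scale of weighted Sobolev norms in which a derivative has order one and multiplication by
a coordinate has order two. The entry of index `k + 1` controls all `xᵃ∂ᵇu` in `L²` with
`2|a| + |b| ≤ k`. -/
noncomputable def scale (n : ℕ) : ℕ → Seminorm ℂ 𝓢(EuclideanSpace ℝ (Fin n), ℂ)
  | 0 => 0
  | 1 => l2Seminorm n
  | k + 2 => scale n (k + 1) + graded (scale n (k + 1)) (scale n k)

theorem scale_add_two (k : ℕ) (u : 𝓢(EuclideanSpace ℝ (Fin n), ℂ)) :
    scale n (k + 2) u = scale n (k + 1) u + graded (scale n (k + 1)) (scale n k) u := by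
  rw [scale]; rfl

theorem scale_le_succ (k : ℕ) (u : 𝓢(EuclideanSpace ℝ (Fin n), ℂ)) :
    scale n k u ≤ scale n (k + 1) u := by
  rcases k with _ | k
  · simp [scale]
  · rw [scale_add_two]
    linarith [apply_nonneg (graded (scale n (k + 1)) (scale n k)) u]

theorem scale_mono {k l : ℕ} (h : k ≤ l) (u : 𝓢(EuclideanSpace ℝ (Fin n), ℂ)) :
    scale n k u ≤ scale n l u :=
  monotone_nat_of_le_succ (f := fun k ↦ scale n k u) (fun k ↦ scale_le_succ k u) h

theorem scale_partialD_le (k : ℕ) (j : Fin n) (u : 𝓢(EuclideanSpace ℝ (Fin n), ℂ)) :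
    scale n k (partialD j u) ≤ scale n (k + 1) u := by
  rcases k with _ | k
  · simp [scale]
  · rw [scale_add_two, graded_apply]
    have h1 := Finset.single_le_sum (f := fun j ↦ scale n (k + 1) (partialD j u))
      (fun j _ ↦ apply_nonneg _ _) (Finset.mem_univ j)
    have h2 : 0 ≤ ∑ j, scale n k (coordMul j u) := Finset.sum_nonneg fun j _ ↦ apply_nonneg _ _
    have h3 := apply_nonneg (scale n (k + 1)) u
    linarith

theorem scale_coordMul_le (k : ℕ) (j : Fin n) (u : 𝓢(EuclideanSpace ℝ (Fin n), ℂ)) :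
    scale n k (coordMul j u) ≤ scale n (k + 2) u := by
  rw [scale_add_two, graded_apply]
  have h1 := Finset.single_le_sum (f := fun j ↦ scale n k (coordMul j u))
    (fun j _ ↦ apply_nonneg _ _) (Finset.mem_univ j)
  have h2 : 0 ≤ ∑ j, scale n (k + 1) (partialD j u) := Finset.sum_nonneg fun j _ ↦ apply_nonneg _ _
  have h3 := apply_nonneg (scale n (k + 1)) u
  linarith

theorem graded_smulLeft_le {p₁ p₀ : Seminorm ℂ 𝓢(EuclideanSpace ℝ (Fin n), ℂ)}
    {W : EuclideanSpace ℝ (Fin n) → ℂ} (hW : IsSmoothBounded W) {K : ℝ}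
    (h₁ : ∀ u, p₁ (smulLeftCLM ℂ W u) ≤ K * p₁ u) (h₀ : ∀ u, p₀ (smulLeftCLM ℂ W u) ≤ K * p₀ u)
    {c : Fin n → ℝ} (hc : ∀ j u, p₁ (smulLeftCLM ℂ
      (fun x ↦ fderiv ℝ W x (EuclideanSpace.single j 1)) u) ≤ c j * p₁ u)
    (u : 𝓢(EuclideanSpace ℝ (Fin n), ℂ)) :
    graded p₁ p₀ (smulLeftCLM ℂ W u) ≤ K * graded p₁ p₀ u + (∑ j, c j) * p₁ u := by
  simp only [graded_apply, mul_add, Finset.mul_sum, Finset.sum_mul]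
  have t₁ : ∑ j, p₁ (partialD j (smulLeftCLM ℂ W u)) ≤
      ∑ j, K * p₁ (partialD j u) + ∑ j, c j * p₁ u := by
    rw [← Finset.sum_add_distrib]
    refine Finset.sum_le_sum fun j _ ↦ ?_
    rw [partialD_smulLeft hW.hasTemperateGrowth (hW.fderiv_apply _).hasTemperateGrowth j fun x ↦ rfl]
    exact (map_add_le_add _ _ _).trans (add_le_add (h₁ _) (hc j u))
  have t₀ : ∑ j, p₀ (coordMul j (smulLeftCLM ℂ W u)) ≤ ∑ j, K * p₀ (coordMul j u) := by
    refine Finset.sum_le_sum fun j _ ↦ ?_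
    rw [coordMul_smulLeft hW.hasTemperateGrowth]
    exact h₀ _
  linarith

/-- Multiplication by a smooth function with bounded derivatives is bounded on the whole scale. -/
theorem scale_smulLeft_le (k : ℕ) {W : EuclideanSpace ℝ (Fin n) → ℂ} (hW : IsSmoothBounded W) :
    ∃ C : ℝ, 0 ≤ C ∧ ∀ u, scale n k (smulLeftCLM ℂ W u) ≤ C * scale n k u := by
  induction k using Nat.twoStepInduction generalizing W with
  | zero => exact ⟨0, le_rfl, by simp [scale]⟩
  | one =>
    obtain ⟨C, h0, hC⟩ := hW.bounded
    exact ⟨C, h0, l2Seminorm_smulLeft_le hW.hasTemperateGrowth hC⟩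
  | more k ih₀ ih₁ =>
    obtain ⟨C₀, hC₀, h₀⟩ := ih₀ hW
    obtain ⟨C₁, hC₁, h₁⟩ := ih₁ hW
    choose c hc0 hc using fun j : Fin n ↦ ih₁ (hW.fderiv_apply (EuclideanSpace.single j 1))
    have hs : 0 ≤ ∑ j, c j := Finset.sum_nonneg fun j _ ↦ hc0 j
    refine ⟨C₀ + C₁ + ∑ j, c j, by positivity, fun u ↦ ?_⟩
    have h := graded_smulLeft_le (p₁ := scale n (k + 1)) (p₀ := scale n k) (K := C₀ + C₁) hW
      (fun u ↦ (h₁ u).trans (by gcongr; linarith)) (fun u ↦ (h₀ u).trans (by gcongr; linarith)) hc u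
    rw [scale_add_two, scale_add_two]
    have p1 := apply_nonneg (scale n (k + 1)) u
    have p2 := apply_nonneg (graded (scale n (k + 1)) (scale n k)) u
    nlinarith [h₁ u, mul_nonneg hC₀ p1, mul_nonneg hs p2]

theorem exists_pos_mul_le {a b d e : ℝ} (ha : 0 ≤ a) (hb : 0 ≤ b) (hd : 0 < d) (he : 0 < e) :
    ∃ ε : NNReal, 0 < ε ∧ ε * a ≤ d ∧ ε * b ≤ e := by
  have hpos : 0 < min (d / (a + 1)) (e / (b + 1)) := by positivity
  refine ⟨⟨_, hpos.le⟩, hpos, ?_, ?_⟩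
  · calc min (d / (a + 1)) (e / (b + 1)) * a ≤ d / (a + 1) * (a + 1) := by
          gcongr
          · exact min_le_left _ _
          · linarith
      _ = d := by field_simp
  · calc min (d / (a + 1)) (e / (b + 1)) * b ≤ e / (b + 1) * (b + 1) := by
          gcongr
          · exact min_le_right _ _
          · linarith
      _ = e := by field_simp

theorem graded_le_schrodinger {p₁ p₀ : Seminorm ℂ 𝓢(EuclideanSpace ℝ (Fin n), ℂ)}
    {G : EuclideanSpace ℝ (Fin n) → ℂ} (hG : G.HasTemperateGrowth) {M d : ℝ} {c : Fin n → ℝ}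
    (hM : 0 ≤ M)
    (h₁ : ∀ u, p₁ u ≤ M * p₁ (schrodinger G u)) (h₀ : ∀ u, p₀ u ≤ M * p₀ (schrodinger G u))
    (hc : ∀ j u, p₁ (partialD j (schrodinger G u) - schrodinger G (partialD j u)) ≤ c j * p₁ u)
    (hd : ∀ j u, p₀ (partialD j u) ≤ d * p₁ u) (u : 𝓢(EuclideanSpace ℝ (Fin n), ℂ)) :
    graded p₁ p₀ u ≤ M * graded p₁ p₀ (schrodinger G u) +
      M * (∑ j, (c j + 2 * d)) * p₁ u := by
  have t₁ (j : Fin n) : p₁ (partialD j u) ≤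
      M * p₁ (partialD j (schrodinger G u)) + M * (c j * p₁ u) := by
    refine (h₁ _).trans ?_
    rw [← mul_add]
    gcongr
    have := map_sub_le_add p₁ (partialD j (schrodinger G u))
      (partialD j (schrodinger G u) - schrodinger G (partialD j u))
    rw [sub_sub_cancel] at this
    linarith [hc j u]
  have t₀ (j : Fin n) : p₀ (coordMul j u) ≤
      M * p₀ (coordMul j (schrodinger G u)) + M * (2 * d * p₁ u) := by
    refine (h₀ _).trans ?_
    rw [← mul_add, schrodinger_coordMul hG]
    gcongr
    refine (map_sub_le_add p₀ _ _).trans ?_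
    rw [map_smul_eq_mul]
    have := hd j u
    simp only [Complex.norm_ofNat]
    linarith
  calc graded p₁ p₀ u = ∑ j, (p₁ (partialD j u) + p₀ (coordMul j u)) := by
        rw [graded_apply, Finset.sum_add_distrib]
    _ ≤ ∑ j, (M * (p₁ (partialD j (schrodinger G u)) + p₀ (coordMul j (schrodinger G u))) +
          M * (c j + 2 * d) * p₁ u) :=
        Finset.sum_le_sum fun j _ ↦ by linarith [t₁ j, t₀ j]
    _ = _ := by
        rw [graded_apply, Finset.sum_add_distrib, ← Finset.sum_mul, ← Finset.mul_sum,
          ← Finset.mul_sum, Finset.sum_add_distrib]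

/-- On every level of the scale there is an equivalent norm for which the resolvents of a family
of Schrödinger operators and the multiplication by `W` have almost the same norm as on `L²`. -/
theorem exists_adapted_seminorm {𝒢 : Set (EuclideanSpace ℝ (Fin n) → ℂ)} {c : ℝ} (hc : c ≠ 0)
    (h𝒢 : ∀ G ∈ 𝒢, G.HasTemperateGrowth) (him : ∀ G ∈ 𝒢, ∀ x, (G x).im = c)
    (hder : ∀ k j, ∃ C : ℝ, 0 ≤ C ∧ ∀ G ∈ 𝒢, ∀ u, scale n k
      (partialD j (schrodinger G u) - schrodinger G (partialD j u)) ≤ C * scale n k u)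
    {W : EuclideanSpace ℝ (Fin n) → ℂ} (hW : IsSmoothBounded W) {K₀ : ℝ}
    (hK₀ : ∀ x, ‖W x‖ ≤ K₀) (k : ℕ) {M K : ℝ} (hM : |c|⁻¹ < M) (hK : K₀ < K) :
    ∃ p : Seminorm ℂ 𝓢(EuclideanSpace ℝ (Fin n), ℂ),
      (∃ C : ℝ, 0 ≤ C ∧ ∀ u, p u ≤ C * scale n k u) ∧
      (∃ C : ℝ, 0 ≤ C ∧ ∀ u, scale n k u ≤ C * p u) ∧
      (∀ G ∈ 𝒢, ∀ u, p u ≤ M * p (schrodinger G u)) ∧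
      ∀ u, p (smulLeftCLM ℂ W u) ≤ K * p u := by
  induction k using Nat.twoStepInduction generalizing M K with
  | zero => exact ⟨0, ⟨0, by simp⟩, ⟨0, by simp [scale]⟩, by simp, by simp⟩
  | one =>
    refine ⟨l2Seminorm n, ⟨1, by simp [scale]⟩, ⟨1, by simp [scale]⟩, fun G hG u ↦ ?_, fun u ↦ ?_⟩
    · have h := l2Seminorm_le_schrodinger (h𝒢 G hG) (him G hG) u
      have hc' : 0 < |c| := abs_pos.2 hc
      calc l2Seminorm n u ≤ |c|⁻¹ * l2Seminorm n (schrodinger G u) := by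
            rw [← div_eq_inv_mul, le_div_iff₀' hc']; exact h
        _ ≤ _ := by gcongr
    · exact (l2Seminorm_smulLeft_le hW.hasTemperateGrowth hK₀ u).trans (by gcongr)
  | more k ih₀ ih₁ =>
    obtain ⟨M', hM', hMM⟩ := exists_between hM
    obtain ⟨K', hK', hKK⟩ := exists_between hK
    have hM'0 : 0 < M' := (inv_pos.2 (abs_pos.2 hc)).trans hM'
    obtain ⟨p₀, ⟨a₀, ha₀, hp₀⟩, ⟨b₀, hb₀, hq₀⟩, hA₀, hW₀⟩ := ih₀ hM' hK'
    obtain ⟨p₁, ⟨a₁, ha₁, hp₁⟩, ⟨b₁, hb₁, hq₁⟩, hA₁, hW₁⟩ := ih₁ hM' hK'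
    choose r hr0 hr using hder (k + 1)
    choose w hw0 hw using fun j : Fin n ↦
      scale_smulLeft_le (k + 1) (hW.fderiv_apply (EuclideanSpace.single j 1))
    have hQA : ∀ G ∈ 𝒢, ∀ u, graded p₁ p₀ u ≤ M' * graded p₁ p₀ (schrodinger G u) +
        M' * (∑ j, (a₁ * (r j * b₁) + 2 * (a₀ * b₁))) * p₁ u := fun G hG ↦
      graded_le_schrodinger (h𝒢 G hG) hM'0.le (hA₁ G hG) (hA₀ G hG)
        (fun j u ↦ calc
          _ ≤ a₁ * (r j * (b₁ * p₁ u)) := by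
            refine (hp₁ _).trans ?_
            gcongr
            refine (hr j G hG u).trans ?_
            have := hr0 j
            gcongr
            exact hq₁ u
          _ = _ := by ring)
        (fun j u ↦ calc
          _ ≤ a₀ * (b₁ * p₁ u) := by
            refine (hp₀ _).trans ?_
            gcongr
            exact (scale_partialD_le k j u).trans (hq₁ u)
          _ = _ := by ring)
    have hQW := graded_smulLeft_le hW hW₁ hW₀ (c := fun j ↦ a₁ * (w j * b₁)) (fun j u ↦ calc
          _ ≤ a₁ * (w j * (b₁ * p₁ u)) := by
            refine (hp₁ _).trans ?_
            gcongr
            refine (hw j u).trans ?_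
            have := hw0 j
            gcongr
            exact hq₁ u
          _ = _ := by ring)
    set R := ∑ j, (a₁ * (r j * b₁) + 2 * (a₀ * b₁)) with hR
    set S := ∑ j, a₁ * (w j * b₁) with hS
    have hR0 : 0 ≤ R := Finset.sum_nonneg fun j _ ↦ by have := hr0 j; positivity
    have hS0 : 0 ≤ S := Finset.sum_nonneg fun j _ ↦ by have := hw0 j; positivity
    obtain ⟨ε, hε, hεR, hεS⟩ := exists_pos_mul_le (a := M' * R * M') (b := S)
      (by positivity) hS0 (sub_pos.2 hMM) (sub_pos.2 hKK)
    have hε' : (0 : ℝ) < ε := hε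
    have happ (u) : (p₁ + ε • graded p₁ p₀) u = p₁ u + ε * graded p₁ p₀ u := rfl
    refine ⟨p₁ + ε • graded p₁ p₀, ⟨a₁ + ε * (a₁ + a₀), by positivity, fun u ↦ ?_⟩,
      ⟨b₁ + (b₁ + b₀) / ε, by positivity, fun u ↦ ?_⟩, fun G hG u ↦ ?_, fun u ↦ ?_⟩
    · rw [happ, scale_add_two]
      have h1 := hp₁ u
      have h2 := graded_le ha₁ ha₀ hp₁ hp₀ u
      have n1 := apply_nonneg (scale n (k + 1)) u
      have n2 := apply_nonneg (graded (scale n (k + 1)) (scale n k)) u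
      calc p₁ u + ε * graded p₁ p₀ u
          ≤ a₁ * scale n (k + 1) u +
            ε * ((a₁ + a₀) * graded (scale n (k + 1)) (scale n k) u) := by gcongr
        _ ≤ a₁ * scale n (k + 1) u +
            ε * ((a₁ + a₀) * graded (scale n (k + 1)) (scale n k) u) +
            (a₁ * graded (scale n (k + 1)) (scale n k) u +
              ε * ((a₁ + a₀) * scale n (k + 1) u)) := le_add_of_nonneg_right (by positivity)
        _ = _ := by ring
    · rw [happ, scale_add_two]
      have h1 := hq₁ u
      have h2 := graded_le hb₁ hb₀ hq₁ hq₀ u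
      have n1 := apply_nonneg p₁ u
      have n2 := apply_nonneg (graded p₁ p₀) u
      calc _ ≤ b₁ * p₁ u + (b₁ + b₀) * graded p₁ p₀ u := by gcongr
        _ ≤ b₁ * p₁ u + (b₁ + b₀) * graded p₁ p₀ u +
          (b₁ * (ε * graded p₁ p₀ u) + (b₁ + b₀) / ε * p₁ u) :=
            le_add_of_nonneg_right (by positivity)
        _ = _ := by field_simp; ring
    · rw [happ, happ]
      have h1 := hA₁ G hG u
      have h2 := hQA G hG u
      have n1 := apply_nonneg p₁ (schrodinger G u)
      have n2 := apply_nonneg (graded p₁ p₀) (schrodinger G u)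
      calc p₁ u + ε * graded p₁ p₀ u
          ≤ M' * p₁ (schrodinger G u) + ε * (M' * graded p₁ p₀ (schrodinger G u) +
            M' * R * (M' * p₁ (schrodinger G u))) := by
              refine add_le_add h1 (mul_le_mul_of_nonneg_left (h2.trans ?_) hε'.le)
              gcongr
        _ = M' * (p₁ (schrodinger G u) + ε * graded p₁ p₀ (schrodinger G u)) +
            ε * (M' * R * M') * p₁ (schrodinger G u) := by ring
        _ ≤ M' * (p₁ (schrodinger G u) + ε * graded p₁ p₀ (schrodinger G u)) +
            (M - M') * (p₁ (schrodinger G u) + ε * graded p₁ p₀ (schrodinger G u)) := by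
              have : 0 ≤ M - M' := by linarith
              gcongr
              exact le_add_of_nonneg_right (by positivity)
        _ = _ := by ring
    · rw [happ, happ]
      have h1 := hW₁ u
      have h2 := hQW u
      have n1 := apply_nonneg p₁ u
      have n2 := apply_nonneg (graded p₁ p₀) u
      calc p₁ (smulLeftCLM ℂ W u) + ε * graded p₁ p₀ (smulLeftCLM ℂ W u)
          ≤ K' * p₁ u + ε * (K' * graded p₁ p₀ u + S * p₁ u) := by gcongr
        _ = K' * (p₁ u + ε * graded p₁ p₀ u) + ε * S * p₁ u := by ring
        _ ≤ K' * (p₁ u + ε * graded p₁ p₀ u) + (K - K') * (p₁ u + ε * graded p₁ p₀ u) := by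
              have : 0 ≤ K - K' := by linarith
              gcongr
              exact le_add_of_nonneg_right (by positivity)
        _ = _ := by ring

theorem fourier_partialD_apply (j : Fin n) (u : 𝓢(EuclideanSpace ℝ (Fin n), ℂ))
    (ξ : EuclideanSpace ℝ (Fin n)) :
    𝓕 (partialD j u) ξ = 2 * Real.pi * Complex.I * ξ j * 𝓕 u ξ := by
  have h := fourier_lineDerivOp_eq u (EuclideanSpace.single j (1 : ℝ))
  have h' : 𝓕 (partialD j u) = _ := h
  rw [h', smul_apply, smulLeftCLM_apply_apply (by fun_prop)]
  simp [EuclideanSpace.inner_single_right, mul_assoc]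

theorem fourier_lap_apply (u : 𝓢(EuclideanSpace ℝ (Fin n), ℂ)) (ξ : EuclideanSpace ℝ (Fin n)) :
    𝓕 (lap n u) ξ = -(4 * Real.pi ^ 2 * ‖ξ‖ ^ 2 : ℝ) * 𝓕 u ξ := by
  rw [lap_eq_sum, FourierTransform.fourier_sum, _root_.sum_apply]
  simp only [fourier_partialD_apply, EuclideanSpace.norm_sq_eq]
  push_cast
  rw [Finset.mul_sum, ← Finset.sum_neg_distrib, Finset.sum_mul]
  refine Finset.sum_congr rfl fun j _ ↦ ?_
  rw [← Complex.ofReal_pow ‖_‖, Real.norm_eq_abs, sq_abs, Complex.ofReal_pow]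
  linear_combination (4 * Real.pi ^ 2 * (ξ j : ℂ) ^ 2 * 𝓕 u ξ) * Complex.I_sq

/-- The operator `1 - (2π)⁻² Δ`, whose Fourier symbol is `1 + ‖ξ‖²`. -/
noncomputable def bessel (n : ℕ) :
    𝓢(EuclideanSpace ℝ (Fin n), ℂ) →L[ℂ] 𝓢(EuclideanSpace ℝ (Fin n), ℂ) :=
  .id ℂ _ - (4 * (Real.pi : ℂ) ^ 2)⁻¹ • lap n

theorem fourier_bessel_apply (u : 𝓢(EuclideanSpace ℝ (Fin n), ℂ))
    (ξ : EuclideanSpace ℝ (Fin n)) :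
    𝓕 (bessel n u) ξ = (1 + ‖ξ‖ ^ 2 : ℝ) * 𝓕 u ξ := by
  have h : bessel n u = u + (-(4 * (Real.pi : ℂ) ^ 2)⁻¹) • lap n u := by
    simp [bessel, sub_eq_add_neg]
  rw [h, FourierTransform.fourier_add, FourierTransform.fourier_smul, _root_.add_apply, smul_apply,
    fourier_lap_apply, smul_eq_mul]
  have : (Real.pi : ℂ) ≠ 0 := by exact_mod_cast Real.pi_ne_zero
  push_cast
  field_simp

theorem fourier_bessel_iterate_apply (m : ℕ) (u : 𝓢(EuclideanSpace ℝ (Fin n), ℂ))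
    (ξ : EuclideanSpace ℝ (Fin n)) :
    𝓕 ((bessel n)^[m] u) ξ = ((1 + ‖ξ‖ ^ 2) ^ m : ℝ) * 𝓕 u ξ := by
  induction m with
  | zero => simp
  | succ m ih =>
    rw [Function.iterate_succ_apply', fourier_bessel_apply, ih]
    push_cast
    ring

theorem scale_bessel_le (k : ℕ) : ∃ C : ℝ, 0 ≤ C ∧ ∀ u : 𝓢(EuclideanSpace ℝ (Fin n), ℂ),
    scale n k (bessel n u) ≤ C * scale n (k + 2) u := by
  refine ⟨1 + ‖(4 * (Real.pi : ℂ) ^ 2)⁻¹‖ * n, by positivity, fun u ↦ ?_⟩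
  have h : bessel n u = u - (4 * (Real.pi : ℂ) ^ 2)⁻¹ • lap n u := by simp [bessel]
  have hl : scale n k (lap n u) ≤ n * scale n (k + 2) u := by
    rw [lap_eq_sum]
    refine (Finset.le_sum_of_subadditive (scale n k) (map_zero _).le (map_add_le_add _) _ _).trans ?_
    calc _ ≤ ∑ _j : Fin n, scale n (k + 2) u := Finset.sum_le_sum fun j _ ↦
          (scale_partialD_le k j _).trans (scale_partialD_le (k + 1) j u)
      _ = _ := by simp
  rw [h]
  refine (map_sub_le_add _ _ _).trans ?_
  rw [map_smul_eq_mul, add_mul, one_mul, mul_assoc]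
  gcongr
  exact scale_mono (by lia) u

theorem scale_bessel_iterate_le (m k : ℕ) :
    ∃ C : ℝ, 0 ≤ C ∧ ∀ u : 𝓢(EuclideanSpace ℝ (Fin n), ℂ),
      scale n k ((bessel n)^[m] u) ≤ C * scale n (k + 2 * m) u := by
  induction m generalizing k with
  | zero => exact ⟨1, by simp, by simp⟩
  | succ m ih =>
    obtain ⟨C, hC, h⟩ := ih (k + 2)
    obtain ⟨D, hD, h'⟩ := scale_bessel_le (n := n) k
    refine ⟨D * C, by positivity, fun u ↦ ?_⟩
    rw [Function.iterate_succ_apply', mul_assoc]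
    refine (h' _).trans ?_
    gcongr
    refine (h u).trans_eq ?_
    ring_nf

theorem norm_apply_le_integral_fourier (u : 𝓢(EuclideanSpace ℝ (Fin n), ℂ))
    (x : EuclideanSpace ℝ (Fin n)) : ‖u x‖ ≤ ∫ ξ, ‖𝓕 u ξ‖ := by
  have h : u x = 𝓕⁻ (𝓕 u) x := by rw [FourierTransform.fourierInv_fourier_eq]
  rw [h, fourierInv_coe]
  exact VectorFourier.norm_fourierIntegral_le_integral_norm _ _ _ _ _

/-- The Sobolev inequality. -/
theorem norm_apply_le_scale : ∃ (m : ℕ) (C : ℝ), 0 ≤ C ∧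
    ∀ (u : 𝓢(EuclideanSpace ℝ (Fin n), ℂ)) x, ‖u x‖ ≤ C * scale n m u := by
  obtain ⟨D, hD, hB⟩ := scale_bessel_iterate_le (n := n) (n + 1) 1
  set w : EuclideanSpace ℝ (Fin n) → ℝ := fun ξ ↦ ((1 + ‖ξ‖ ^ 2) ^ (n + 1))⁻¹ with hw
  have hwc : Continuous w :=
    Continuous.inv₀ (by fun_prop) fun ξ ↦ by positivity
  have hwint : Integrable fun ξ ↦ w ξ ^ 2 := by
    have := integrable_rpow_neg_one_add_norm_sq (E := EuclideanSpace ℝ (Fin n)) (μ := volume)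
      (r := 4 * (n + 1)) (by rw [finrank_euclideanSpace_fin]; linarith)
    refine this.congr (Filter.Eventually.of_forall fun ξ ↦ ?_)
    have h1 : (-(4 * ((n : ℝ) + 1)) / 2) = -(((n + 1) * 2 : ℕ) : ℝ) := by push_cast; ring
    simp only [hw]
    rw [h1, Real.rpow_neg (by positivity), Real.rpow_natCast, inv_pow, pow_mul]
  refine ⟨1 + 2 * (n + 1), (∫ ξ, w ξ ^ 2) ^ (1 / 2 : ℝ) * D,
    mul_nonneg (Real.rpow_nonneg (integral_nonneg fun _ ↦ by positivity) _) hD, fun u x ↦ ?_⟩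
  set v := (bessel n)^[n + 1] u with hv
  have hpt (ξ) : ‖𝓕 u ξ‖ = w ξ * ‖𝓕 v ξ‖ := by
    rw [hv, fourier_bessel_iterate_apply, norm_mul, Complex.norm_real, Real.norm_of_nonneg
      (by positivity)]
    simp only [hw]
    field_simp
  have hnorm : (∫ ξ, ‖𝓕 v ξ‖ ^ 2) ^ (1 / 2 : ℝ) = l2Seminorm n v := by
    rw [integral_norm_sq_fourier, ← norm_toL2_sq, l2Seminorm_apply, ← Real.sqrt_eq_rpow,
      Real.sqrt_sq (norm_nonneg _)]
  have hol := integral_mul_le_Lp_mul_Lq_of_nonneg (μ := volume) Real.HolderConjugate.two_two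
    (f := w) (g := fun ξ ↦ ‖𝓕 v ξ‖)
    (Filter.Eventually.of_forall fun ξ ↦ by simp only [hw]; positivity)
    (Filter.Eventually.of_forall fun ξ ↦ norm_nonneg _)
    (by simpa using (memLp_two_iff_integrable_sq hwc.aestronglyMeasurable).2 hwint)
    (by simpa using ((𝓕 v).memLp 2 volume).norm)
  simp only [Real.rpow_two] at hol
  rw [hnorm] at hol
  calc ‖u x‖ ≤ ∫ ξ, w ξ * ‖𝓕 v ξ‖ := by
        simpa only [hpt] using norm_apply_le_integral_fourier u x
    _ ≤ (∫ ξ, w ξ ^ 2) ^ (1 / 2 : ℝ) * (D * scale n (1 + 2 * (n + 1)) u) := by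
        refine hol.trans ?_
        gcongr
        exact hB u
    _ = _ := by ring

theorem norm_le_sum_norm_coord (x : EuclideanSpace ℝ (Fin n)) : ‖x‖ ≤ ∑ j, ‖x j‖ := by
  have h : x = ∑ j, x j • EuclideanSpace.single j (1 : ℝ) := by
    ext i; simp [Finset.sum_apply, Pi.single_apply]
  calc ‖x‖ = ‖∑ j, x j • EuclideanSpace.single j (1 : ℝ)‖ := by rw [← h]
    _ ≤ ∑ j, ‖x j • EuclideanSpace.single j (1 : ℝ)‖ := norm_sum_le _ _
    _ = _ := by simp [norm_smul]

theorem seminorm_zero_le_scale (k : ℕ) : ∃ (m : ℕ) (C : ℝ), 0 ≤ C ∧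
    ∀ u : 𝓢(EuclideanSpace ℝ (Fin n), ℂ), SchwartzMap.seminorm ℂ k 0 u ≤ C * scale n m u := by
  induction k with
  | zero =>
    obtain ⟨m, C, hC, h⟩ := norm_apply_le_scale (n := n)
    exact ⟨m, C, hC, fun u ↦ seminorm_le_bound ℂ 0 0 u
      (mul_nonneg hC (apply_nonneg _ _)) fun x ↦ by simpa using h u x⟩
  | succ k ih =>
    obtain ⟨m, C, hC, h⟩ := ih
    refine ⟨m + 2, n * C, by positivity, fun u ↦
      seminorm_le_bound ℂ (k + 1) 0 u (by positivity) fun x ↦ ?_⟩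
    calc ‖x‖ ^ (k + 1) * ‖iteratedFDeriv ℝ 0 u x‖
        ≤ ‖x‖ ^ k * (∑ j, ‖x j‖) * ‖u x‖ := by
          rw [norm_iteratedFDeriv_zero, pow_succ]
          gcongr
          exact norm_le_sum_norm_coord x
      _ = ∑ j, ‖x‖ ^ k * ‖iteratedFDeriv ℝ 0 (coordMul j u) x‖ := by
          rw [Finset.mul_sum, Finset.sum_mul]
          simp [coordMul_apply, mul_assoc]
      _ ≤ ∑ _j : Fin n, C * scale n (m + 2) u := by
          refine Finset.sum_le_sum fun j _ ↦ (le_seminorm ℂ k 0 _ x).trans ((h _).trans ?_)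
          gcongr
          exact scale_coordMul_le m j u
      _ = _ := by simp [mul_assoc]

theorem norm_iteratedFDeriv_succ_le (l : ℕ) (u : 𝓢(EuclideanSpace ℝ (Fin n), ℂ))
    (x : EuclideanSpace ℝ (Fin n)) :
    ‖iteratedFDeriv ℝ (l + 1) u x‖ ≤ ∑ j, ‖iteratedFDeriv ℝ l (partialD j u) x‖ := by
  let L (j : Fin n) : ℂ →L[ℝ] (EuclideanSpace ℝ (Fin n) →L[ℝ] ℂ) :=
    ContinuousLinearMap.smulRightL ℝ _ ℂ (EuclideanSpace.proj (𝕜 := ℝ) j)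
  have hL (j : Fin n) : ‖L j‖ ≤ 1 := by
    refine ContinuousLinearMap.opNorm_le_bound _ zero_le_one fun c ↦ ?_
    refine ContinuousLinearMap.opNorm_le_bound _ (by positivity) fun y ↦ ?_
    have h : L j c y = y j • c := rfl
    rw [h, norm_smul, one_mul, mul_comm]
    gcongr
    exact PiLp.norm_apply_le y j
  have hu : fderiv ℝ u = fun x ↦ ∑ j, (L j ∘ partialD j u) x := by
    ext1 y
    refine ContinuousLinearMap.ext fun v ↦ ?_
    have hv : v = ∑ j, v j • EuclideanSpace.single j (1 : ℝ) := by
      ext i; simp [Finset.sum_apply, Pi.single_apply]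
    conv_lhs => rw [hv]
    simp [L, partialD_apply]
  rw [← norm_iteratedFDeriv_fderiv, hu, iteratedFDeriv_fun_sum_apply fun j _ ↦
    ((L j).contDiff.comp ((partialD j u).smooth l)).contDiffAt]
  refine (norm_sum_le _ _).trans (Finset.sum_le_sum fun j _ ↦ ?_)
  refine ((L j).norm_iteratedFDeriv_comp_left
    ((partialD j u).smooth l).contDiffAt le_rfl).trans ?_
  exact mul_le_of_le_one_left (norm_nonneg _) (hL j)

/-- The weighted Sobolev norms dominate the seminorms of Schwartz space. -/
theorem seminorm_le_scale (k l : ℕ) : ∃ (m : ℕ) (C : ℝ), 0 ≤ C ∧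
    ∀ u : 𝓢(EuclideanSpace ℝ (Fin n), ℂ), SchwartzMap.seminorm ℂ k l u ≤ C * scale n m u := by
  induction l with
  | zero => exact seminorm_zero_le_scale k
  | succ l ih =>
    obtain ⟨m, C, hC, h⟩ := ih
    refine ⟨m + 1, n * C, by positivity, fun u ↦
      seminorm_le_bound ℂ k (l + 1) u (by positivity) fun x ↦ ?_⟩
    calc ‖x‖ ^ k * ‖iteratedFDeriv ℝ (l + 1) u x‖
        ≤ ∑ j, ‖x‖ ^ k * ‖iteratedFDeriv ℝ l (partialD j u) x‖ := by
          rw [← Finset.mul_sum]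
          gcongr
          exact norm_iteratedFDeriv_succ_le l u x
      _ ≤ ∑ _j : Fin n, C * scale n (m + 1) u := by
          refine Finset.sum_le_sum fun j _ ↦ (le_seminorm ℂ k l _ x).trans ((h _).trans ?_)
          gcongr
          exact scale_partialD_le m j u
      _ = _ := by simp [mul_assoc]

theorem exists_tsum {u : ℕ → 𝓢(EuclideanSpace ℝ (Fin n), ℂ)}
    (hu : ∀ k l, Summable fun i ↦ SchwartzMap.seminorm ℂ k l (u i)) :
    ∃ U : 𝓢(EuclideanSpace ℝ (Fin n), ℂ), (∀ x, U x = ∑' i, u i x) ∧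
      ∀ k l, SchwartzMap.seminorm ℂ k l U ≤ ∑' i, SchwartzMap.seminorm ℂ k l (u i) := by
  have hs (k : ℕ) : ((k : ℕ∞) ≤ ⊤) → Summable fun i ↦ SchwartzMap.seminorm ℂ 0 k (u i) :=
    fun _ ↦ hu 0 k
  have hb (k i : ℕ) (x : EuclideanSpace ℝ (Fin n)) : ((k : ℕ∞) ≤ ⊤) →
      ‖iteratedFDeriv ℝ k (u i) x‖ ≤ SchwartzMap.seminorm ℂ 0 k (u i) :=
    fun _ ↦ norm_iteratedFDeriv_le_seminorm ℂ (u i) k x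
  have hbound (k l : ℕ) (x : EuclideanSpace ℝ (Fin n)) :
      ‖x‖ ^ k * ‖iteratedFDeriv ℝ l (fun x ↦ ∑' i, u i x) x‖ ≤
        ∑' i, SchwartzMap.seminorm ℂ k l (u i) := by
    rw [iteratedFDeriv_tsum (fun i ↦ (u i).smooth ⊤) hs hb le_top]
    have h1 : Summable fun i ↦ ‖iteratedFDeriv ℝ l (u i) x‖ :=
      (hu 0 l).of_nonneg_of_le (fun _ ↦ norm_nonneg _) fun i ↦ hb l i x le_top
    calc _ ≤ ‖x‖ ^ k * ∑' i, ‖iteratedFDeriv ℝ l (u i) x‖ := by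
          gcongr
          exact norm_tsum_le_tsum_norm h1
      _ = ∑' i, ‖x‖ ^ k * ‖iteratedFDeriv ℝ l (u i) x‖ := tsum_mul_left.symm
      _ ≤ _ := (h1.mul_left _).tsum_le_tsum (fun i ↦ le_seminorm ℂ k l (u i) x) (hu k l)
  exact ⟨⟨fun x ↦ ∑' i, u i x, contDiff_tsum (fun i ↦ (u i).smooth ⊤) hs hb,
    fun k l ↦ ⟨_, hbound k l⟩⟩, fun _ ↦ rfl, fun k l ↦ seminorm_le_bound ℂ k l _
      (tsum_nonneg fun i ↦ apply_nonneg _ _) (hbound k l)⟩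

/-- Schwartz space is sequentially complete: absolutely convergent series converge. -/
theorem exists_tendsto_sum {u : ℕ → 𝓢(EuclideanSpace ℝ (Fin n), ℂ)}
    (hu : ∀ k l, Summable fun i ↦ SchwartzMap.seminorm ℂ k l (u i)) :
    ∃ U, Filter.Tendsto (fun N ↦ ∑ i ∈ Finset.range N, u i) Filter.atTop (nhds U) := by
  obtain ⟨U, hU, -⟩ := exists_tsum hu
  have hsum (x) : Summable fun i ↦ u i x := (hu 0 0).of_norm_bounded fun i ↦ by
    simpa using le_seminorm ℂ 0 0 (u i) x
  refine ⟨U, ((schwartz_withSeminorms ℂ _ _).tendsto_nhds _ _).2 fun kl ε hε ↦ ?_⟩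
  filter_upwards [(tendsto_sum_nat_add fun i ↦ SchwartzMap.seminorm ℂ kl.1 kl.2 (u i)).eventually
    (gt_mem_nhds hε)] with N hN
  obtain ⟨T, hT, hTle⟩ := exists_tsum (u := fun i ↦ u (i + N))
    fun k l ↦ (summable_nat_add_iff N).2 (hu k l)
  have hUT : ∑ i ∈ Finset.range N, u i - U = -T := by
    ext x
    rw [_root_.sub_apply, _root_.neg_apply, _root_.sum_apply, hU, hT,
      ← (hsum x).sum_add_tsum_nat_add N]
    ring
  rw [hUT, map_neg_eq_map]
  exact (hTle kl.1 kl.2).trans_lt hN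

/-- A family with geometric decay in each weighted Sobolev norm can be summed. -/
theorem exists_tendsto_sum_of_scale {u : ℕ → 𝓢(EuclideanSpace ℝ (Fin n), ℂ)}
    (hu : ∀ m, ∃ C : ℝ, ∀ i, scale n m (u i) ≤ C * (1 / 2) ^ i) :
    ∃ U, Filter.Tendsto (fun N ↦ ∑ i ∈ Finset.range N, u i) Filter.atTop (nhds U) := by
  refine exists_tendsto_sum fun k l ↦ ?_
  obtain ⟨m, D, hD, h⟩ := seminorm_le_scale (n := n) k l
  obtain ⟨C, hC⟩ := hu m
  refine ((summable_geometric_two.mul_left C).mul_left D).of_nonneg_of_le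
    (fun i ↦ apply_nonneg _ _) fun i ↦ (h _).trans ?_
  gcongr
  exact hC i

/-- Perturbation of a surjective Schrödinger operator by a small bounded potential. -/
theorem surjective_add {A B : 𝓢(EuclideanSpace ℝ (Fin n), ℂ) →L[ℂ] 𝓢(EuclideanSpace ℝ (Fin n), ℂ)}
    (hA : Function.Surjective A)
    (h : ∀ m, ∃ p : Seminorm ℂ 𝓢(EuclideanSpace ℝ (Fin n), ℂ),
      (∃ C : ℝ, 0 ≤ C ∧ ∀ u, scale n m u ≤ C * p u) ∧
      ∃ M K : ℝ, 0 ≤ M ∧ M * K ≤ 1 / 2 ∧ (∀ u, p u ≤ M * p (A u)) ∧ ∀ u, p (B u) ≤ K * p u) :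
    Function.Surjective (A + B) := by
  intro f
  choose R hR using hA
  let u : ℕ → 𝓢(EuclideanSpace ℝ (Fin n), ℂ) := fun i ↦ (fun v ↦ R (-B v))^[i] (R f)
  have hu (i : ℕ) : A (u (i + 1)) = -B (u i) := by
    simp only [u, Function.iterate_succ_apply', hR]
  obtain ⟨U, hU⟩ := exists_tendsto_sum_of_scale (u := u) fun m ↦ by
    obtain ⟨p, ⟨C, hC, hpC⟩, M, K, hM, hMK, hpA, hpB⟩ := h m
    have hp (i : ℕ) : p (u i) ≤ p (R f) * (1 / 2) ^ i := by
      induction i with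
      | zero => simp [u]
      | succ i ih =>
        calc p (u (i + 1)) ≤ M * p (B (u i)) := by
              simpa [hu, map_neg_eq_map] using hpA (u (i + 1))
          _ ≤ M * (K * p (u i)) := by gcongr; exact hpB _
          _ = M * K * p (u i) := by ring
          _ ≤ 1 / 2 * (p (R f) * (1 / 2) ^ i) := by gcongr
          _ = _ := by ring
    refine ⟨C * p (R f), fun i ↦ (hpC _).trans ?_⟩
    rw [mul_assoc]
    gcongr
    exact hp i
  refine ⟨U, ?_⟩
  have hpart (N : ℕ) : (A + B) (∑ i ∈ Finset.range N, u i) = f - A (u N) := by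
    induction N with
    | zero => simp [u, hR]
    | succ N ih =>
      rw [Finset.sum_range_succ, map_add, ih, hu, _root_.add_apply]
      abel
  have hzero : Filter.Tendsto u Filter.atTop (nhds 0) := by
    have := ((Filter.tendsto_add_atTop_iff_nat 1).2 hU).sub hU
    simpa [Finset.sum_range_succ] using this
  have h1 := ((A + B).continuous.tendsto U).comp hU
  have h2 : Filter.Tendsto (fun N ↦ f - A (u N)) Filter.atTop (nhds f) := by
    simpa using tendsto_const_nhds.sub ((A.continuous.tendsto 0).comp hzero)
  simp only [Function.comp_def, hpart] at h1
  exact tendsto_nhds_unique h1 h2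

theorem hasTemperateGrowth_const_smul {W : EuclideanSpace ℝ (Fin n) → ℂ}
    (hW : W.HasTemperateGrowth) (s : ℂ) : (s • W).HasTemperateGrowth :=
  (Function.HasTemperateGrowth.const s).smul hW

theorem schrodinger_add_smul {G W : EuclideanSpace ℝ (Fin n) → ℂ} (hG : G.HasTemperateGrowth)
    (hW : W.HasTemperateGrowth) (s : ℂ) :
    schrodinger (G + s • W) = schrodinger G + s • smulLeftCLM ℂ W := by
  rw [schrodinger, schrodinger, smulLeftCLM_add hG (hasTemperateGrowth_const_smul hW s),
    smulLeftCLM_smul hW, add_assoc]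

theorem scale_commutator_le {G W : EuclideanSpace ℝ (Fin n) → ℂ} (hG : G.HasTemperateGrowth)
    (hG' : ∀ v, IsSmoothBounded fun x ↦ fderiv ℝ G x v) (hW : IsSmoothBounded W) (k : ℕ)
    (j : Fin n) : ∃ C : ℝ, 0 ≤ C ∧ ∀ s : ℂ, ‖s‖ ≤ 1 → ∀ u, scale n k
      (partialD j (schrodinger (G + s • W) u) - schrodinger (G + s • W) (partialD j u)) ≤
        C * scale n k u := by
  set v : EuclideanSpace ℝ (Fin n) := EuclideanSpace.single j 1
  obtain ⟨C₀, hC₀, h₀⟩ := scale_smulLeft_le k (hG' v)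
  obtain ⟨C₁, hC₁, h₁⟩ := scale_smulLeft_le k (hW.fderiv_apply v)
  refine ⟨C₀ + C₁, by positivity, fun s hs u ↦ ?_⟩
  have hsW' := hasTemperateGrowth_const_smul (hW.fderiv_apply v).hasTemperateGrowth s
  rw [schrodinger_partialD (hG.add (hasTemperateGrowth_const_smul hW.hasTemperateGrowth s))
    ((hG' v).hasTemperateGrowth.add hsW') j, sub_sub_cancel,
    smulLeftCLM_add (hG' v).hasTemperateGrowth hsW',
    smulLeftCLM_smul (hW.fderiv_apply v).hasTemperateGrowth]
  · refine (map_add_le_add (scale n k) _ _).trans ?_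
    rw [add_mul]
    refine add_le_add (h₀ u) ?_
    have hs' : scale n k (s • smulLeftCLM ℂ (fun x ↦ fderiv ℝ W x v) u) =
      ‖s‖ * scale n k (smulLeftCLM ℂ (fun x ↦ fderiv ℝ W x v) u) := map_smul_eq_mul _ _ _
    exact hs'.trans_le <| (mul_le_of_le_one_left (apply_nonneg _ _) hs).trans (h₁ u)
  · intro x
    have hdW := hW.1.differentiable (by simp) x
    rw [fderiv_add (hG.1.differentiable (by simp) x) (hdW.const_smul s), fderiv_const_smul hdW]
    rfl

/-- Surjectivity of `-Δ + G` is stable under adding a real potential with bounded derivatives, by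
the method of continuity. -/
theorem surjective_schrodinger_add {G W : EuclideanSpace ℝ (Fin n) → ℂ}
    (hG : G.HasTemperateGrowth) (hG' : ∀ v, IsSmoothBounded fun x ↦ fderiv ℝ G x v) {c : ℝ}
    (hc : c ≠ 0) (hGc : ∀ x, (G x).im = c) (hW : IsSmoothBounded W) (hWr : ∀ x, (W x).im = 0)
    (hsurj : Function.Surjective (schrodinger G)) :
    Function.Surjective (schrodinger (G + W)) := by
  obtain ⟨K₀, hK₀, hWK⟩ := hW.bounded
  set M : ℝ := |c|⁻¹ + 1
  have hM : |c|⁻¹ < M := lt_add_one _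
  have hM0 : 0 ≤ M := by positivity
  obtain ⟨J, hJ⟩ := exists_nat_gt (2 * (M * (K₀ + 1)))
  have hJ0 : (0 : ℝ) < J := lt_of_le_of_lt (by positivity) hJ
  have hstep (i : ℕ) (hi : i ≤ J) :
      Function.Surjective (schrodinger (G + ((i / J : ℝ) : ℂ) • W)) := by
    induction i with
    | zero => simpa using hsurj
    | succ i ih =>
      have hsum : G + (((i + 1 : ℕ) / J : ℝ) : ℂ) • W =
          (G + ((i / J : ℝ) : ℂ) • W) + ((1 / J : ℝ) : ℂ) • W := by
        rw [add_assoc, ← add_smul]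
        push_cast
        rw [add_div]
      have hGi := hG.add (hasTemperateGrowth_const_smul hW.hasTemperateGrowth ((i / J : ℝ) : ℂ))
      rw [hsum, schrodinger_add_smul hGi hW.hasTemperateGrowth, FunLike.coe_add]
      refine surjective_add (ih (by lia)) fun m ↦ ?_
      obtain ⟨p, -, hp, hpA, hpW⟩ := exists_adapted_seminorm
        (𝒢 := {H | ∃ s : ℝ, |s| ≤ 1 ∧ H = G + (s : ℂ) • W}) hc
        (by
          rintro _ ⟨s, -, rfl⟩
          exact hG.add (hasTemperateGrowth_const_smul hW.hasTemperateGrowth _))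
        (by rintro _ ⟨s, -, rfl⟩ x; simp [hGc, hWr])
        (fun k j ↦ by
          obtain ⟨C, hC, h⟩ := scale_commutator_le hG hG' hW k j
          refine ⟨C, hC, ?_⟩
          rintro _ ⟨s, hs, rfl⟩
          exact h s (by simpa using hs))
        hW hWK m hM (lt_add_one K₀)
      refine ⟨p, hp, M, 1 / J * (K₀ + 1), hM0, ?_, hpA _ ⟨i / J, ?_, rfl⟩, fun u ↦ ?_⟩
      · rw [mul_left_comm, one_div, inv_mul_le_iff₀ hJ0]
        linarith
      · rw [abs_of_nonneg (by positivity), div_le_one hJ0]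
        exact_mod_cast (by lia : i ≤ J)
      · rw [_root_.smul_apply, map_smul_eq_mul, Complex.norm_real,
          Real.norm_of_nonneg (by positivity), mul_assoc]
        gcongr
        exact hpW u
  simpa [hJ0.ne'] using hstep J le_rfl

/-- A bounded solution of a polynomial autonomous differential equation has bounded derivatives. -/
theorem hasTemperateGrowth_of_hasDerivAt_eval {f : ℝ → ℂ} {P : Polynomial ℂ}
    (hf : ∀ s, HasDerivAt f (P.eval (f s)) s) {C : ℝ} (hC : ∀ s, ‖f s‖ ≤ C) :
    f.HasTemperateGrowth := by
  have hiter (k : ℕ) : ∃ Q : Polynomial ℂ, iteratedDeriv k f = fun s ↦ Q.eval (f s) := by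
    induction k with
    | zero => exact ⟨Polynomial.X, by simp⟩
    | succ k ih =>
      obtain ⟨Q, hQ⟩ := ih
      refine ⟨Q.derivative * P, funext fun s ↦ ?_⟩
      have h := (Q.hasDerivAt (f s)).comp_of_eq s (hf s) rfl
      rw [iteratedDeriv_succ, hQ, Polynomial.eval_mul]
      exact h.deriv
  refine ⟨contDiff_of_differentiable_iteratedDeriv fun k _ ↦ ?_, fun k ↦ ?_⟩
  · obtain ⟨Q, hQ⟩ := hiter k
    rw [hQ]
    exact fun s ↦ ((Q.hasDerivAt (f s)).comp_of_eq s (hf s) rfl).differentiableAt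
  · obtain ⟨Q, hQ⟩ := hiter k
    obtain ⟨D, hD⟩ := (isCompact_closedBall (0 : ℂ) C).exists_bound_of_continuousOn
      (f := fun w ↦ Q.eval w) Q.continuous.continuousOn
    refine ⟨0, D, fun s ↦ ?_⟩
    rw [norm_iteratedFDeriv_eq_norm_iteratedDeriv, hQ]
    simpa using hD (f s) (by simpa using hC s)

theorem hasTemperateGrowth_cexp_mul_I :
    (fun s : ℝ ↦ Complex.exp (s * Complex.I)).HasTemperateGrowth := by
  refine hasTemperateGrowth_of_hasDerivAt_eval (P := Polynomial.C Complex.I * Polynomial.X)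
    (C := 1) (fun s ↦ ?_) fun s ↦ (Complex.norm_exp_ofReal_mul_I s).le
  have := ((Complex.ofRealCLM.hasDerivAt (x := s)).mul_const Complex.I).cexp
  convert! this using 1
  simp [mul_comm Complex.I]

theorem hasTemperateGrowth_inv_mul_sub (β : ℝ) {z : ℂ} (hz : z.im ≠ 0) :
    (fun s : ℝ ↦ (β * s - z : ℂ)⁻¹).HasTemperateGrowth := by
  have him (s : ℝ) : (β * s - z : ℂ).im = -z.im := by simp
  have hne (s : ℝ) : (β * s - z : ℂ) ≠ 0 := fun h ↦ hz (by simpa [h] using (him s).symm)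
  refine hasTemperateGrowth_of_hasDerivAt_eval (P := -Polynomial.C (β : ℂ) * Polynomial.X ^ 2)
    (C := |z.im|⁻¹) (fun s ↦ ?_) fun s ↦ ?_
  · have := ((((Complex.ofRealCLM.hasDerivAt (x := s)).const_mul (β : ℂ)).sub_const z)).inv (hne s)
    convert! this using 1
    simp
    field_simp
  · rw [norm_inv]
    refine inv_anti₀ (abs_pos.2 hz) ?_
    simpa [him] using Complex.abs_im_le_norm (β * s - z : ℂ)

theorem partialD_fourier (j : Fin n) (u : 𝓢(EuclideanSpace ℝ (Fin n), ℂ)) :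
    partialD j (𝓕 u) = (-(2 * Real.pi * Complex.I)) • 𝓕 (coordMul j u) := by
  have h : partialD j (𝓕 u) = _ := lineDerivOp_fourier_eq u (EuclideanSpace.single j (1 : ℝ))
  rw [h, FourierTransform.fourier_smul]
  congr 2
  ext x
  rw [smulLeftCLM_apply_apply (by fun_prop), coordMul_apply]
  simp [EuclideanSpace.inner_single_right]

/-- The phase function conjugating the Stark operator to multiplication by a coordinate, on the
Fourier side. -/
noncomputable def phase (j : Fin n) (β : ℝ) (ξ : EuclideanSpace ℝ (Fin n)) : ℝ :=
  8 * Real.pi ^ 3 / β * (ξ j * ‖ξ‖ ^ 2 - 2 / 3 * ξ j ^ 3)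

theorem hasTemperateGrowth_phase (j : Fin n) (β : ℝ) : (phase j β).HasTemperateGrowth := by
  have hj : (fun ξ : EuclideanSpace ℝ (Fin n) ↦ ξ j).HasTemperateGrowth :=
    (EuclideanSpace.proj (𝕜 := ℝ) j).hasTemperateGrowth
  unfold phase
  fun_prop

theorem fderiv_phase (j : Fin n) (β : ℝ) (ξ : EuclideanSpace ℝ (Fin n)) :
    fderiv ℝ (phase j β) ξ (EuclideanSpace.single j 1) = 8 * Real.pi ^ 3 / β * ‖ξ‖ ^ 2 := by
  have h1 : HasFDerivAt (fun ξ : EuclideanSpace ℝ (Fin n) ↦ ξ j)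
      (EuclideanSpace.proj (𝕜 := ℝ) j) ξ := (EuclideanSpace.proj (𝕜 := ℝ) j).hasFDerivAt
  have h2 := (hasStrictFDerivAt_norm_sq ξ).hasFDerivAt
  have h := (((h1.mul h2).sub ((h1.pow 3).const_mul (2 / 3))).const_mul (8 * Real.pi ^ 3 / β))
  have h' : HasFDerivAt (phase j β) _ ξ := h
  rw [h'.fderiv]
  simp [-mul_eq_mul_left_iff, EuclideanSpace.inner_single_right]
  ring

/-- The unimodular multiplier `exp (iφ)`. -/
noncomputable def phaseExp (j : Fin n) (β : ℝ) (ξ : EuclideanSpace ℝ (Fin n)) : ℂ :=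
  Complex.exp (phase j β ξ * Complex.I)

theorem hasTemperateGrowth_phaseExp (j : Fin n) (β : ℝ) : (phaseExp j β).HasTemperateGrowth :=
  hasTemperateGrowth_cexp_mul_I.comp (hasTemperateGrowth_phase j β)

theorem fderiv_phaseExp (j : Fin n) (β : ℝ) (ξ : EuclideanSpace ℝ (Fin n)) :
    fderiv ℝ (phaseExp j β) ξ (EuclideanSpace.single j 1) =
      (8 * Real.pi ^ 3 / β * ‖ξ‖ ^ 2 : ℝ) * Complex.I * phaseExp j β ξ := by
  have h := ((hasTemperateGrowth_phase j β).1.differentiable (by simp) ξ).hasFDerivAt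
  have h' := ((Complex.ofRealCLM.hasFDerivAt.comp ξ h).mul_const Complex.I).cexp
  have h'' : HasFDerivAt (phaseExp j β) _ ξ := h'
  rw [h''.fderiv]
  simp [fderiv_phase, phaseExp]
  ring

/-- The free Stark operator is surjective on Schwartz space for nonreal spectral parameter. -/
theorem surjective_schrodinger_coord (j : Fin n) {β : ℝ} (hβ : β ≠ 0) {z : ℂ} (hz : z.im ≠ 0) :
    Function.Surjective
      (schrodinger fun x : EuclideanSpace ℝ (Fin n) ↦ (β * (x j : ℝ) - z : ℂ)) := by
  intro f
  have hj : (fun ξ : EuclideanSpace ℝ (Fin n) ↦ ξ j).HasTemperateGrowth :=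
    (EuclideanSpace.proj (𝕜 := ℝ) j).hasTemperateGrowth
  have hG : (fun x : EuclideanSpace ℝ (Fin n) ↦ (β * (x j : ℝ) - z : ℂ)).HasTemperateGrowth := by
    have := hasTemperateGrowth_coord j
    fun_prop
  have hR : (fun x : EuclideanSpace ℝ (Fin n) ↦ (β * (x j : ℝ) - z : ℂ)⁻¹).HasTemperateGrowth :=
    (hasTemperateGrowth_inv_mul_sub β hz).comp hj
  have hE := hasTemperateGrowth_phaseExp j β
  have hE' : (fun ξ ↦ (phaseExp j β ξ)⁻¹).HasTemperateGrowth := by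
    have h := hasTemperateGrowth_cexp_mul_I.comp (hasTemperateGrowth_phase j β).neg
    convert h using 1
    ext ξ
    simp [phaseExp, ← Complex.exp_neg]
  set h : 𝓢(EuclideanSpace ℝ (Fin n), ℂ) :=
    smulLeftCLM ℂ (fun ξ ↦ (phaseExp j β ξ)⁻¹) (𝓕 f) with hh
  set y := smulLeftCLM ℂ (fun x : EuclideanSpace ℝ (Fin n) ↦ (β * (x j : ℝ) - z : ℂ)⁻¹) (𝓕⁻ h)
    with hy
  set u := 𝓕⁻ (smulLeftCLM ℂ (phaseExp j β) (𝓕 y)) with hu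
  have hyeq : (β : ℂ) • coordMul j y - z • y = 𝓕⁻ h := by
    ext x
    have hne : (β * (x j : ℝ) - z : ℂ) ≠ 0 := fun h ↦ hz (by simpa using congrArg Complex.im h)
    rw [_root_.sub_apply, _root_.smul_apply, _root_.smul_apply, coordMul_apply, hy,
      smulLeftCLM_apply_apply hR]
    simp only [smul_eq_mul]
    field_simp
  have hyF (ξ) : (β : ℂ) * 𝓕 (coordMul j y) ξ - z * 𝓕 y ξ = (phaseExp j β ξ)⁻¹ * 𝓕 f ξ := by
    have := congrArg (fun g : 𝓢(EuclideanSpace ℝ (Fin n), ℂ) ↦ 𝓕 g ξ) hyeq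
    simpa [sub_eq_add_neg, ← neg_smul, FourierTransform.fourier_add,
      FourierTransform.fourier_smul, hh, smulLeftCLM_apply_apply hE'] using this
  have huF : 𝓕 u = smulLeftCLM ℂ (phaseExp j β) (𝓕 y) := by
    rw [hu, FourierTransform.fourier_fourierInv_eq]
  refine ⟨u, ?_⟩
  have hop : schrodinger (fun x : EuclideanSpace ℝ (Fin n) ↦ (β * (x j : ℝ) - z : ℂ)) u =
      (-1 : ℂ) • lap n u + ((β : ℂ) • coordMul j u + (-z) • u) := by
    rw [schrodinger_apply]
    ext x
    simp [smulLeftCLM_apply_apply hG, coordMul_apply]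
    ring
  suffices 𝓕 (schrodinger (fun x : EuclideanSpace ℝ (Fin n) ↦ (β * (x j : ℝ) - z : ℂ)) u) = 𝓕 f by
    have := congrArg (fun g ↦ 𝓕⁻ g) this
    simpa only [FourierTransform.fourierInv_fourier_eq] using this
  have hx (v : 𝓢(EuclideanSpace ℝ (Fin n), ℂ)) (ξ) :
      𝓕 (coordMul j v) ξ = Complex.I / (2 * Real.pi) * partialD j (𝓕 v) ξ := by
    have hpi : (Real.pi : ℂ) ≠ 0 := by exact_mod_cast Real.pi_ne_zero
    rw [partialD_fourier, _root_.smul_apply, smul_eq_mul]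
    field_simp
    linear_combination (𝓕 (coordMul j v) ξ) * Complex.I_sq
  rw [hop]
  ext ξ
  have hEne : phaseExp j β ξ ≠ 0 := Complex.exp_ne_zero _
  have hder : partialD j (𝓕 u) ξ = phaseExp j β ξ * (partialD j (𝓕 y) ξ +
      (8 * Real.pi ^ 3 / β * ‖ξ‖ ^ 2 : ℝ) * Complex.I * 𝓕 y ξ) := by
    rw [huF, partialD_apply, smulLeftCLM_apply hE]
    simp only [smul_eq_mul]
    rw [fderiv_fun_mul (hE.1.differentiable (by simp) ξ) (𝓕 y).differentiableAt]
    simp only [_root_.add_apply, _root_.smul_apply, fderiv_phaseExp, smul_eq_mul, partialD_apply]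
    ring
  have hFu : 𝓕 u ξ = phaseExp j β ξ * 𝓕 y ξ := by
    rw [huF, smulLeftCLM_apply_apply hE, smul_eq_mul]
  simp only [FourierTransform.fourier_add, FourierTransform.fourier_smul, _root_.add_apply,
    _root_.smul_apply, smul_eq_mul, fourier_lap_apply, hx u, hder, hFu]
  have hpi : (Real.pi : ℂ) ≠ 0 := by exact_mod_cast Real.pi_ne_zero
  have hβ' : (β : ℂ) ≠ 0 := by exact_mod_cast hβ
  have hfin : 𝓕 f ξ = phaseExp j β ξ * ((β : ℂ) * 𝓕 (coordMul j y) ξ - z * 𝓕 y ξ) := by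
    rw [hyF]; field_simp
  rw [hfin, hx y]
  push_cast
  field_simp
  ring_nf
  simp only [Complex.I_sq]
  ring

theorem IsSmoothBounded.ofReal {V : EuclideanSpace ℝ (Fin n) → ℝ} (hV : ContDiff ℝ ∞ V)
    (hVb : ∀ k : ℕ, ∃ C : ℝ, ∀ x, ‖iteratedFDeriv ℝ k V x‖ ≤ C) :
    IsSmoothBounded fun x ↦ (V x : ℂ) := by
  refine ⟨Complex.ofRealCLM.contDiff.comp hV, fun k ↦ ?_⟩
  obtain ⟨C, hC⟩ := hVb k
  refine ⟨C, fun x ↦ le_of_eq_of_le ?_ (hC x)⟩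
  exact Complex.ofRealLI.norm_iteratedFDeriv_comp_left (hV.of_le (by exact_mod_cast le_top)).contDiffAt
    le_rfl

/-- The Stark operator is bijective on Schwartz space for nonreal spectral parameter. -/
theorem bijective_schrodinger_stark (j : Fin n) {β : ℝ} (hβ : β ≠ 0)
    {W : EuclideanSpace ℝ (Fin n) → ℂ} (hW : IsSmoothBounded W) (hWr : ∀ x, (W x).im = 0)
    {z : ℂ} (hz : z.im ≠ 0) :
    Function.Bijective
      (schrodinger ((fun x : EuclideanSpace ℝ (Fin n) ↦ (β * (x j : ℝ) - z : ℂ)) + W)) := by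
  have hG : (fun x : EuclideanSpace ℝ (Fin n) ↦ (β * (x j : ℝ) - z : ℂ)).HasTemperateGrowth := by
    have := hasTemperateGrowth_coord j
    fun_prop
  have hGc (x : EuclideanSpace ℝ (Fin n)) : (β * (x j : ℝ) - z : ℂ).im = -z.im := by simp
  constructor
  · refine (injective_iff_map_eq_zero _).2 fun u hu ↦ eq_zero_of_l2Seminorm_le_zero ?_
    have h := l2Seminorm_le_schrodinger (hG.add hW.hasTemperateGrowth) (c := -z.im)
      (fun x ↦ by simp [hWr]) u
    rw [hu, map_zero] at h
    exact nonpos_of_mul_nonpos_right h (by simpa using hz)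
  · refine surjective_schrodinger_add hG (fun v ↦ ?_) (neg_ne_zero.2 hz) hGc hW hWr
      (surjective_schrodinger_coord j hβ hz)
    have h (x : EuclideanSpace ℝ (Fin n)) := (((Complex.ofRealCLM.comp
      (EuclideanSpace.proj (𝕜 := ℝ) j)).hasFDerivAt (x := x)).const_mul (β : ℂ)).sub_const z
    have h' (x : EuclideanSpace ℝ (Fin n)) :
        fderiv ℝ (fun x : EuclideanSpace ℝ (Fin n) ↦ (β * (x j : ℝ) - z : ℂ)) x v = β * v j := by
      have h'' : HasFDerivAt (fun x : EuclideanSpace ℝ (Fin n) ↦ (β * (x j : ℝ) - z : ℂ)) _ x := h x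
      rw [h''.fderiv]
      simp
    simp only [h']
    exact IsSmoothBounded.const _

end Stark

/-- For the Stark Hamiltonian `P = −Δ + βx₁ + V` with `β > 0`, `V ∈ C_b^∞(ℝⁿ; ℝ)`, and
`Im z ≠ 0`, every Schwartz function `f` has a unique Schwartz solution `u` of
`(P − z) u = f`. -/
theorem stmt_4 (n : ℕ) (hn : 0 < n) (β : ℝ) (hβ : 0 < β)
    (V : EuclideanSpace ℝ (Fin n) → ℝ) (hV : ContDiff ℝ (⊤ : ℕ∞) V)
    (hVb : ∀ k : ℕ, ∃ C : ℝ, ∀ x, ‖iteratedFDeriv ℝ k V x‖ ≤ C)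
    (z : ℂ) (hz : z.im ≠ 0) (f : SchwartzMap (EuclideanSpace ℝ (Fin n)) ℂ) :
    ∃! u : SchwartzMap (EuclideanSpace ℝ (Fin n)) ℂ,
      ∀ x, -laplacian (⇑u) x + (((β * x ⟨0, hn⟩ + V x : ℝ) : ℂ) - z) * u x = f x := by
  have hW := Stark.IsSmoothBounded.ofReal hV hVb
  have hG : ((fun x : EuclideanSpace ℝ (Fin n) ↦ (β * (x ⟨0, hn⟩ : ℝ) - z : ℂ)) +
      fun x ↦ (V x : ℂ)).HasTemperateGrowth := by
    have := Stark.hasTemperateGrowth_coord (⟨0, hn⟩ : Fin n)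
    exact Function.HasTemperateGrowth.add (by fun_prop) hW.hasTemperateGrowth
  refine (existsUnique_congr fun u ↦ ?_).1
    ((Stark.bijective_schrodinger_stark ⟨0, hn⟩ hβ.ne' hW (by simp) hz).existsUnique f)
  rw [SchwartzMap.ext_iff]
  refine forall_congr' fun x ↦ ?_
  rw [Stark.schrodinger_apply, _root_.add_apply, _root_.neg_apply, Stark.lap_apply,
    SchwartzMap.smulLeftCLM_apply_apply hG, smul_eq_mul, Pi.add_apply]
  push_cast
  rw [sub_add_eq_add_sub]
end

section
/- Let n ≥ 1, β > 0, let V : ℝⁿ → ℝ be a smooth function all of whose derivatives (including V itself) are bounded, and let z ∈ ℂ with Im z ≠ 0. If u is a continuous linear functional on the Schwartz space 𝒮(ℝⁿ; ℂ) (i.e., a tempered distribution) such that u((−Δ + βx₁ + V − z)φ) = 0 for every φ ∈ 𝒮(ℝⁿ; ℂ), then u = 0. -/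
/-- A representation of the canonical commutation relations by operators `D i` (skew-symmetric)
and `X i` (symmetric) on a complex vector space `S` embedded by `J` into a Hilbert space. -/
structure WeylSystem {ι S 𝓗 : Type*} [DecidableEq ι] [AddCommGroup S] [Module ℂ S]
    [NormedAddCommGroup 𝓗] [InnerProductSpace ℂ 𝓗] (J : S →ₗ[ℂ] 𝓗)
    (D X : ι → Module.End ℂ S) : Prop where
  injective : Function.Injective J
  comm_D_X : ∀ i j f, D i (X j f) = X j (D i f) + if i = j then f else 0
  comm_D_D : ∀ i j f, D i (D j f) = D j (D i f)
  comm_X_X : ∀ i j f, X i (X j f) = X j (X i f)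
  skew_D : ∀ i f g, inner ℂ (J (D i f)) (J g) = -inner ℂ (J f) (J (D i g))
  symm_X : ∀ i f g, inner ℂ (J (X i f)) (J g) = inner ℂ (J f) (J (X i g))

/-- A family of symbols acting by `T` as bounded operators commuting with all `X i`, and closed
under commutators with the `D i`, the commutator being given by `d i`. -/
structure MultiplierFamily {ι S 𝓗 𝓜 : Type*} [AddCommGroup S] [Module ℂ S]
    [NormedAddCommGroup 𝓗] [InnerProductSpace ℂ 𝓗] (J : S →ₗ[ℂ] 𝓗)
    (D X : ι → Module.End ℂ S) (T : 𝓜 → Module.End ℂ S) (d : ι → 𝓜 → 𝓜) : Prop where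
  bounded : ∀ m, ∃ C : ℝ, ∀ f, ‖J (T m f)‖ ≤ C * ‖J f‖
  comm_X : ∀ m i f, X i (T m f) = T m (X i f)
  comm_D : ∀ m i f, D i (T m f) = T m (D i f) + T (d i m) f

namespace WeylSystem

variable {ι S 𝓗 𝓜 : Type*} [AddCommGroup S] [Module ℂ S]
  [NormedAddCommGroup 𝓗] [InnerProductSpace ℂ 𝓗]

/-- The two families `D i` and `ε X i` as a single family indexed by `Bool × ι`. -/
noncomputable def letter (D X : ι → Module.End ℂ S) (ε : ℝ) (b : Bool) (i : ι) :
    Module.End ℂ S :=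
  if b then (ε : ℂ) • X i else D i

/-- The harmonic oscillator `∑ (ε² Xᵢ² - Dᵢ²) + ε⁻²`. -/
noncomputable def oscillator [Fintype ι] (D X : ι → Module.End ℂ S) (ε : ℝ) : Module.End ℂ S :=
  ∑ i, (letter D X ε true i * letter D X ε true i - letter D X ε false i * letter D X ε false i)
    + ((ε ^ 2)⁻¹ : ℂ) • 1

/-- The operator `-∑ Dᵢ² + β X₀ + V`. -/
noncomputable def stark [Fintype ι] (D X : ι → Module.End ℂ S) (β : ℝ) (o : ι)
    (V : Module.End ℂ S) :
    Module.End ℂ S :=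
  -∑ i, D i * D i + (β : ℂ) • X o + V

variable {J : S →ₗ[ℂ] 𝓗} {D X : ι → Module.End ℂ S} {T : 𝓜 → Module.End ℂ S} {d : ι → 𝓜 → 𝓜}

theorem inner_letter [DecidableEq ι] (h : WeylSystem J D X) (ε : ℝ) (b : Bool) (i : ι) (f g : S) :
    inner ℂ (J (letter D X ε b i f)) (J g) =
      (if b then 1 else -1) * inner ℂ (J f) (J (letter D X ε b i g)) := by
  cases b
  · simp [letter, h.skew_D]
  · simp [letter, h.symm_X]

variable [Fintype ι]

theorem oscillator_apply (ε : ℝ) (f : S) : oscillator D X ε f =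
    ∑ i, (letter D X ε true i (letter D X ε true i f) -
      letter D X ε false i (letter D X ε false i f)) + ((ε ^ 2)⁻¹ : ℂ) • f := by
  simp [oscillator]

theorem stark_apply (β : ℝ) (o : ι) (V : Module.End ℂ S) (f : S) : stark D X β o V f =
    -∑ i, D i (D i f) + (β : ℂ) • X o f + V f := by
  simp [stark]

theorem oscillator_multiplier (hT : MultiplierFamily J D X T d) (ε : ℝ) (m : 𝓜) (f : S) :
    oscillator D X ε (T m f) = T m (oscillator D X ε f) -
      ∑ i, ((2 : ℂ) • T (d i m) (letter D X ε false i f) + T (d i (d i m)) f) := by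
  simp only [oscillator_apply, letter, map_add, map_sum, map_sub, map_smul, hT.comm_X, hT.comm_D,
    Finset.sum_sub_distrib, Finset.sum_add_distrib, two_smul, if_true, LinearMap.smul_apply,
    Bool.false_eq_true, if_false]
  abel

variable [DecidableEq ι]

theorem oscillator_letter (h : WeylSystem J D X) (ε : ℝ) (b : Bool) (j : ι) (f : S) :
    oscillator D X ε (letter D X ε b j f) =
      letter D X ε b j (oscillator D X ε f) - (2 * ε : ℂ) • letter D X ε (!b) j f := by
  have key : ∀ i, letter D X ε true i (letter D X ε true i (letter D X ε b j f)) -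
      letter D X ε false i (letter D X ε false i (letter D X ε b j f)) =
      letter D X ε b j (letter D X ε true i (letter D X ε true i f) -
      letter D X ε false i (letter D X ε false i f)) -
      if i = j then (2 * ε : ℂ) • letter D X ε (!b) j f else 0 := by
    intro i
    cases b
    · have e1 : X i (D j f) = D j (X i f) - if j = i then f else 0 := by
        rw [h.comm_D_X, add_sub_cancel_right]
      have e2 : X i (D j (X i f)) = D j (X i (X i f)) - if j = i then X i f else 0 := by
        rw [h.comm_D_X j i (X i f), add_sub_cancel_right]
      have e3 : D i (D i (D j f)) = D j (D i (D i f)) := by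
        rw [h.comm_D_D i j f, h.comm_D_D i j]
      rcases eq_or_ne i j with rfl | hij
      · simp [letter, e1, e2]
        module
      · simp [letter, e1, e2, e3, hij, hij.symm]
    · rcases eq_or_ne i j with rfl | hij
      · simp [letter, h.comm_D_X]
        module
      · simp [letter, h.comm_D_X, hij, h.comm_X_X i j, smul_sub]
  rw [oscillator_apply, oscillator_apply, Finset.sum_congr rfl fun i _ => key i]
  simp [Finset.sum_sub_distrib, map_sum]
  abel

theorem inner_oscillator (h : WeylSystem J D X) (ε : ℝ) (f g : S) :
    inner ℂ (J (oscillator D X ε f)) (J g) = inner ℂ (J f) (J (oscillator D X ε g)) := by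
  simp only [oscillator_apply, map_add, map_sum, map_sub, map_smul, inner_add_left,
    inner_add_right, sum_inner, inner_sum, inner_sub_left, inner_sub_right, inner_smul_left,
    inner_smul_right, inner_letter h]
  simp

theorem inner_oscillator_pow (h : WeylSystem J D X) (ε : ℝ) (N : ℕ) (f g : S) :
    inner ℂ (J ((oscillator D X ε ^ N) f)) (J g) =
      inner ℂ (J f) (J ((oscillator D X ε ^ N) g)) := by
  induction N generalizing f g with
  | zero => simp
  | succ N ih =>
    rw [pow_succ, Module.End.mul_apply, ih, inner_oscillator h, ← Module.End.mul_apply,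
      ← pow_succ', pow_succ]

theorem energy (h : WeylSystem J D X) (ε : ℝ) (f : S) :
    (inner ℂ (J f) (J (oscillator D X ε f))).re =
      ∑ i, (‖J (letter D X ε true i f)‖ ^ 2 + ‖J (letter D X ε false i f)‖ ^ 2) +
        (ε ^ 2)⁻¹ * ‖J f‖ ^ 2 := by
  have e1 : ∀ b i, inner ℂ (J f) (J (letter D X ε b i (letter D X ε b i f))) =
      (if b then 1 else -1) * (‖J (letter D X ε b i f)‖ ^ 2 : ℂ) := by
    intro b i
    have := inner_letter h ε b i f (letter D X ε b i f)
    rw [inner_self_eq_norm_sq_to_K] at this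
    cases b <;> simp_all
  simp only [oscillator_apply, map_add, map_sum, map_sub, map_smul,
    inner_add_right, inner_sum, inner_sub_right, inner_smul_right, e1, inner_self_eq_norm_sq_to_K]
  simp only [Complex.add_re, Complex.re_sum]
  congr 1
  · refine Finset.sum_congr rfl fun i _ => ?_
    norm_cast
    simp
  · norm_cast
    exact Complex.re_ofReal_mul _ _

theorem energy_le (f g : S) : (inner ℂ (J f) (J g)).re ≤ ‖J f‖ * ‖J g‖ :=
  (Complex.re_le_norm _).trans (norm_inner_le_norm _ _)

theorem norm_letter_sq_le (h : WeylSystem J D X) (ε : ℝ) (b : Bool) (i : ι) (f : S) :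
    ‖J (letter D X ε b i f)‖ ^ 2 ≤ (inner ℂ (J f) (J (oscillator D X ε f))).re := by
  rw [energy h]
  have h1 : ‖J (letter D X ε b i f)‖ ^ 2 ≤
      ‖J (letter D X ε true i f)‖ ^ 2 + ‖J (letter D X ε false i f)‖ ^ 2 := by
    cases b
    · linarith [sq_nonneg ‖J (letter D X ε true i f)‖]
    · linarith [sq_nonneg ‖J (letter D X ε false i f)‖]
  have h2 := Finset.single_le_sum (f := fun i => ‖J (letter D X ε true i f)‖ ^ 2 +
    ‖J (letter D X ε false i f)‖ ^ 2) (fun _ _ => by positivity) (Finset.mem_univ i)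
  have h3 : 0 ≤ (ε ^ 2)⁻¹ * ‖J f‖ ^ 2 := by positivity
  linarith

theorem norm_le_oscillator (h : WeylSystem J D X) {ε : ℝ} (hε : 0 < ε) (f : S) :
    ‖J f‖ ≤ ε ^ 2 * ‖J (oscillator D X ε f)‖ := by
  have h1 := energy h ε f
  have h2 := energy_le (J := J) f (oscillator D X ε f)
  have h3 : 0 ≤ ∑ i, (‖J (letter D X ε true i f)‖ ^ 2 + ‖J (letter D X ε false i f)‖ ^ 2) :=
    Finset.sum_nonneg fun _ _ => by positivity
  have h4 : (ε ^ 2)⁻¹ * ‖J f‖ ^ 2 ≤ ‖J f‖ * ‖J (oscillator D X ε f)‖ := by linarith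
  rw [inv_mul_le_iff₀ (by positivity)] at h4
  rcases (norm_nonneg (J f)).eq_or_lt with h0 | h0
  · rw [← h0]; positivity
  · refine le_of_mul_le_mul_left (a := ‖J f‖) ?_ h0
    nlinarith

theorem norm_letter_le (h : WeylSystem J D X) {ε : ℝ} (hε : 0 < ε) (b : Bool) (i : ι) (f : S) :
    ‖J (letter D X ε b i f)‖ ≤ ε * ‖J (oscillator D X ε f)‖ := by
  have h1 := norm_letter_sq_le h ε b i f
  have h2 := energy_le (J := J) f (oscillator D X ε f)
  have h3 := norm_le_oscillator h hε f
  refine abs_le_of_sq_le_sq' ?_ (by positivity) |>.2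
  nlinarith [norm_nonneg (J (oscillator D X ε f))]

theorem norm_letter_letter_le (h : WeylSystem J D X) {ε : ℝ} (hε : 0 < ε) (hε1 : ε ≤ 1)
    (b b' : Bool) (i i' : ι) (f : S) :
    ‖J (letter D X ε b i (letter D X ε b' i' f))‖ ≤ 2 * ‖J (oscillator D X ε f)‖ := by
  set a := ‖J (letter D X ε b' i' (letter D X ε b' i' f))‖ with ha
  set c := ‖J (oscillator D X ε f)‖ with hc
  have hc0 : 0 ≤ c := norm_nonneg _
  have ha0 : 0 ≤ a := norm_nonneg _
  have main : ∀ b i, ‖J (letter D X ε b i (letter D X ε b' i' f))‖ ^ 2 ≤ a * c + 2 * c ^ 2 := by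
    intro b i
    refine (norm_letter_sq_le h ε b i _).trans ((Complex.re_le_norm _).trans ?_)
    rw [oscillator_letter h, map_sub, map_smul, inner_sub_right, inner_smul_right]
    refine (norm_sub_le _ _).trans (add_le_add ?_ ?_)
    · have := inner_letter h ε b' i' (letter D X ε b' i' f) (oscillator D X ε f)
      have hn : ‖inner ℂ (J (letter D X ε b' i' f)) (J (letter D X ε b' i' (oscillator D X ε f)))‖
          = ‖inner ℂ (J (letter D X ε b' i' (letter D X ε b' i' f))) (J (oscillator D X ε f))‖ := by
        rw [this, norm_mul]
        cases b' <;> simp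
      rw [hn]
      exact norm_inner_le_norm _ _
    · rw [norm_mul]
      have e1 := norm_letter_le h hε b' i' f
      have e2 := norm_letter_le h hε (!b') i' f
      have e3 := norm_inner_le_norm (𝕜 := ℂ) (J (letter D X ε b' i' f))
        (J (letter D X ε (!b') i' f))
      have e4 : ‖(2 * ε : ℂ)‖ = 2 * ε := by
        simp [abs_of_pos hε]
      rw [e4]
      have e5 : ‖J (letter D X ε b' i' f)‖ ≤ c := e1.trans (by nlinarith)
      have e6 : ‖J (letter D X ε (!b') i' f)‖ ≤ c := e2.trans (by nlinarith)
      have e7 : ‖J (letter D X ε b' i' f)‖ * ‖J (letter D X ε (!b') i' f)‖ ≤ c * c := by gcongr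
      calc _ ≤ 2 * ε * (c * c) := by gcongr; exact e3.trans e7
        _ ≤ 2 * c ^ 2 := by nlinarith [mul_nonneg hc0 hc0]
  have ha2 : a ≤ 2 * c := by
    have := main b' i'
    rw [← ha] at this
    nlinarith
  refine abs_le_of_sq_le_sq' ?_ (by positivity) |>.2
  nlinarith [main b i]

theorem norm_pow_oscillator_le_succ (h : WeylSystem J D X) {ε : ℝ} (hε : 0 < ε) (j : ℕ) (f : S) :
    ‖J ((oscillator D X ε ^ j) f)‖ ≤ ε ^ 2 * ‖J ((oscillator D X ε ^ (j + 1)) f)‖ := by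
  rw [pow_succ' (oscillator D X ε), Module.End.mul_apply]
  exact norm_le_oscillator h hε _

theorem norm_pow_oscillator_letter_le (h : WeylSystem J D X) {ε : ℝ} (hε : 0 < ε) (hε1 : ε ≤ 1)
    (j : ℕ) (b : Bool) (i : ι) (f : S) :
    ‖J ((oscillator D X ε ^ j) (letter D X ε b i f))‖ ≤
      3 ^ j * (ε * ‖J ((oscillator D X ε ^ (j + 1)) f)‖) := by
  induction j generalizing f b with
  | zero => simpa using norm_letter_le h hε b i f
  | succ j ih =>
    rw [pow_succ, Module.End.mul_apply, oscillator_letter h, map_sub, map_sub, map_smul, map_smul]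
    refine (norm_sub_le _ _).trans ?_
    have h1 := ih b (oscillator D X ε f)
    rw [← Module.End.mul_apply (oscillator D X ε ^ (j + 1)), ← pow_succ] at h1
    have h2 := ih (!b) f
    have h3 := norm_pow_oscillator_le_succ h hε (j + 1) f
    have h4 : ‖J ((oscillator D X ε ^ (j + 1)) f)‖ ≤ ‖J ((oscillator D X ε ^ (j + 1 + 1)) f)‖ :=
      h3.trans (mul_le_of_le_one_left (norm_nonneg _) (by nlinarith))
    have e4 : ‖(2 * ε : ℂ)‖ = 2 * ε := by simp [abs_of_pos hε]
    rw [norm_smul, e4]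
    have h5 : 2 * ε * ‖J ((oscillator D X ε ^ j) (letter D X ε (!b) i f))‖ ≤
        2 * (3 ^ j * (ε * ‖J ((oscillator D X ε ^ (j + 1 + 1)) f)‖)) := by
      calc _ ≤ 2 * 1 * (3 ^ j * (ε * ‖J ((oscillator D X ε ^ (j + 1 + 1)) f)‖)) := by
            gcongr
            exact h2.trans (by gcongr)
        _ = _ := by ring
    calc _ ≤ _ := add_le_add h1 h5
      _ = _ := by ring

theorem norm_pow_oscillator_letter_letter_le (h : WeylSystem J D X) {ε : ℝ} (hε : 0 < ε)
    (hε1 : ε ≤ 1) (j : ℕ) (b b' : Bool) (i i' : ι) (f : S) :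
    ‖J ((oscillator D X ε ^ j) (letter D X ε b i (letter D X ε b' i' f)))‖ ≤
      2 * 5 ^ j * ‖J ((oscillator D X ε ^ (j + 1)) f)‖ := by
  induction j generalizing f b b' with
  | zero => simpa using norm_letter_letter_le h hε hε1 b b' i i' f
  | succ j ih =>
    rw [pow_succ, Module.End.mul_apply, oscillator_letter h, oscillator_letter h]
    simp only [map_sub, map_smul]
    have h1 := ih b b' (oscillator D X ε f)
    rw [← Module.End.mul_apply (oscillator D X ε ^ (j + 1)), ← pow_succ] at h1
    have h3 := norm_pow_oscillator_le_succ h hε (j + 1) f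
    have h4 : ‖J ((oscillator D X ε ^ (j + 1)) f)‖ ≤ ‖J ((oscillator D X ε ^ (j + 1 + 1)) f)‖ :=
      h3.trans (mul_le_of_le_one_left (norm_nonneg _) (by nlinarith))
    have e4 : ‖(2 * ε : ℂ)‖ ≤ 2 := by simp [abs_of_pos hε, hε1]
    have h5 : ∀ b b', ‖(2 * ε : ℂ) •
        J ((oscillator D X ε ^ j) (letter D X ε b i (letter D X ε b' i' f)))‖ ≤
        2 * (2 * 5 ^ j * ‖J ((oscillator D X ε ^ (j + 1 + 1)) f)‖) := by
      intro b b'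
      rw [norm_smul]
      gcongr
      exact (ih b b' f).trans (by gcongr)
    refine (norm_sub_le _ _).trans ((add_le_add_left (norm_sub_le _ _) _).trans ?_)
    calc _ ≤ _ := add_le_add (add_le_add h1 (h5 b (!b'))) (h5 (!b) b')
      _ = _ := by ring

theorem norm_pow_oscillator_multiplier_le (h : WeylSystem J D X)
    (hT : MultiplierFamily J D X T d) (j : ℕ) (m : 𝓜) :
    ∃ C : ℝ, 0 ≤ C ∧ ∀ ε : ℝ, 0 < ε → ε ≤ 1 → ∀ f, ‖J ((oscillator D X ε ^ j) (T m f))‖ ≤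
      C * ‖J ((oscillator D X ε ^ j) f)‖ := by
  induction j generalizing m with
  | zero =>
    obtain ⟨C, hC⟩ := hT.bounded m
    exact ⟨max C 0, le_max_right _ _, fun ε _ _ f => by
      simpa using (hC f).trans (mul_le_mul_of_nonneg_right (le_max_left _ _) (norm_nonneg _))⟩
  | succ j ih =>
    choose C hC0 hC using ih
    refine ⟨C m + ∑ i, (2 * (C (d i m) * 3 ^ j) + C (d i (d i m))), ?_, fun ε hε hε1 f => ?_⟩
    · exact add_nonneg (hC0 _) (Finset.sum_nonneg fun i _ =>
        add_nonneg (mul_nonneg zero_le_two (mul_nonneg (hC0 _) (by positivity))) (hC0 _))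
    · have h4 : ‖J ((oscillator D X ε ^ j) f)‖ ≤ ‖J ((oscillator D X ε ^ (j + 1)) f)‖ :=
        (norm_pow_oscillator_le_succ h hε j f).trans
          (mul_le_of_le_one_left (norm_nonneg _) (by nlinarith))
      rw [pow_succ, Module.End.mul_apply, oscillator_multiplier hT]
      simp only [map_sub, map_sum, map_add, map_smul]
      refine (norm_sub_le _ _).trans ?_
      rw [add_mul, Finset.sum_mul]
      refine add_le_add ?_ ((norm_sum_le _ _).trans (Finset.sum_le_sum fun i _ => ?_))
      · simpa [pow_succ] using hC m ε hε hε1 (oscillator D X ε f)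
      · refine (norm_add_le _ _).trans ?_
        rw [add_mul, norm_smul, ← pow_succ]
        refine add_le_add ?_ ?_
        · simp only [Complex.norm_ofNat, mul_assoc]
          gcongr
          refine (hC (d i m) ε hε hε1 _).trans (mul_le_mul_of_nonneg_left ?_ (hC0 _))
          refine (norm_pow_oscillator_letter_le h hε hε1 j false i f).trans ?_
          gcongr
          exact mul_le_of_le_one_left (norm_nonneg _) hε1
        · exact (hC _ ε hε hε1 f).trans (mul_le_mul_of_nonneg_left h4 (hC0 _))


theorem norm_pow_oscillator_le_mono (h : WeylSystem J D X) {ε : ℝ} (hε : 0 < ε) (hε1 : ε ≤ 1)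
    (j : ℕ) (f : S) :
    ‖J ((oscillator D X ε ^ j) f)‖ ≤ ε * ‖J ((oscillator D X ε ^ (j + 1)) f)‖ :=
  (norm_pow_oscillator_le_succ h hε j f).trans
    (mul_le_mul_of_nonneg_right (by nlinarith) (norm_nonneg _))

theorem oscillator_stark (h : WeylSystem J D X) (hT : MultiplierFamily J D X T d) {ε : ℝ}
    (hε : ε ≠ 0) (β : ℝ) (o : ι) (m : 𝓜) (f : S) :
    oscillator D X ε (stark D X β o (T m) f) = stark D X β o (T m) (oscillator D X ε f) +
      (∑ i, (2 * ε : ℂ) • (letter D X ε true i (letter D X ε false i f) +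
          letter D X ε false i (letter D X ε true i f)) -
        (2 * β : ℂ) • letter D X ε false o f -
        ∑ i, ((2 : ℂ) • T (d i m) (letter D X ε false i f) + T (d i (d i m)) f)) := by
  have hD : ∀ i g, D i g = letter D X ε false i g := fun i g => by simp [letter]
  have hε' : (ε : ℂ) ≠ 0 := by exact_mod_cast hε
  have hX : ∀ g, (β : ℂ) • X o g = (β * (ε : ℂ)⁻¹) • letter D X ε true o g := fun g => by
    simp only [letter, if_true, LinearMap.smul_apply, smul_smul, mul_assoc, inv_mul_cancel₀ hε',
      mul_one]
  have e : (2 * β : ℂ) = (β * (ε : ℂ)⁻¹) * (2 * ε) := by field_simp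
  simp only [stark_apply, map_add, map_neg, map_sum, hX, hD, map_smul, oscillator_letter h,
    oscillator_multiplier hT, map_sub, Bool.not_true, Bool.not_false, smul_sub, smul_add,
    Finset.sum_sub_distrib, Finset.sum_add_distrib, e, mul_smul]
  abel

theorem norm_pow_oscillator_comm_stark_le (h : WeylSystem J D X)
    (hT : MultiplierFamily J D X T d) (β : ℝ) (o : ι) (m : 𝓜) (j : ℕ) :
    ∃ C : ℝ, 0 ≤ C ∧ ∀ ε : ℝ, 0 < ε → ε ≤ 1 → ∀ f, ‖J ((oscillator D X ε ^ j)
      (oscillator D X ε (stark D X β o (T m) f) - stark D X β o (T m) (oscillator D X ε f)))‖ ≤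
      C * (ε * ‖J ((oscillator D X ε ^ (j + 1)) f)‖) := by
  choose C hC0 hC using fun m => norm_pow_oscillator_multiplier_le h hT j m
  refine ⟨∑ _i : ι, 2 * (2 * 5 ^ j + 2 * 5 ^ j) + 2 * |β| * 3 ^ j +
    ∑ i, (2 * (C (d i m) * 3 ^ j) + C (d i (d i m))), ?_, fun ε hε hε1 f => ?_⟩
  · refine add_nonneg (by positivity) (Finset.sum_nonneg fun i _ => ?_)
    exact add_nonneg (mul_nonneg zero_le_two (mul_nonneg (hC0 _) (by positivity))) (hC0 _)
  set A := ε * ‖J ((oscillator D X ε ^ (j + 1)) f)‖ with hA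
  rw [oscillator_stark h hT hε.ne', add_sub_cancel_left, add_mul, add_mul, Finset.sum_mul,
    Finset.sum_mul]
  simp only [map_sub, map_sum, map_add, map_smul]
  have e4 : ‖(2 * ε : ℂ)‖ = 2 * ε := by simp [abs_of_pos hε]
  refine (norm_sub_le _ _).trans (add_le_add ((norm_sub_le _ _).trans (add_le_add ?_ ?_)) ?_)
  · refine (norm_sum_le _ _).trans (Finset.sum_le_sum fun i _ => ?_)
    rw [norm_smul, e4]
    calc _ ≤ 2 * ε * (2 * 5 ^ j * ‖J ((oscillator D X ε ^ (j + 1)) f)‖ +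
          2 * 5 ^ j * ‖J ((oscillator D X ε ^ (j + 1)) f)‖) := by
          gcongr
          exact (norm_add_le _ _).trans (add_le_add
            (norm_pow_oscillator_letter_letter_le h hε hε1 j _ _ _ _ f)
            (norm_pow_oscillator_letter_letter_le h hε hε1 j _ _ _ _ f))
      _ = _ := by rw [hA]; ring
  · rw [norm_smul, mul_assoc]
    have : ‖(2 * β : ℂ)‖ = 2 * |β| := by simp
    rw [this]
    gcongr
    exact norm_pow_oscillator_letter_le h hε hε1 j false o f
  · refine (norm_sum_le _ _).trans (Finset.sum_le_sum fun i _ => ?_)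
    refine (norm_add_le _ _).trans ?_
    rw [add_mul, norm_smul]
    refine add_le_add ?_ ?_
    · simp only [Complex.norm_ofNat, mul_assoc]
      gcongr
      exact (hC (d i m) ε hε hε1 _).trans (mul_le_mul_of_nonneg_left
        (norm_pow_oscillator_letter_le h hε hε1 j false i f) (hC0 _))
    · exact (hC _ ε hε hε1 f).trans (mul_le_mul_of_nonneg_left
        (norm_pow_oscillator_le_mono h hε hε1 j f) (hC0 _))

theorem norm_comm_pow_oscillator_stark_le (h : WeylSystem J D X)
    (hT : MultiplierFamily J D X T d) (β : ℝ) (o : ι) (m : 𝓜) (N : ℕ) :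
    ∃ C : ℝ, 0 ≤ C ∧ ∀ ε : ℝ, 0 < ε → ε ≤ 1 → ∀ f,
      ‖J ((oscillator D X ε ^ N) (stark D X β o (T m) f) -
        stark D X β o (T m) ((oscillator D X ε ^ N) f))‖ ≤
      C * (ε * ‖J ((oscillator D X ε ^ N) f)‖) := by
  induction N with
  | zero => exact ⟨0, le_rfl, fun ε _ _ f => by simp⟩
  | succ N ih =>
    obtain ⟨C, hC0, hC⟩ := ih
    obtain ⟨C', hC'0, hC'⟩ := norm_pow_oscillator_comm_stark_le h hT β o m N
    refine ⟨C' + C, by positivity, fun ε hε hε1 f => ?_⟩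
    have h1 := hC ε hε hε1 (oscillator D X ε f)
    have h2 := hC' ε hε hε1 f
    have e : (oscillator D X ε ^ (N + 1)) (stark D X β o (T m) f) -
        stark D X β o (T m) ((oscillator D X ε ^ (N + 1)) f) =
        (oscillator D X ε ^ N) (oscillator D X ε (stark D X β o (T m) f) -
          stark D X β o (T m) (oscillator D X ε f)) +
        ((oscillator D X ε ^ N) (stark D X β o (T m) (oscillator D X ε f)) -
        stark D X β o (T m) ((oscillator D X ε ^ N) (oscillator D X ε f))) := by
      simp [pow_succ]
    rw [e, map_add, add_mul]
    refine (norm_add_le _ _).trans (add_le_add h2 ?_)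
    simpa [pow_succ] using h1

theorem norm_pow_oscillator_stark_le (h : WeylSystem J D X)
    (hT : MultiplierFamily J D X T d) (β : ℝ) (o : ι) (m : 𝓜) {ε : ℝ} (hε : 0 < ε)
    (hε1 : ε ≤ 1) (N : ℕ) :
    ∃ C : ℝ, 0 ≤ C ∧ ∀ f, ‖J ((oscillator D X ε ^ N) (stark D X β o (T m) f))‖ ≤
      C * ‖J ((oscillator D X ε ^ (N + 1)) f)‖ := by
  obtain ⟨C, hC0, hC⟩ := norm_pow_oscillator_multiplier_le h hT N m
  refine ⟨∑ _i : ι, 2 * 5 ^ N + |β| * ε⁻¹ * 3 ^ N + C, by positivity, fun f => ?_⟩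
  have hD : ∀ i g, D i g = letter D X ε false i g := fun i g => by simp [letter]
  have hX : ∀ g, X o g = ((ε⁻¹ : ℝ) : ℂ) • letter D X ε true o g := fun g => by
    simp only [letter, if_true, LinearMap.smul_apply, smul_smul, ← Complex.ofReal_mul,
      inv_mul_cancel₀ hε.ne', Complex.ofReal_one, one_smul]
  have hle : ε * ‖J ((oscillator D X ε ^ (N + 1)) f)‖ ≤ ‖J ((oscillator D X ε ^ (N + 1)) f)‖ :=
    mul_le_of_le_one_left (norm_nonneg _) hε1
  simp only [stark_apply, map_add, map_neg, map_sum, hX, hD, map_smul, add_mul, Finset.sum_mul]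
  refine (norm_add_le _ _).trans (add_le_add ((norm_add_le _ _).trans (add_le_add ?_ ?_)) ?_)
  · rw [norm_neg]
    refine (norm_sum_le _ _).trans (Finset.sum_le_sum fun i _ => ?_)
    exact norm_pow_oscillator_letter_letter_le h hε hε1 N _ _ _ _ f
  · rw [norm_smul, norm_smul, Complex.norm_real, Complex.norm_real, Real.norm_eq_abs,
      Real.norm_eq_abs, abs_of_pos (inv_pos.2 hε), mul_assoc, mul_assoc]
    gcongr
    exact (norm_pow_oscillator_letter_le h hε hε1 N true o f).trans (by gcongr)
  · exact (hC ε hε hε1 f).trans (mul_le_mul_of_nonneg_left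
      ((norm_pow_oscillator_le_mono h hε hε1 N f).trans hle) hC0)

theorem im_inner_stark_self (h : WeylSystem J D X) (β : ℝ) (o : ι) {V : Module.End ℂ S}
    (hV : ∀ f g, inner ℂ (J (V f)) (J g) = inner ℂ (J f) (J (V g))) (f : S) :
    (inner ℂ (J f) (J (stark D X β o V f))).im = 0 := by
  rw [← Complex.conj_eq_iff_im, inner_conj_symm]
  simp only [stark_apply, map_add, map_neg, map_sum, map_smul, inner_add_left, inner_add_right,
    inner_neg_left, inner_neg_right, sum_inner, inner_sum, inner_smul_left, inner_smul_right,
    h.skew_D, h.symm_X, hV, Complex.conj_ofReal, neg_neg]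

/-- Galerkin approximation: the equation `(P - z) φ = ψ` can be solved weakly in any
finite-dimensional subspace when `P` has real quadratic form and `z` is not real. -/
theorem exists_galerkin (hJ : Function.Injective J) {P : Module.End ℂ S}
    (hP : ∀ f, (inner ℂ (J f) (J (P f))).im = 0) {z : ℂ} (hz : z.im ≠ 0) (E : Submodule ℂ S)
    [FiniteDimensional ℂ E] (ψ : S) :
    ∃ φ ∈ E, ∀ e ∈ E, inner ℂ (J e) (J (P φ - z • φ)) = inner ℂ (J e) (J ψ) := by
  let F : Submodule ℂ 𝓗 := E.map J
  let A : E →ₗ[ℂ] F := F.orthogonalProjectionOnto.toLinearMap ∘ₗ J ∘ₗ (P - z • 1) ∘ₗ E.subtype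
  have hA : ∀ (φ : E) (e : F), inner ℂ (e : 𝓗) (A φ : 𝓗) = inner ℂ (e : 𝓗) (J (P φ - z • φ)) := by
    intro φ e
    exact Submodule.inner_orthogonalProjectionOnto_eq_of_mem_left e _
  have hinj : Function.Injective A := by
    rw [injective_iff_map_eq_zero]
    intro φ hφ
    have h1 := hA φ ⟨J φ, Submodule.mem_map_of_mem φ.2⟩
    rw [hφ] at h1
    have h2 := congrArg Complex.im h1
    simp only [ZeroMemClass.coe_zero, inner_zero_right, map_sub, map_smul, inner_sub_right,
      inner_smul_right, Complex.sub_im, hP, Complex.zero_im, zero_sub] at h2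
    rw [inner_self_eq_norm_sq_to_K] at h2
    have h3 : z.im * ‖J φ‖ ^ 2 = 0 := by
      have : ((‖J φ‖ : ℂ) ^ 2) = ((‖J φ‖ ^ 2 : ℝ) : ℂ) := by push_cast; rfl
      simp only [Complex.coe_algebraMap] at h2
      rw [this, Complex.im_mul_ofReal] at h2
      linarith
    have h4 : J φ = 0 := by simpa [hz] using h3
    exact Subtype.ext (hJ (by simpa using h4))
  have hfin : Module.finrank ℂ E = Module.finrank ℂ F :=
    (LinearEquiv.finrank_eq (Submodule.equivMapOfInjective J hJ E))
  obtain ⟨φ, hφ⟩ := (LinearMap.injective_iff_surjective_of_finrank_eq_finrank hfin).1 hinj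
    (F.orthogonalProjectionOnto (J ψ))
  refine ⟨φ, φ.2, fun e he => ?_⟩
  have h1 := hA φ ⟨J e, Submodule.mem_map_of_mem he⟩
  rw [hφ] at h1
  rw [← h1]
  exact Submodule.inner_orthogonalProjectionOnto_eq_of_mem_left (K := F)
    ⟨J e, Submodule.mem_map_of_mem he⟩ _

theorem galerkin_bound (h : WeylSystem J D X) {P : Module.End ℂ S}
    (hP : ∀ f, (inner ℂ (J f) (J (P f))).im = 0) {z : ℂ} {ε C : ℝ} {N : ℕ}
    (hC : ∀ f, ‖J ((oscillator D X ε ^ N) (P f) - P ((oscillator D X ε ^ N) f))‖ ≤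
      C * ‖J ((oscillator D X ε ^ N) f)‖) (hCz : C < |z.im|) {φ ψ : S}
    (hφ : inner ℂ (J ((oscillator D X ε ^ N) ((oscillator D X ε ^ N) φ))) (J (P φ - z • φ)) =
      inner ℂ (J ((oscillator D X ε ^ N) ((oscillator D X ε ^ N) φ))) (J ψ)) :
    ‖J ((oscillator D X ε ^ N) φ)‖ ≤ ‖J ((oscillator D X ε ^ N) ψ)‖ / (|z.im| - C) := by
  rw [inner_oscillator_pow h ε N _ (P φ - z • φ), inner_oscillator_pow h ε N _ ψ] at hφ
  set g := (oscillator D X ε ^ N) φ with hg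
  have e1 : (oscillator D X ε ^ N) (P φ - z • φ) =
      ((oscillator D X ε ^ N) (P φ) - P g) + P g - z • g := by
    simp [hg]
  rw [e1] at hφ
  have h2 := congrArg Complex.im hφ
  rw [map_sub, map_add, inner_sub_right, inner_add_right, map_smul, inner_smul_right,
    inner_self_eq_norm_sq_to_K, Complex.sub_im, Complex.add_im, hP] at h2
  have h3 : (z * ((‖J g‖ : ℂ) ^ 2)).im = z.im * ‖J g‖ ^ 2 := by
    have : ((‖J g‖ : ℂ) ^ 2) = ((‖J g‖ ^ 2 : ℝ) : ℂ) := by push_cast; rfl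
    rw [this, Complex.im_mul_ofReal]
  simp only [Complex.coe_algebraMap] at h2
  rw [h3] at h2
  have h4 := (Complex.abs_im_le_norm _).trans (norm_inner_le_norm (𝕜 := ℂ) (J g)
    (J ((oscillator D X ε ^ N) (P φ) - P g)))
  have h5 := (Complex.abs_im_le_norm _).trans (norm_inner_le_norm (𝕜 := ℂ) (J g)
    (J ((oscillator D X ε ^ N) ψ)))
  have h6 : |z.im| * ‖J g‖ ^ 2 ≤ ‖J g‖ * (C * ‖J g‖) + ‖J g‖ * ‖J ((oscillator D X ε ^ N) ψ)‖ := by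
    have : |z.im| * ‖J g‖ ^ 2 = |z.im * ‖J g‖ ^ 2| := by
      rw [abs_mul, abs_of_nonneg (sq_nonneg ‖J g‖)]
    rw [this]
    have e2 : z.im * ‖J g‖ ^ 2 = (inner ℂ (J g) (J ((oscillator D X ε ^ N) (P φ) - P g))).im -
      (inner ℂ (J g) (J ((oscillator D X ε ^ N) ψ))).im := by linarith
    rw [e2]
    refine (abs_sub _ _).trans (add_le_add (h4.trans ?_) h5)
    exact mul_le_mul_of_nonneg_left (hC φ) (norm_nonneg _)
  rw [le_div_iff₀ (by linarith)]
  rcases (norm_nonneg (J g)).eq_or_lt with h0 | h0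
  · rw [← h0]; simp
  · refine le_of_mul_le_mul_left (a := ‖J g‖) ?_ h0
    nlinarith

theorem exists_inner_representation [CompleteSpace 𝓗] {A : S →ₗ[ℂ] 𝓗}
    (hA : Function.Injective A) (u : S →ₗ[ℂ] ℂ) {C : ℝ} (hu : ∀ f, ‖u f‖ ≤ C * ‖A f‖) :
    ∃ w : 𝓗, ∀ f, u f = inner ℂ w (A f) := by
  let e := LinearEquiv.ofInjective A hA
  let l : StrongDual ℂ (LinearMap.range A) := (u ∘ₗ e.symm.toLinearMap).mkContinuous C (by
    intro x
    obtain ⟨f, rfl⟩ := e.surjective x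
    simpa [e] using hu f)
  obtain ⟨L, hL, -⟩ := exists_extension_norm_eq _ l
  refine ⟨(InnerProductSpace.toDual ℂ 𝓗).symm L, fun f => ?_⟩
  rw [InnerProductSpace.toDual_symm_apply]
  have := hL (e f)
  simpa [l, e] using this.symm

theorem eq_zero_of_stark_sub_smul [CompleteSpace 𝓗] (h : WeylSystem J D X)
    (hT : MultiplierFamily J D X T d) (β : ℝ) (o : ι) (m : 𝓜)
    (hm : ∀ f g, inner ℂ (J (T m f)) (J g) = inner ℂ (J f) (J (T m g))) {z : ℂ} (hz : z.im ≠ 0)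
    (u : S →ₗ[ℂ] ℂ) {N : ℕ}
    (hbound : ∀ ε : ℝ, 0 < ε → ε ≤ 1 → ∃ C, ∀ f, ‖u f‖ ≤ C * ‖J ((oscillator D X ε ^ N) f)‖)
    (hE : ∀ ε : ℝ, 0 < ε → ∃ E : ℕ → Submodule ℂ S, (∀ k, FiniteDimensional ℂ (E k)) ∧
      (∀ k, ∀ f ∈ E k, oscillator D X ε f ∈ E k) ∧
      ∀ w : 𝓗, ∀ δ : ℝ, 0 < δ → ∃ k, ∃ e ∈ E k, ‖w - J e‖ < δ)
    (hu : ∀ f, u (stark D X β o (T m) f - z • f) = 0) : u = 0 := by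
  have hP := fun f => im_inner_stark_self h β o hm f
  set P := stark D X β o (T m) with hPdef
  obtain ⟨C, hC0, hC⟩ := norm_comm_pow_oscillator_stark_le h hT β o m (N + 1)
  obtain ⟨ε, hε, hε1, hεC⟩ : ∃ ε : ℝ, 0 < ε ∧ ε ≤ 1 ∧ C * ε < |z.im| := by
    have hz' : 0 < |z.im| := abs_pos.2 hz
    refine ⟨min 1 (|z.im| / (C + 1)), lt_min one_pos (by positivity), min_le_left _ _, ?_⟩
    calc C * min 1 (|z.im| / (C + 1)) ≤ C * (|z.im| / (C + 1)) := by gcongr; exact min_le_right _ _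
      _ = |z.im| * (C / (C + 1)) := by ring
      _ < |z.im| := mul_lt_of_lt_one_right hz' ((div_lt_one (by positivity)).2 (by linarith))
  obtain ⟨E, hEfin, hEinv, hEdense⟩ := hE ε hε
  obtain ⟨K, hK⟩ := hbound ε hε hε1
  set H := oscillator D X ε with hH
  have hHinj : ∀ j, Function.Injective (J ∘ₗ (H ^ j)) := by
    intro j
    rw [injective_iff_map_eq_zero]
    induction j with
    | zero => intro f hf; exact h.injective (by simpa using hf)
    | succ j ih =>
      intro f hf
      refine ih f (norm_le_zero_iff.1 ?_)
      have := norm_pow_oscillator_le_succ h hε j f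
      rw [LinearMap.comp_apply] at hf ⊢
      rwa [hf, norm_zero, mul_zero] at this
  have hEpow : ∀ k j, ∀ f ∈ E k, (H ^ j) f ∈ E k := by
    intro k j
    induction j with
    | zero => intro f hf; simpa using hf
    | succ j ih =>
      intro f hf
      rw [pow_succ, Module.End.mul_apply]
      exact ih _ (hEinv k f hf)
  obtain ⟨w, hw⟩ := exists_inner_representation (hHinj N) u hK
  obtain ⟨B, hB0, hB⟩ := norm_pow_oscillator_stark_le h hT β o m hε hε1 N
  ext ψ
  set R := ‖J ((H ^ (N + 1)) ψ)‖ / (|z.im| - C * ε) with hR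
  set Q := B * R + ‖z‖ * R + ‖J ((H ^ N) ψ)‖ with hQ
  have hR0 : 0 ≤ R := div_nonneg (norm_nonneg _) (by linarith)
  have hQ0 : 0 ≤ Q := by positivity
  have main : ∀ δ : ℝ, 0 < δ → ‖u ψ‖ ≤ δ * Q := by
    intro δ hδ
    obtain ⟨k, e, he, hwe⟩ := hEdense w δ hδ
    have := hEfin k
    obtain ⟨φ, hφE, hφ⟩ := exists_galerkin h.injective hP hz (E k) ψ
    have hφR : ‖J ((H ^ (N + 1)) φ)‖ ≤ R :=
      galerkin_bound h hP (fun f => by simpa [mul_assoc] using hC ε hε hε1 f) hεC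
        (hφ _ (hEpow k _ _ (hEpow k _ _ hφE)))
    have hφR' : ‖J ((H ^ N) φ)‖ ≤ R := ((norm_pow_oscillator_le_mono h hε hε1 N φ).trans
      (mul_le_of_le_one_left (norm_nonneg _) hε1)).trans hφR
    set r := P φ - z • φ - ψ with hr
    have hur : u r = -u ψ := by rw [hr, map_sub, hu, zero_sub]
    have hrE : inner ℂ (J e) (J ((H ^ N) r)) = 0 := by
      rw [← inner_oscillator_pow h, hr, map_sub, inner_sub_right, hφ _ (hEpow k _ _ he), sub_self]
    have hrQ : ‖J ((H ^ N) r)‖ ≤ Q := by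
      rw [hr]
      simp only [map_sub, map_smul]
      refine (norm_sub_le _ _).trans (add_le_add_left ((norm_sub_le _ _).trans
        (add_le_add ?_ ?_)) _)
      · exact (hB φ).trans (mul_le_mul_of_nonneg_left hφR hB0)
      · rw [norm_smul]
        gcongr
    have : u r = inner ℂ (w - J e) (J ((H ^ N) r)) := by
      rw [inner_sub_left, hrE, sub_zero, hw]
      rfl
    calc ‖u ψ‖ = ‖u r‖ := by rw [hur, norm_neg]
      _ ≤ ‖w - J e‖ * ‖J ((H ^ N) r)‖ := by rw [this]; exact norm_inner_le_norm _ _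
      _ ≤ δ * Q := by gcongr
  refine norm_le_zero_iff.1 (le_of_forall_pos_le_add fun η hη => ?_)
  have := main (η / (Q + 1)) (by positivity)
  refine this.trans ?_
  rw [zero_add, div_mul_eq_mul_div, div_le_iff₀ (by positivity)]
  nlinarith

end WeylSystem

namespace SchwartzMap

open MeasureTheory
open scoped SchwartzMap LineDeriv ContDiff

variable {ι : Type*} [Fintype ι]

/-- The embedding of Schwartz functions into `L²`. -/
noncomputable def toL2 :
    𝓢(EuclideanSpace ℝ ι, ℂ) →ₗ[ℂ] Lp ℂ 2 (volume : Measure (EuclideanSpace ℝ ι)) :=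
  (toLpCLM ℂ ℂ 2 volume).toLinearMap

/-- Multiplication by a function of temperate growth. -/
noncomputable def multiplier (W : EuclideanSpace ℝ ι → ℂ) :
    Module.End ℂ 𝓢(EuclideanSpace ℝ ι, ℂ) :=
  (smulLeftCLM ℂ W).toLinearMap

/-- Multiplication by the `i`-th coordinate. -/
noncomputable def coordMul (i : ι) : Module.End ℂ 𝓢(EuclideanSpace ℝ ι, ℂ) :=
  multiplier fun x => (x i : ℂ)

theorem hasTemperateGrowth_coord (i : ι) :
    (fun x : EuclideanSpace ℝ ι => (x i : ℂ)).HasTemperateGrowth :=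
  (Complex.ofRealCLM ∘L EuclideanSpace.proj (𝕜 := ℝ) i).hasTemperateGrowth

theorem multiplier_apply {W : EuclideanSpace ℝ ι → ℂ} (hW : W.HasTemperateGrowth)
    (f : 𝓢(EuclideanSpace ℝ ι, ℂ)) (x : EuclideanSpace ℝ ι) : multiplier W f x = W x * f x :=
  smulLeftCLM_apply_apply hW f x

theorem coordMul_apply (i : ι) (f : 𝓢(EuclideanSpace ℝ ι, ℂ)) (x : EuclideanSpace ℝ ι) :
    coordMul i f x = x i * f x :=
  multiplier_apply (hasTemperateGrowth_coord i) f x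

theorem inner_toL2 (f g : 𝓢(EuclideanSpace ℝ ι, ℂ)) :
    inner ℂ (toL2 f) (toL2 g) = ∫ x, inner ℂ (f x) (g x) :=
  inner_toL2_toL2_eq f g

theorem inner_multiplier {W : EuclideanSpace ℝ ι → ℝ}
    (hW : (fun x => (W x : ℂ)).HasTemperateGrowth) (f g : 𝓢(EuclideanSpace ℝ ι, ℂ)) :
    inner ℂ (toL2 (multiplier (fun x => (W x : ℂ)) f)) (toL2 g) =
      inner ℂ (toL2 f) (toL2 (multiplier (fun x => (W x : ℂ)) g)) := by
  rw [inner_toL2, inner_toL2]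
  congr 1 with x
  simp only [multiplier_apply hW, RCLike.inner_apply, map_mul, Complex.conj_ofReal]
  ring

variable [DecidableEq ι]

/-- The partial derivative in the `i`-th coordinate direction. -/
noncomputable def coordDeriv (i : ι) : Module.End ℂ 𝓢(EuclideanSpace ℝ ι, ℂ) :=
  (LineDeriv.lineDerivOpCLM ℂ 𝓢(EuclideanSpace ℝ ι, ℂ)
    (EuclideanSpace.single i (1 : ℝ))).toLinearMap

theorem coordDeriv_apply (i : ι) (f : 𝓢(EuclideanSpace ℝ ι, ℂ)) (x : EuclideanSpace ℝ ι) :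
    coordDeriv i f x = fderiv ℝ f x (EuclideanSpace.single i 1) :=
  rfl

theorem coordDeriv_multiplier {W : EuclideanSpace ℝ ι → ℂ} (hW : W.HasTemperateGrowth) (i : ι)
    {W' : EuclideanSpace ℝ ι → ℂ} (hW' : W'.HasTemperateGrowth)
    (h : ∀ x, fderiv ℝ W x (EuclideanSpace.single i 1) = W' x) (f : 𝓢(EuclideanSpace ℝ ι, ℂ)) :
    coordDeriv i (multiplier W f) = multiplier W (coordDeriv i f) + multiplier W' f := by
  ext x
  have h1 : (multiplier W f : EuclideanSpace ℝ ι → ℂ) = fun x => W x * f x :=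
    funext (multiplier_apply hW f)
  rw [coordDeriv_apply, h1, fderiv_fun_mul (hW.1.differentiable (by simp) x) f.differentiableAt]
  simp [multiplier_apply hW, multiplier_apply hW', coordDeriv_apply, h]
  ring

theorem coordDeriv_coordMul (i j : ι) (f : 𝓢(EuclideanSpace ℝ ι, ℂ)) :
    coordDeriv i (coordMul j f) = coordMul j (coordDeriv i f) + if i = j then f else 0 := by
  have h2 : (fun _ : EuclideanSpace ℝ ι => if i = j then (1 : ℂ) else 0).HasTemperateGrowth :=
    .const _
  rw [coordMul, coordDeriv_multiplier (hasTemperateGrowth_coord j) i h2]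
  · congr 1
    ext x
    rw [multiplier_apply h2]
    split_ifs <;> simp
  · intro x
    have h3 := (Complex.ofRealCLM ∘L EuclideanSpace.proj (𝕜 := ℝ) (ι := ι) j).hasFDerivAt (x := x)
    have h4 : fderiv ℝ (fun x : EuclideanSpace ℝ ι => (x j : ℂ)) x =
      Complex.ofRealCLM ∘L EuclideanSpace.proj (𝕜 := ℝ) j := h3.fderiv
    rw [h4]
    split_ifs with h <;> simp [h]

theorem inner_coordDeriv (i : ι) (f g : 𝓢(EuclideanSpace ℝ ι, ℂ)) :
    inner ℂ (toL2 (coordDeriv i f)) (toL2 g) = -inner ℂ (toL2 f) (toL2 (coordDeriv i g)) := by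
  rw [inner_toL2, inner_toL2]
  have h := integral_bilinear_lineDerivOp_right_eq_neg_left (μ := volume) f g
    (ContinuousLinearMap.mul ℝ ℂ ∘L (Complex.conjCLE : ℂ →L[ℝ] ℂ)) (EuclideanSpace.single i 1)
  simp only [ContinuousLinearMap.comp_apply, ContinuousLinearMap.mul_apply',
    ContinuousLinearEquiv.coe_coe, Complex.conjCLE_apply] at h
  simp only [RCLike.inner_apply']
  exact neg_eq_iff_eq_neg.1 h.symm

theorem coordDeriv_coordDeriv_apply (i j : ι) (f : 𝓢(EuclideanSpace ℝ ι, ℂ))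
    (x : EuclideanSpace ℝ ι) : coordDeriv i (coordDeriv j f) x =
      fderiv ℝ (fderiv ℝ f) x (EuclideanSpace.single i 1) (EuclideanSpace.single j 1) := by
  have h1 : (coordDeriv j f : EuclideanSpace ℝ ι → ℂ) =
    fun x => fderiv ℝ f x (EuclideanSpace.single j 1) := rfl
  rw [coordDeriv_apply, h1, fderiv_clm_apply _ (by fun_prop)]
  · simp
  · exact (f.smooth 2).fderiv_right (m := 1) (by norm_num) |>.differentiable (by simp) x

theorem coordDeriv_comm (i j : ι) (f : 𝓢(EuclideanSpace ℝ ι, ℂ)) :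
    coordDeriv i (coordDeriv j f) = coordDeriv j (coordDeriv i f) := by
  ext x
  rw [coordDeriv_coordDeriv_apply, coordDeriv_coordDeriv_apply]
  exact (f.contDiffAt 2).isSymmSndFDerivAt (by simp) _ _

theorem weylSystem : WeylSystem (toL2 (ι := ι)) coordDeriv coordMul where
  injective := injective_toLp 2 volume
  comm_D_X := coordDeriv_coordMul
  comm_D_D i j f := coordDeriv_comm i j f
  comm_X_X i j f := by
    ext x
    simp only [coordMul_apply]
    ring
  skew_D := inner_coordDeriv
  symm_X i f g := inner_multiplier (hasTemperateGrowth_coord i) f g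

end SchwartzMap

namespace SchwartzMap

open MeasureTheory
open scoped SchwartzMap LineDeriv ContDiff

variable {ι : Type*} [Fintype ι]

/-- Smooth functions all of whose derivatives are bounded. -/
def BoundedSymbol (ι : Type*) [Fintype ι] : Type _ :=
  {W : EuclideanSpace ℝ ι → ℂ // ContDiff ℝ ∞ W ∧ ∀ k : ℕ, ∃ C, ∀ x, ‖iteratedFDeriv ℝ k W x‖ ≤ C}

theorem BoundedSymbol.hasTemperateGrowth (W : BoundedSymbol ι) : W.1.HasTemperateGrowth :=
  ⟨W.2.1, fun k => ⟨0, by simpa using W.2.2 k⟩⟩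

/-- The directional derivative of a bounded symbol. -/
noncomputable def BoundedSymbol.deriv (v : EuclideanSpace ℝ ι) (W : BoundedSymbol ι) :
    BoundedSymbol ι := by
  refine ⟨fun x => fderiv ℝ W.1 x v, ?_, fun k => ?_⟩
  · exact (W.2.1.fderiv_right (by simp)).clm_apply contDiff_const
  · obtain ⟨C, hC⟩ := W.2.2 (k + 1)
    refine ⟨‖v‖ * C, fun x => (norm_iteratedFDeriv_clm_apply_const
      ((W.2.1.fderiv_right (m := ∞) (by simp)).contDiffAt) (by exact_mod_cast le_top)).trans ?_⟩
    rw [norm_iteratedFDeriv_fderiv]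
    gcongr
    exact hC x

theorem norm_toL2_le {f g : 𝓢(EuclideanSpace ℝ ι, ℂ)} {C : ℝ} (h : ∀ x, ‖f x‖ ≤ C * ‖g x‖) :
    ‖toL2 f‖ ≤ C * ‖toL2 g‖ := by
  refine Lp.norm_le_mul_norm_of_ae_le_mul ?_
  filter_upwards [coeFn_toLp f 2 volume, coeFn_toLp g 2 volume] with x hf hg
  change ‖(f.toLp 2 volume) x‖ ≤ C * ‖(g.toLp 2 volume) x‖
  rw [hf, hg]
  exact h x

theorem multiplierFamily [DecidableEq ι] : MultiplierFamily (toL2 (ι := ι)) coordDeriv coordMul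
    (fun W : BoundedSymbol ι => multiplier W.1)
    (fun i => BoundedSymbol.deriv (EuclideanSpace.single i 1)) where
  bounded W := by
    obtain ⟨C, hC⟩ := W.2.2 0
    refine ⟨C, fun f => norm_toL2_le fun x => ?_⟩
    rw [multiplier_apply W.hasTemperateGrowth, norm_mul]
    gcongr
    simpa using hC x
  comm_X W i f := by
    ext x
    simp only [coordMul_apply, multiplier_apply W.hasTemperateGrowth]
    ring
  comm_D W i f := coordDeriv_multiplier W.hasTemperateGrowth i
    (BoundedSymbol.hasTemperateGrowth _) (fun _ => rfl) f

end SchwartzMap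

namespace WeylSystem

variable {ι S 𝓗 : Type*} [AddCommGroup S] [Module ℂ S]
  [NormedAddCommGroup 𝓗] [InnerProductSpace ℂ 𝓗]
  {J : S →ₗ[ℂ] 𝓗} {D X : ι → Module.End ℂ S} [Fintype ι]

/-- The function `p` is controlled by a power, independent of `ε ∈ (0, 1]`, of the oscillator. -/
def OscillatorBounded (J : S →ₗ[ℂ] 𝓗) (D X : ι → Module.End ℂ S) (p : S → ℝ) : Prop :=
  ∃ N : ℕ, ∀ ε : ℝ, 0 < ε → ε ≤ 1 →
    ∃ C : ℝ, 0 ≤ C ∧ ∀ f, p f ≤ C * ‖J ((oscillator D X ε ^ N) f)‖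

theorem oscillatorBounded_norm : OscillatorBounded J D X (fun f => ‖J f‖) :=
  ⟨0, fun _ _ _ => ⟨1, zero_le_one, fun f => by simp⟩⟩

theorem OscillatorBounded.mono {p q : S → ℝ} (hp : OscillatorBounded J D X p) {K : ℝ}
    (hK : 0 ≤ K) (h : ∀ f, q f ≤ K * p f) : OscillatorBounded J D X q := by
  obtain ⟨N, hN⟩ := hp
  refine ⟨N, fun ε hε hε1 => ?_⟩
  obtain ⟨C, hC, hpC⟩ := hN ε hε hε1
  refine ⟨K * C, by positivity, fun f => (h f).trans ?_⟩
  rw [mul_assoc]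
  exact mul_le_mul_of_nonneg_left (hpC f) hK

variable [DecidableEq ι]

theorem norm_pow_oscillator_le_add (h : WeylSystem J D X) {ε : ℝ} (hε : 0 < ε) (hε1 : ε ≤ 1)
    (j k : ℕ) (f : S) :
    ‖J ((oscillator D X ε ^ j) f)‖ ≤ ‖J ((oscillator D X ε ^ (j + k)) f)‖ := by
  induction k with
  | zero => rfl
  | succ k ih =>
    exact ih.trans ((norm_pow_oscillator_le_mono h hε hε1 (j + k) f).trans
      (mul_le_of_le_one_left (norm_nonneg _) hε1))

theorem OscillatorBounded.add (h : WeylSystem J D X) {p q : S → ℝ}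
    (hp : OscillatorBounded J D X p) (hq : OscillatorBounded J D X q) :
    OscillatorBounded J D X (fun f => p f + q f) := by
  obtain ⟨N, hN⟩ := hp
  obtain ⟨M, hM⟩ := hq
  refine ⟨N + M, fun ε hε hε1 => ?_⟩
  obtain ⟨C, hC, hpC⟩ := hN ε hε hε1
  obtain ⟨C', hC', hqC⟩ := hM ε hε hε1
  refine ⟨C + C', by positivity, fun f => ?_⟩
  rw [add_mul]
  refine add_le_add ((hpC f).trans ?_) ((hqC f).trans ?_)
  · gcongr
    exact norm_pow_oscillator_le_add h hε hε1 N M f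
  · gcongr
    rw [add_comm]
    exact norm_pow_oscillator_le_add h hε hε1 M N f

theorem OscillatorBounded.sum (h : WeylSystem J D X) {κ : Type*} (s : Finset κ) {p : κ → S → ℝ}
    (hp : ∀ i ∈ s, OscillatorBounded J D X (p i)) :
    OscillatorBounded J D X (fun f => ∑ i ∈ s, p i f) := by
  classical
  induction s using Finset.induction_on with
  | empty => exact ⟨0, fun _ _ _ => ⟨0, le_rfl, fun f => by simp⟩⟩
  | insert a s ha ih =>
    simp only [Finset.sum_insert ha]
    exact .add h (hp a (Finset.mem_insert_self a s))
      (ih fun i hi => hp i (Finset.mem_insert_of_mem hi))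

theorem OscillatorBounded.comp_D (h : WeylSystem J D X) {p : S → ℝ}
    (hp : OscillatorBounded J D X p) (i : ι) : OscillatorBounded J D X (fun f => p (D i f)) := by
  obtain ⟨N, hN⟩ := hp
  refine ⟨N + 1, fun ε hε hε1 => ?_⟩
  obtain ⟨C, hC, hpC⟩ := hN ε hε hε1
  refine ⟨C * (3 ^ N * ε), by positivity, fun f => (hpC _).trans ?_⟩
  have := norm_pow_oscillator_letter_le h hε hε1 N false i f
  simp only [letter, Bool.false_eq_true, if_false] at this
  rw [mul_assoc, mul_assoc]
  gcongr

theorem OscillatorBounded.comp_X (h : WeylSystem J D X) {p : S → ℝ}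
    (hp : OscillatorBounded J D X p) (i : ι) : OscillatorBounded J D X (fun f => p (X i f)) := by
  obtain ⟨N, hN⟩ := hp
  refine ⟨N + 1, fun ε hε hε1 => ?_⟩
  obtain ⟨C, hC, hpC⟩ := hN ε hε hε1
  refine ⟨C * 3 ^ N, by positivity, fun f => (hpC _).trans ?_⟩
  have := norm_pow_oscillator_letter_le h hε hε1 N true i f
  simp only [letter, if_true, LinearMap.smul_apply, map_smul, norm_smul, Complex.norm_real,
    Real.norm_of_nonneg hε.le] at this
  rw [mul_assoc]
  gcongr
  refine le_of_mul_le_mul_left (this.trans_eq ?_) hε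
  ring

end WeylSystem

namespace SchwartzMap

open MeasureTheory
open scoped SchwartzMap LineDeriv ContDiff FourierTransform

variable {ι : Type*} [Fintype ι]

theorem norm_toL2 (f : 𝓢(EuclideanSpace ℝ ι, ℂ)) :
    ‖toL2 f‖ = (∫ x, ‖f x‖ ^ (2 : ℝ)) ^ (1 / 2 : ℝ) := by
  have := norm_toLp' (f := f) (p := 2) (μ := volume) (by norm_num) (by norm_num)
  rw [show toL2 f = f.toLp 2 volume from rfl, this]
  simp

theorem norm_toL2_fourierInv (f : 𝓢(EuclideanSpace ℝ ι, ℂ)) : ‖toL2 (𝓕⁻ f)‖ = ‖toL2 f‖ := by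
  rw [norm_toL2, norm_toL2]
  have := integral_norm_sq_fourier (𝓕⁻ f)
  rw [FourierTransform.fourier_fourierInv_eq] at this
  simp only [Real.rpow_two, this]

theorem coordMul_fourierInv [DecidableEq ι] (i : ι) (f : 𝓢(EuclideanSpace ℝ ι, ℂ)) :
    coordMul i (𝓕⁻ f) = (-(2 * Real.pi * Complex.I))⁻¹ • 𝓕⁻ (coordDeriv i f) := by
  have h := fourierInv_lineDerivOp_eq f (EuclideanSpace.single i (1 : ℝ))
  have h' : 𝓕⁻ (coordDeriv i f) = _ := h
  rw [h']
  have h2 : -(2 * Real.pi * Complex.I) ≠ 0 := by simp [Real.pi_ne_zero]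
  rw [smul_smul, inv_mul_cancel₀ h2, one_smul]
  ext x
  have h3 : (fun x : EuclideanSpace ℝ ι =>
      inner ℝ x (EuclideanSpace.single i 1)).HasTemperateGrowth := by
    fun_prop
  rw [coordMul_apply, smulLeftCLM_apply_apply h3]
  simp [EuclideanSpace.inner_single_right]

/-- Multiplication by `1 + ‖x‖²`. -/
noncomputable def japaneseMul : Module.End ℂ 𝓢(EuclideanSpace ℝ ι, ℂ) :=
  1 + ∑ i, coordMul i * coordMul i

theorem japaneseMul_pow_apply (m : ℕ) (f : 𝓢(EuclideanSpace ℝ ι, ℂ)) (x : EuclideanSpace ℝ ι) :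
    (japaneseMul ^ m) f x = (1 + ‖x‖ ^ 2 : ℝ) ^ m * f x := by
  induction m generalizing f with
  | zero => simp
  | succ m ih =>
    have h1 : japaneseMul f x = (1 + ‖x‖ ^ 2 : ℝ) * f x := by
      simp [japaneseMul, coordMul_apply, EuclideanSpace.real_norm_sq_eq, add_mul, Finset.sum_mul]
      exact Finset.sum_congr rfl fun i _ => by ring
    rw [pow_succ, Module.End.mul_apply, ih, h1]
    ring

theorem exists_norm_apply_le_japaneseMul : ∃ (m : ℕ) (K : ℝ), 0 ≤ K ∧
    ∀ (f : 𝓢(EuclideanSpace ℝ ι, ℂ)) x, ‖f x‖ ≤ K * ‖toL2 ((japaneseMul ^ m) (𝓕⁻ f))‖ := by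
  set m := Module.finrank ℝ (EuclideanSpace ℝ ι) + 1 with hm
  have hk : MemLp (fun x : EuclideanSpace ℝ ι => ((1 + ‖x‖ ^ 2) ^ m)⁻¹) (ENNReal.ofReal 2) := by
    have hc : Continuous fun x : EuclideanSpace ℝ ι => ((1 + ‖x‖ ^ 2) ^ m)⁻¹ :=
      Continuous.inv₀ (by fun_prop) fun x => by positivity
    rw [ENNReal.ofReal_ofNat]
    refine (memLp_two_iff_integrable_sq hc.aestronglyMeasurable).2 ?_
    have h : (Module.finrank ℝ (EuclideanSpace ℝ ι) : ℝ) < 4 * m := by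
      rw [hm]
      push_cast
      nlinarith [(Module.finrank ℝ (EuclideanSpace ℝ ι)).cast_nonneg (α := ℝ)]
    refine (integrable_rpow_neg_one_add_norm_sq (μ := volume) h).congr (.of_forall fun x => ?_)
    beta_reduce
    rw [show -(4 * (m : ℝ)) / 2 = -((m * 2 : ℕ) : ℝ) by push_cast; ring,
      Real.rpow_neg (by positivity), Real.rpow_natCast, pow_mul, inv_pow]
  refine ⟨m, (∫ x : EuclideanSpace ℝ ι, ‖((1 + ‖x‖ ^ 2) ^ m)⁻¹‖ ^ (2 : ℝ)) ^ (1 / 2 : ℝ),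
    by positivity, fun f x => ?_⟩
  have h1 := norm_fourier_apply_le_toLp_one (𝓕⁻ f) x
  rw [FourierTransform.fourier_fourierInv_eq, norm_toLp_one] at h1
  have h2 := integral_mul_norm_le_Lp_mul_Lq (p := 2) (q := 2) Real.HolderConjugate.two_two hk
    (((japaneseMul ^ m) (𝓕⁻ f)).memLp (ENNReal.ofReal 2) volume).norm
  rw [norm_toL2]
  refine (h1.trans_eq ?_).trans (h2.trans_eq ?_)
  · congr 1 with y
    rw [japaneseMul_pow_apply]
    rw [norm_norm, norm_mul, norm_pow, Complex.norm_real, norm_inv, norm_pow,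
      inv_mul_cancel_left₀]
    have : (0 : ℝ) < 1 + ‖y‖ ^ 2 := by positivity
    exact pow_ne_zero _ (norm_ne_zero_iff.2 this.ne')
  · simp

theorem seminorm_succ_zero_le (k : ℕ) (f : 𝓢(EuclideanSpace ℝ ι, ℂ)) :
    SchwartzMap.seminorm ℂ (k + 1) 0 f ≤ ∑ i, SchwartzMap.seminorm ℂ k 0 (coordMul i f) := by
  refine seminorm_le_bound ℂ _ _ f (Finset.sum_nonneg fun i _ => apply_nonneg _ _) fun x => ?_
  have h1 : ‖x‖ ≤ ∑ i, ‖x i‖ := by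
    refine abs_le_of_sq_le_sq' ?_ (by positivity) |>.2
    rw [EuclideanSpace.norm_sq_eq]
    exact Finset.sum_sq_le_sq_sum_of_nonneg fun i _ => norm_nonneg _
  rw [norm_iteratedFDeriv_zero, pow_succ, mul_assoc]
  calc ‖x‖ ^ k * (‖x‖ * ‖f x‖) ≤ ‖x‖ ^ k * ((∑ i, ‖x i‖) * ‖f x‖) := by gcongr
    _ = ∑ i, ‖x‖ ^ k * ‖coordMul i f x‖ := by
      simp [Finset.sum_mul, Finset.mul_sum, coordMul_apply]
    _ ≤ _ := Finset.sum_le_sum fun i _ => norm_pow_mul_le_seminorm ℂ _ k x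

variable [DecidableEq ι]

open WeylSystem

theorem oscillatorBounded_comp_japaneseMul_fourierInv (m : ℕ) :
    OscillatorBounded (toL2 (ι := ι)) coordDeriv coordMul
      (fun f => ‖toL2 ((japaneseMul ^ m) (𝓕⁻ f))‖) := by
  set c : ℂ := (-(2 * Real.pi * Complex.I))⁻¹ with hc
  let L : Module.End ℂ 𝓢(EuclideanSpace ℝ ι, ℂ) :=
    1 + (c * c) • ∑ i, coordDeriv i * coordDeriv i
  have hL : ∀ f, japaneseMul (𝓕⁻ f) = 𝓕⁻ (L f) := fun f => by
    simp [japaneseMul, L, coordMul_fourierInv, FourierTransform.fourierInv_add,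
      FourierTransform.fourierInv_smul, Finset.smul_sum, smul_smul, hc]
  have hLm : ∀ f, (japaneseMul ^ m) (𝓕⁻ f) = 𝓕⁻ ((L ^ m) f) := by
    induction m with
    | zero => simp
    | succ m ih => exact fun f => by simp [pow_succ, hL, ih]
  simp only [hLm, norm_toL2_fourierInv]
  suffices ∀ p : Seminorm ℂ 𝓢(EuclideanSpace ℝ ι, ℂ),
      OscillatorBounded (toL2 (ι := ι)) coordDeriv coordMul p →
      OscillatorBounded (toL2 (ι := ι)) coordDeriv coordMul (fun f => p ((L ^ m) f)) from
    this ((normSeminorm ℂ _).comp toL2) oscillatorBounded_norm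
  clear hLm
  induction m with
  | zero => exact fun p hp => by simpa using hp
  | succ m ih =>
    intro p hp
    simp only [pow_succ', Module.End.mul_apply]
    refine ih (p.comp L) (.mono (.add weylSystem hp (.sum weylSystem Finset.univ fun i _ =>
      (hp.comp_D weylSystem i).comp_D weylSystem i)) (K := 1 + ‖c * c‖) (by positivity) fun f => ?_)
    have h1 : p.comp L f ≤ p f + ‖c * c‖ * ∑ i, p (coordDeriv i (coordDeriv i f)) := by
      simp only [Seminorm.comp_apply, L, LinearMap.add_apply, Module.End.one_apply,
        LinearMap.smul_apply, LinearMap.sum_apply, Module.End.mul_apply]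
      refine (map_add_le_add p _ _).trans (add_le_add_right ?_ _)
      rw [map_smul_eq_mul]
      gcongr
      exact Finset.le_sum_of_subadditive p (map_zero p).le (map_add_le_add p) _ _
    have h2 : 0 ≤ ∑ i, p (coordDeriv i (coordDeriv i f)) :=
      Finset.sum_nonneg fun i _ => apply_nonneg p _
    have h3 := apply_nonneg p f
    nlinarith [norm_nonneg (c * c)]

theorem exists_seminorm_succ_le (k l : ℕ) : ∃ C : ℝ, 0 ≤ C ∧ ∀ f : 𝓢(EuclideanSpace ℝ ι, ℂ),
    SchwartzMap.seminorm ℂ k (l + 1) f ≤ C * ∑ i, SchwartzMap.seminorm ℂ k l (coordDeriv i f) := by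
  let A : ι → ℂ →L[ℝ] EuclideanSpace ℝ ι →L[ℝ] ℂ := fun i =>
    ContinuousLinearMap.smulRightL ℝ (EuclideanSpace ℝ ι) ℂ (EuclideanSpace.proj i)
  have hA : ∀ f : 𝓢(EuclideanSpace ℝ ι, ℂ), fderiv ℝ f = fun x => ∑ i, A i (coordDeriv i f x) := by
    intro f
    ext x v
    have hv : v = ∑ i, v i • EuclideanSpace.single i (1 : ℝ) := by
      ext j
      simp [Pi.single_apply]
    conv_lhs => rw [hv]
    simp [A, coordDeriv_apply]
  refine ⟨∑ i, ‖A i‖, by positivity, fun f => seminorm_le_bound ℂ _ _ f (by positivity) fun x => ?_⟩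
  have h1 : ‖iteratedFDeriv ℝ (l + 1) f x‖ ≤
      ∑ i, ‖A i‖ * ‖iteratedFDeriv ℝ l (coordDeriv i f) x‖ := by
    rw [← norm_iteratedFDeriv_fderiv, hA]
    rw [iteratedFDeriv_fun_sum_apply]
    · refine (norm_sum_le _ _).trans (Finset.sum_le_sum fun i _ => ?_)
      exact (A i).norm_iteratedFDeriv_comp_left ((coordDeriv i f).contDiffAt l) le_rfl
    · intro i _
      exact (A i).contDiff.contDiffAt.comp x ((coordDeriv i f).contDiffAt l)
  calc ‖x‖ ^ k * ‖iteratedFDeriv ℝ (l + 1) f x‖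
      ≤ ‖x‖ ^ k * ∑ i, ‖A i‖ * ‖iteratedFDeriv ℝ l (coordDeriv i f) x‖ := by gcongr
    _ = ∑ i, ‖A i‖ * (‖x‖ ^ k * ‖iteratedFDeriv ℝ l (coordDeriv i f) x‖) := by
      rw [Finset.mul_sum]
      exact Finset.sum_congr rfl fun i _ => by ring
    _ ≤ ∑ i, ‖A i‖ * ∑ j, SchwartzMap.seminorm ℂ k l (coordDeriv j f) := by
      gcongr with i
      exact (le_seminorm ℂ k l _ x).trans (Finset.single_le_sum
        (f := fun j => SchwartzMap.seminorm ℂ k l (coordDeriv j f))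
        (fun j _ => apply_nonneg _ _) (Finset.mem_univ i))
    _ = _ := by rw [Finset.sum_mul]

theorem oscillatorBounded_seminorm (k l : ℕ) :
    OscillatorBounded (toL2 (ι := ι)) coordDeriv coordMul (SchwartzMap.seminorm ℂ k l) := by
  induction l with
  | zero =>
    induction k with
    | zero =>
      obtain ⟨m, K, hK, h⟩ := exists_norm_apply_le_japaneseMul (ι := ι)
      refine (oscillatorBounded_comp_japaneseMul_fourierInv m).mono hK fun f => ?_
      exact seminorm_le_bound ℂ _ _ f (by positivity) fun x => by simpa using h f x
    | succ k ih =>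
      refine (OscillatorBounded.sum weylSystem Finset.univ fun i _ =>
        ih.comp_X weylSystem i).mono zero_le_one fun f => ?_
      simpa using seminorm_succ_zero_le k f
  | succ l ih =>
    obtain ⟨C, hC, h⟩ := exists_seminorm_succ_le (ι := ι) k l
    exact (OscillatorBounded.sum weylSystem Finset.univ fun i _ =>
        ih.comp_D weylSystem i).mono hC h

theorem oscillatorBounded_functional (u : 𝓢(EuclideanSpace ℝ ι, ℂ) →L[ℂ] ℂ) :
    OscillatorBounded (toL2 (ι := ι)) coordDeriv coordMul (fun f => ‖u f‖) := by
  obtain ⟨s, C, -, h⟩ := Seminorm.bound_of_continuous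
    (schwartz_withSeminorms ℂ (EuclideanSpace ℝ ι) ℂ)
    ((normSeminorm ℂ ℂ).comp u.toLinearMap) u.continuous.norm
  refine (OscillatorBounded.sum weylSystem s fun q _ =>
    oscillatorBounded_seminorm q.1 q.2).mono C.2 fun f => ?_
  refine (h f).trans ?_
  refine mul_le_mul_of_nonneg_left (Seminorm.finset_sup_apply_le
    (Finset.sum_nonneg fun q _ => apply_nonneg _ f) fun q hq => ?_) C.2
  exact Finset.single_le_sum (f := fun q : ℕ × ℕ => SchwartzMap.seminorm ℂ q.1 q.2 f)
    (fun q _ => apply_nonneg _ f) hq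

end SchwartzMap

namespace WeylSystem

variable {ι S 𝓗 : Type*} [AddCommGroup S] [Module ℂ S]
  [NormedAddCommGroup 𝓗] [InnerProductSpace ℂ 𝓗]
  {J : S →ₗ[ℂ] 𝓗} {D X : ι → Module.End ℂ S}

/-- The span of all vectors obtained from `g` by applying at most `k` operators `X i`. -/
def polySpace (X : ι → Module.End ℂ S) (g : S) : ℕ → Submodule ℂ S
  | 0 => Submodule.span ℂ {g}
  | k + 1 => polySpace X g k ⊔ ⨆ i, (polySpace X g k).map (X i)

theorem polySpace_mono (X : ι → Module.End ℂ S) (g : S) : Monotone (polySpace X g) :=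
  monotone_nat_of_le_succ fun _ => le_sup_left

theorem apply_mem_polySpace (g : S) {k : ℕ} {f : S} (hf : f ∈ polySpace X g k) (i : ι) :
    X i f ∈ polySpace X g (k + 1) :=
  le_sup_right (a := polySpace X g k)
    (Submodule.mem_iSup_of_mem i (Submodule.mem_map_of_mem hf))

theorem polySpace_induction {g : S} {k : ℕ} {p : S → Prop} (h0 : ∀ f ∈ polySpace X g k, p f)
    (hX : ∀ f ∈ polySpace X g k, ∀ i, p (X i f)) (hadd : ∀ f f', p f → p f' → p (f + f'))
    {f : S} (hf : f ∈ polySpace X g (k + 1)) : p f := by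
  obtain ⟨y, hy, z, hz, rfl⟩ := Submodule.mem_sup.1 hf
  refine hadd _ _ (h0 y hy) ?_
  refine Submodule.iSup_induction _ (motive := p) hz ?_ (h0 0 (zero_mem _)) hadd
  rintro i _ ⟨x, hx, rfl⟩
  exact hX x hx i

theorem annihilation_mem_polySpace [DecidableEq ι] (h : WeylSystem J D X) {ε : ℝ} {g : S}
    (hg : ∀ i, D i g + (ε : ℂ) • X i g = 0) (k : ℕ) (i : ι) {f : S} (hf : f ∈ polySpace X g k) :
    D i f + (ε : ℂ) • X i f ∈ polySpace X g k ∧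
      ∀ j, X j (D i f + (ε : ℂ) • X i f) ∈ polySpace X g k := by
  induction k generalizing f with
  | zero =>
    obtain ⟨c, rfl⟩ := Submodule.mem_span_singleton.1 hf
    have : D i (c • g) + (ε : ℂ) • X i (c • g) = 0 := by
      rw [map_smul, map_smul, smul_comm, ← smul_add, hg, smul_zero]
    rw [this]
    exact ⟨zero_mem _, fun j => by rw [map_zero]; exact zero_mem _⟩
  | succ k ih =>
    refine polySpace_induction (p := fun f => D i f + (ε : ℂ) • X i f ∈ polySpace X g (k + 1) ∧
      ∀ j, X j (D i f + (ε : ℂ) • X i f) ∈ polySpace X g (k + 1)) (fun f hf => ?_)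
      (fun f hf l => ?_) (fun f f' hf hf' => ?_) hf
    · exact ⟨polySpace_mono X g k.le_succ (ih hf).1,
        fun j => polySpace_mono X g k.le_succ ((ih hf).2 j)⟩
    · have h1 : D i (X l f) + (ε : ℂ) • X i (X l f) =
          X l (D i f + (ε : ℂ) • X i f) + if i = l then f else 0 := by
        rw [h.comm_D_X, h.comm_X_X i l, map_add, map_smul]
        abel
      have h2 : X l (D i f + (ε : ℂ) • X i f) + (if i = l then f else 0) ∈ polySpace X g k := by
        refine add_mem ((ih hf).2 l) ?_
        split_ifs
        exacts [hf, zero_mem _]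
      rw [h1]
      exact ⟨polySpace_mono X g k.le_succ h2, apply_mem_polySpace g h2⟩
    · have h1 : D i (f + f') + (ε : ℂ) • X i (f + f') =
          D i f + (ε : ℂ) • X i f + (D i f' + (ε : ℂ) • X i f') := by
        rw [map_add, map_add, smul_add]
        abel
      rw [h1]
      refine ⟨add_mem hf.1 hf'.1, fun j => ?_⟩
      rw [map_add]
      exact add_mem (hf.2 j) (hf'.2 j)

variable [Fintype ι]

instance finiteDimensional_polySpace (g : S) (k : ℕ) : FiniteDimensional ℂ (polySpace X g k) := by
  induction k with
  | zero => exact inferInstanceAs (FiniteDimensional ℂ (Submodule.span ℂ {g}))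
  | succ k ih =>
    exact inferInstanceAs
      (FiniteDimensional ℂ ↥(polySpace X g k ⊔ ⨆ i, (polySpace X g k).map (X i)))

theorem pow_sum_mem_polySpace (g : S) (c : ι → ℂ) (k : ℕ) :
    ((∑ i, c i • X i) ^ k) g ∈ polySpace X g k := by
  induction k with
  | zero => exact Submodule.mem_span_singleton_self g
  | succ k ih =>
    rw [pow_succ', Module.End.mul_apply, LinearMap.sum_apply]
    exact Submodule.sum_mem _ fun i _ => Submodule.smul_mem _ _ (apply_mem_polySpace g ih i)

theorem oscillator_mem_polySpace [DecidableEq ι] (h : WeylSystem J D X) {ε : ℝ} {g : S}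
    (hg : ∀ i, D i g + (ε : ℂ) • X i g = 0) (k : ℕ) {f : S} (hf : f ∈ polySpace X g k) :
    oscillator D X ε f ∈ polySpace X g k := by
  rw [oscillator_apply]
  refine add_mem (Submodule.sum_mem _ fun i _ => ?_) (Submodule.smul_mem _ _ hf)
  have h1 := annihilation_mem_polySpace h hg k i hf
  have h2 := annihilation_mem_polySpace h hg k i h1.1
  have key : letter D X ε true i (letter D X ε true i f) -
      letter D X ε false i (letter D X ε false i f) =
      (2 * ε : ℂ) • X i (D i f + (ε : ℂ) • X i f) -
      (D i (D i f + (ε : ℂ) • X i f) + (ε : ℂ) • X i (D i f + (ε : ℂ) • X i f)) + (ε : ℂ) • f := by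
    simp only [letter, if_true, Bool.false_eq_true, if_false, LinearMap.smul_apply, map_smul,
      map_add, h.comm_D_X]
    module
  rw [key]
  exact add_mem (sub_mem (Submodule.smul_mem _ _ (h1.2 i)) h2.1) (Submodule.smul_mem _ _ hf)

end WeylSystem

namespace SchwartzMap

open MeasureTheory
open scoped SchwartzMap LineDeriv ContDiff FourierTransform Nat

theorem one_add_pow_mul_exp_le {ε : ℝ} (hε : 0 < ε) (m : ℕ) {t : ℝ} (ht : 0 ≤ t) :
    (1 + t) ^ m * Real.exp (-(ε / 2 * t ^ 2)) ≤ m ! * Real.exp (1 + 1 / (2 * ε)) := by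
  have h1 := Real.pow_div_factorial_le_exp (1 + t) (by positivity) m
  rw [div_le_iff₀ (by positivity)] at h1
  calc _ ≤ Real.exp (1 + t) * m ! * Real.exp (-(ε / 2 * t ^ 2)) := by gcongr
    _ = m ! * Real.exp (1 + t - ε / 2 * t ^ 2) := by
      rw [sub_eq_add_neg, Real.exp_add (1 + t)]
      ring
    _ ≤ _ := by
      gcongr
      have : 1 + 1 / (2 * ε) - (1 + t - ε / 2 * t ^ 2) = (ε * t - 1) ^ 2 / (2 * ε) := by
        field_simp
        ring
      have : 0 ≤ (ε * t - 1) ^ 2 / (2 * ε) := by positivity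
      linarith

variable {V : Type*} [NormedAddCommGroup V] [InnerProductSpace ℝ V]

/-- The real-valued Gaussian `exp (-ε ‖x‖² / 2)` as a Schwartz function. -/
noncomputable def realGaussian (V : Type*) [NormedAddCommGroup V] [InnerProductSpace ℝ V] {ε : ℝ}
    (hε : 0 < ε) : 𝓢(V, ℝ) where
  toFun x := Real.exp (-(ε / 2 * ‖x‖ ^ 2))
  smooth' := by
    have : ContDiff ℝ ∞ fun x : V => ‖x‖ ^ 2 := contDiff_norm_sq ℝ
    fun_prop
  decay' k n := by
    have hf : (fun x : V => -(ε / 2 * ‖x‖ ^ 2)).HasTemperateGrowth := by fun_prop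
    obtain ⟨l, C, hC, h⟩ := hf.norm_iteratedFDeriv_le_uniform n
    refine ⟨n ! * (1 + C) ^ n * ((k + l * n)! * Real.exp (1 + 1 / (2 * ε))), fun x => ?_⟩
    have h1 : ∀ i ≤ n, ‖iteratedFDeriv ℝ i Real.exp (-(ε / 2 * ‖x‖ ^ 2))‖ ≤
        Real.exp (-(ε / 2 * ‖x‖ ^ 2)) := fun i _ => by
      rw [norm_iteratedFDeriv_eq_norm_iteratedDeriv, iteratedDeriv_eq_iterate, Real.iter_deriv_exp,
        Real.norm_of_nonneg (Real.exp_pos _).le]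
    have h2 : ∀ i, 1 ≤ i → i ≤ n → ‖iteratedFDeriv ℝ i (fun x : V => -(ε / 2 * ‖x‖ ^ 2)) x‖ ≤
        ((1 + C) * (1 + ‖x‖) ^ l) ^ i := fun i hi hin => by
      have h3 : (1 : ℝ) ≤ (1 + ‖x‖) ^ l := one_le_pow₀ (by linarith [norm_nonneg x])
      have h4 : (1 : ℝ) ≤ (1 + C) * (1 + ‖x‖) ^ l := by nlinarith
      refine (h i hin x).trans (le_trans ?_ (le_self_pow₀ h4 (by omega)))
      gcongr
      linarith
    have h5 := norm_iteratedFDeriv_comp_le (N := ∞) Real.contDiff_exp hf.1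
      (by exact_mod_cast le_top) x h1 h2
    calc ‖x‖ ^ k * ‖iteratedFDeriv ℝ n (Real.exp ∘ fun x : V => -(ε / 2 * ‖x‖ ^ 2)) x‖
        ≤ (1 + ‖x‖) ^ k * (n ! * Real.exp (-(ε / 2 * ‖x‖ ^ 2)) *
          ((1 + C) * (1 + ‖x‖) ^ l) ^ n) := by
          gcongr
          linarith
      _ = n ! * (1 + C) ^ n * ((1 + ‖x‖) ^ (k + l * n) * Real.exp (-(ε / 2 * ‖x‖ ^ 2))) := by
          rw [mul_pow, ← pow_mul, pow_add]
          ring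
      _ ≤ _ := by
          exact mul_le_mul_of_nonneg_left (one_add_pow_mul_exp_le hε _ (norm_nonneg x))
            (by positivity)

/-- The complex-valued Gaussian `exp (-ε ‖x‖² / 2)` as a Schwartz function. -/
noncomputable def gaussian (V : Type*) [NormedAddCommGroup V] [InnerProductSpace ℝ V] {ε : ℝ}
    (hε : 0 < ε) : 𝓢(V, ℂ) :=
  (realGaussian V hε).postcompCLM Complex.ofRealCLM

theorem gaussian_apply {ε : ℝ} (hε : 0 < ε) (x : V) :
    gaussian V hε x = (Real.exp (-(ε / 2 * ‖x‖ ^ 2)) : ℝ) :=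
  rfl

variable {ι : Type*} [Fintype ι]

theorem coordDeriv_gaussian [DecidableEq ι] {ε : ℝ} (hε : 0 < ε) (i : ι) :
    coordDeriv i (gaussian (EuclideanSpace ℝ ι) hε) +
      (ε : ℂ) • coordMul i (gaussian (EuclideanSpace ℝ ι) hε) = 0 := by
  ext x
  have h1 : HasFDerivAt (fun x : EuclideanSpace ℝ ι => ‖x‖ ^ 2) (2 • innerSL ℝ x) x :=
    (hasStrictFDerivAt_norm_sq x).hasFDerivAt
  have h2 : HasFDerivAt (gaussian (EuclideanSpace ℝ ι) hε) _ x :=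
    Complex.ofRealCLM.hasFDerivAt.comp x (h1.const_mul (ε / 2)).neg.exp
  simp only [add_apply, smul_apply, coordDeriv_apply, coordMul_apply, h2.fderiv]
  simp [gaussian_apply, EuclideanSpace.inner_single_right]
  ring

end SchwartzMap

namespace SchwartzMap

open MeasureTheory
open scoped SchwartzMap ContDiff FourierTransform Nat RealInnerProductSpace

section Fourier

variable {V : Type*} [NormedAddCommGroup V] [InnerProductSpace ℝ V] [FiniteDimensional ℝ V]
  [MeasurableSpace V] [BorelSpace V]

theorem ae_eq_zero_of_fourier_eq_zero {h : V → ℂ} (hh : Integrable h) (hF : 𝓕 h = 0) :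
    ∀ᵐ x, h x = 0 := by
  refine ae_eq_zero_of_integral_contDiff_smul_eq_zero hh.locallyIntegrable fun g hg hgc => ?_
  have hgc' : HasCompactSupport fun x => (g x : ℂ) := hgc.comp_left Complex.ofReal_zero
  let χ : 𝓢(V, ℂ) := hgc'.toSchwartzMap (Complex.ofRealCLM.contDiff.comp hg)
  have h1 : ∫ x, 𝓕 ((𝓕⁻ χ : 𝓢(V, ℂ)) : V → ℂ) x • h x =
      ∫ x, ((𝓕⁻ χ : 𝓢(V, ℂ)) : V → ℂ) x • 𝓕 h x := by
    simpa using! VectorFourier.integral_fourierIntegral_smul_eq_flip (L := innerₗ V)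
      Real.continuous_fourierChar continuous_inner (𝓕⁻ χ : 𝓢(V, ℂ)).integrable hh
  have h2 : 𝓕 ((𝓕⁻ χ : 𝓢(V, ℂ)) : V → ℂ) = χ := by
    rw [← fourier_coe, FourierTransform.fourier_fourierInv_eq]
  rw [h2, hF] at h1
  have h3 : ∀ x, χ x = g x := fun _ => rfl
  simpa [h3] using h1

theorem fourier_eq_zero_of_moments {h : V → ℂ} (hh : AEStronglyMeasurable h)
    (hexp : ∀ c : ℝ, Integrable fun x => Real.exp (c * ‖x‖) * ‖h x‖)
    (hmom : ∀ (ξ : V) (j : ℕ), ∫ x, (⟪x, ξ⟫ : ℂ) ^ j * h x = 0) : 𝓕 h = 0 := by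
  ext ξ
  have h1 := hasSum_integral_of_dominated_convergence (μ := volume)
    (F := fun (j : ℕ) x => ((-2 * Real.pi * ⟪x, ξ⟫ : ℝ) * Complex.I) ^ j / j ! * h x)
    (f := fun x => Complex.exp ((-2 * Real.pi * ⟪x, ξ⟫ : ℝ) * Complex.I) * h x)
    (fun j x => (2 * Real.pi * ‖ξ‖ * ‖x‖) ^ j / j ! * ‖h x‖) (fun j => ?_) (fun j => ?_) ?_ ?_ ?_
  · have h2 : ∀ j : ℕ, ∫ x, ((-2 * Real.pi * ⟪x, ξ⟫ : ℝ) * Complex.I) ^ j / j ! * h x = 0 := by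
      intro j
      have : ∀ x, ((-2 * Real.pi * ⟪x, ξ⟫ : ℝ) * Complex.I) ^ j / j ! * h x =
          (-2 * Real.pi * Complex.I) ^ j / j ! * ((⟪x, ξ⟫ : ℂ) ^ j * h x) := by
        intro x
        push_cast
        ring
      simp_rw [this]
      rw [integral_const_mul, hmom, mul_zero]
    simp_rw [h2] at h1
    rw [Real.fourier_eq']
    simpa using h1.unique hasSum_zero
  · exact (Continuous.aestronglyMeasurable (by fun_prop)).mul hh
  · filter_upwards with x
    rw [norm_mul, norm_div, norm_pow, norm_mul, Complex.norm_I, mul_one, Complex.norm_real,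
      Complex.norm_natCast]
    gcongr
    rw [norm_mul, norm_mul, mul_assoc (2 * Real.pi), mul_comm ‖ξ‖]
    gcongr
    · simp
    · exact (Real.norm_of_nonneg Real.pi_pos.le).le
    · exact norm_inner_le_norm (𝕜 := ℝ) x ξ
  · filter_upwards with x
    exact (Real.summable_pow_div_factorial _).mul_right _
  · refine (hexp (2 * Real.pi * ‖ξ‖)).congr (ae_of_all _ fun x => ?_)
    simp only [tsum_mul_right, Real.exp_eq_exp_ℝ, NormedSpace.exp_eq_tsum_div]
  · filter_upwards with x
    have h2 := NormedSpace.expSeries_div_hasSum_exp (𝔸 := ℂ)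
      ((-2 * Real.pi * ⟪x, ξ⟫ : ℝ) * Complex.I)
    rw [← Complex.exp_eq_exp_ℂ] at h2
    exact h2.mul_right (h x)

end Fourier

theorem exp_mul_exp_neg_sq_le {ε : ℝ} (hε : 0 < ε) (c t : ℝ) :
    Real.exp (c * t) * Real.exp (-(ε / 2 * t ^ 2)) ≤
      Real.exp (c ^ 2 / ε) * Real.exp (-(ε / 2 / 2 * t ^ 2)) := by
  rw [← Real.exp_add, ← Real.exp_add, Real.exp_le_exp]
  have h1 : c ^ 2 / ε + -(ε / 2 / 2 * t ^ 2) - (c * t + -(ε / 2 * t ^ 2)) =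
      (2 * c - ε * t) ^ 2 / (4 * ε) := by
    field_simp
    ring
  have : 0 ≤ (2 * c - ε * t) ^ 2 / (4 * ε) := by positivity
  linarith

variable {ι : Type*} [Fintype ι]

theorem pow_sum_coordMul_apply (c : ι → ℂ) (j : ℕ) (f : 𝓢(EuclideanSpace ℝ ι, ℂ))
    (x : EuclideanSpace ℝ ι) :
    ((∑ i, c i • coordMul i) ^ j) f x = (∑ i, c i * x i) ^ j * f x := by
  induction j with
  | zero => simp
  | succ j ih =>
    rw [pow_succ', Module.End.mul_apply, LinearMap.sum_apply, sum_apply, pow_succ', mul_assoc, ← ih,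
      Finset.sum_mul]
    exact Finset.sum_congr rfl fun i _ => by
      rw [LinearMap.smul_apply, smul_apply, coordMul_apply, smul_eq_mul, mul_assoc]

theorem inner_toL2_left (f : 𝓢(EuclideanSpace ℝ ι, ℂ))
    (w : Lp ℂ 2 (volume : Measure (EuclideanSpace ℝ ι))) :
    inner ℂ (toL2 f) w = ∫ x, inner ℂ (f x) (w x) := by
  rw [L2.inner_def]
  refine integral_congr_ae ?_
  filter_upwards [f.coeFn_toLp 2 volume] with x hx
  rw [← hx]
  rfl

theorem eq_zero_of_inner_polySpace_gaussian {ε : ℝ} (hε : 0 < ε)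
    {w : Lp ℂ 2 (volume : Measure (EuclideanSpace ℝ ι))}
    (hw : ∀ k, ∀ f ∈ WeylSystem.polySpace coordMul (gaussian (EuclideanSpace ℝ ι) hε) k,
      inner ℂ (toL2 f) w = 0) : w = 0 := by
  let h : EuclideanSpace ℝ ι → ℂ := fun x => gaussian (EuclideanSpace ℝ ι) hε x * w x
  have hmeas : AEStronglyMeasurable h :=
    (gaussian _ hε).continuous.aestronglyMeasurable.mul (Lp.aestronglyMeasurable w)
  have hexp : ∀ c : ℝ, Integrable fun x => Real.exp (c * ‖x‖) * ‖h x‖ := by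
    intro c
    have h1 : Integrable fun x => ‖gaussian (EuclideanSpace ℝ ι) (half_pos hε) x * w x‖ :=
      (((gaussian _ (half_pos hε)).memLp 2 volume).integrable_mul (Lp.memLp w)).norm
    refine (h1.const_mul (Real.exp (c ^ 2 / ε))).mono'
      ((Continuous.aestronglyMeasurable (by fun_prop)).mul hmeas.norm) ?_
    filter_upwards with x
    rw [Real.norm_of_nonneg (by positivity)]
    simp only [h, norm_mul, gaussian_apply, Complex.norm_real, Real.norm_eq_abs, Real.abs_exp]
    rw [← mul_assoc, ← mul_assoc]
    exact mul_le_mul_of_nonneg_right (exp_mul_exp_neg_sq_le hε c ‖x‖) (norm_nonneg _)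
  have hh_int : Integrable h := by
    simpa [integrable_norm_iff hmeas] using hexp 0
  have hmom : ∀ (ξ : EuclideanSpace ℝ ι) (j : ℕ), ∫ x, (⟪x, ξ⟫ : ℂ) ^ j * h x = 0 := by
    intro ξ j
    rw [← hw j _ (WeylSystem.pow_sum_mem_polySpace _ (fun i => (ξ i : ℂ)) j), inner_toL2_left]
    congr 1 with x
    have h1 : (∑ i, (ξ i : ℂ) * x i) = (⟪x, ξ⟫ : ℂ) := by
      simp [PiLp.inner_apply]
    rw [pow_sum_coordMul_apply, h1, RCLike.inner_apply', map_mul, map_pow, gaussian_apply,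
      Complex.conj_ofReal, Complex.conj_ofReal, mul_assoc]
    rfl
  have h0 := ae_eq_zero_of_fourier_eq_zero hh_int (fourier_eq_zero_of_moments hmeas hexp hmom)
  refine (Lp.eq_zero_iff_ae_eq_zero).2 ?_
  filter_upwards [h0] with x hx
  simpa [h, gaussian_apply] using hx

theorem exists_polySpace_gaussian_close {ε : ℝ} (hε : 0 < ε)
    (w : Lp ℂ 2 (volume : Measure (EuclideanSpace ℝ ι))) {δ : ℝ} (hδ : 0 < δ) :
    ∃ k, ∃ e ∈ WeylSystem.polySpace coordMul (gaussian (EuclideanSpace ℝ ι) hε) k,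
      ‖w - toL2 e‖ < δ := by
  let E := WeylSystem.polySpace coordMul (gaussian (EuclideanSpace ℝ ι) hε)
  have h1 : ((⨆ k, E k).map toL2).topologicalClosure = ⊤ := by
    rw [Submodule.topologicalClosure_eq_top_iff, Submodule.eq_bot_iff]
    intro v hv
    refine eq_zero_of_inner_polySpace_gaussian hε fun k f hf => ?_
    exact (Submodule.mem_orthogonal _ _).1 hv _
      (Submodule.mem_map_of_mem (Submodule.mem_iSup_of_mem k hf))
  have h2 : w ∈ closure ((⨆ k, E k).map toL2 : Set _) := by
    rw [← Submodule.topologicalClosure_coe, h1]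
    trivial
  obtain ⟨_, ⟨e, he, rfl⟩, hd⟩ := Metric.mem_closure_iff.1 h2 δ hδ
  obtain ⟨k, hk⟩ := (Submodule.mem_iSup_of_directed _
    (WeylSystem.polySpace_mono _ _).directed_le).1 he
  exact ⟨k, e, hk, by rwa [← dist_eq_norm]⟩

end SchwartzMap

namespace SchwartzMap

open scoped SchwartzMap ContDiff

theorem laplacian_eq_sum_coordDeriv {n : ℕ} (f : 𝓢(EuclideanSpace ℝ (Fin n), ℂ))
    (x : EuclideanSpace ℝ (Fin n)) :
    _root_.laplacian f x = ∑ i, coordDeriv i (coordDeriv i f) x := by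
  refine Finset.sum_congr rfl fun i _ => ?_
  rw [coordDeriv_coordDeriv_apply, iteratedFDeriv_two_apply]
  rfl

/-- A real-valued smooth function with bounded derivatives, as a bounded symbol. -/
def BoundedSymbol.ofReal {ι : Type*} [Fintype ι] (W : EuclideanSpace ℝ ι → ℝ)
    (hW : ContDiff ℝ ∞ W) (hWb : ∀ k : ℕ, ∃ C, ∀ x, ‖iteratedFDeriv ℝ k W x‖ ≤ C) :
    BoundedSymbol ι := by
  refine ⟨fun x => (W x : ℂ), Complex.ofRealCLM.contDiff.comp hW, fun k => ?_⟩
  obtain ⟨C, hC⟩ := hWb k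
  refine ⟨‖Complex.ofRealCLM‖ * C, fun x => (Complex.ofRealCLM.norm_iteratedFDeriv_comp_left
    hW.contDiffAt (by exact_mod_cast le_top)).trans ?_⟩
  gcongr
  exact hC x

theorem eq_zero_of_stark {n : ℕ} (β : ℝ) (o : Fin n) {V : EuclideanSpace ℝ (Fin n) → ℝ}
    (hV : ContDiff ℝ ∞ V) (hVb : ∀ k : ℕ, ∃ C, ∀ x, ‖iteratedFDeriv ℝ k V x‖ ≤ C) {z : ℂ}
    (hz : z.im ≠ 0) (u : 𝓢(EuclideanSpace ℝ (Fin n), ℂ) →L[ℂ] ℂ)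
    (hu : ∀ φ ψ : 𝓢(EuclideanSpace ℝ (Fin n), ℂ),
      (∀ x, ψ x = -_root_.laplacian φ x + (((β * x o + V x : ℝ) : ℂ) - z) * φ x) → u ψ = 0) :
    u = 0 := by
  let W := BoundedSymbol.ofReal V hV hVb
  obtain ⟨N, hN⟩ := oscillatorBounded_functional u
  refine ContinuousLinearMap.coe_injective (WeylSystem.eq_zero_of_stark_sub_smul (N := N)
    weylSystem multiplierFamily β o W (inner_multiplier W.hasTemperateGrowth) hz u.toLinearMap
    (fun ε hε hε1 => ?_) (fun ε hε => ?_) fun f => hu f _ fun x => ?_)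
  · obtain ⟨C, -, hC⟩ := hN ε hε hε1
    exact ⟨C, hC⟩
  · exact ⟨WeylSystem.polySpace coordMul (gaussian _ hε), fun k => inferInstance,
      fun k f hf => WeylSystem.oscillator_mem_polySpace weylSystem (coordDeriv_gaussian hε) k hf,
      fun w δ hδ => exists_polySpace_gaussian_close hε w hδ⟩
  · have hW : multiplier W.1 f x = V x * f x := multiplier_apply W.hasTemperateGrowth f x
    rw [WeylSystem.stark_apply, laplacian_eq_sum_coordDeriv, sub_apply, add_apply, add_apply,
      neg_apply, sum_apply, smul_apply, smul_apply, hW, coordMul_apply, smul_eq_mul, smul_eq_mul]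
    push_cast
    ring

end SchwartzMap

/-- If a tempered distribution `u` annihilates `(P − z)φ` for every Schwartz `φ`, where
`P = −Δ + βx₁ + V` is the Stark Hamiltonian with `β > 0`, `V ∈ C_b^∞(ℝⁿ; ℝ)` and
`Im z ≠ 0`, then `u = 0`: the kernel of `P − z` on `𝒮'` is trivial. -/
theorem stmt_5 (n : ℕ) (hn : 0 < n) (β : ℝ) (hβ : 0 < β)
    (V : EuclideanSpace ℝ (Fin n) → ℝ) (hV : ContDiff ℝ (⊤ : ℕ∞) V)
    (hVb : ∀ k : ℕ, ∃ C : ℝ, ∀ x, ‖iteratedFDeriv ℝ k V x‖ ≤ C)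
    (z : ℂ) (hz : z.im ≠ 0)
    (u : SchwartzMap (EuclideanSpace ℝ (Fin n)) ℂ →L[ℂ] ℂ)
    (hu : ∀ φ ψ : SchwartzMap (EuclideanSpace ℝ (Fin n)) ℂ,
      (∀ x, ψ x = -laplacian (⇑φ) x + (((β * x ⟨0, hn⟩ + V x : ℝ) : ℂ) - z) * φ x) →
      u ψ = 0) :
    u = 0 := by
  exact SchwartzMap.eq_zero_of_stark β ⟨0, hn⟩ hV hVb hz u hu
end

section
/- Let n ≥ 1, β > 0, and z ∈ ℂ with Im z ≠ 0. Then for every ξ ∈ ℝⁿ the quantity βξ₁ + ∑_{j=2}^n ξ_j² − z is nonzero, and for every Schwartz function g ∈ 𝒮(ℝⁿ; ℂ) the function ξ ↦ g(ξ) / (βξ₁ + ∑_{j=2}^n ξ_j² − z) again belongs to 𝒮(ℝⁿ; ℂ). -/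
lemma Complex.ofReal_sub_ne_zero_of_im_ne_zero {z : ℂ} (hz : z.im ≠ 0) (t : ℝ) :
    (t : ℂ) - z ≠ 0 := fun h ↦ hz (by simpa using congrArg Complex.im h)

lemma iteratedDeriv_ofReal_sub_inv {z : ℂ} (hz : z.im ≠ 0) (n : ℕ) :
    iteratedDeriv n (fun t : ℝ ↦ ((t : ℂ) - z)⁻¹) =
      fun t : ℝ ↦ (-1) ^ n * (n.factorial : ℂ) * (((t : ℂ) - z) ^ (n + 1))⁻¹ := by
  induction n with
  | zero => simp
  | succ n ih =>
    ext t
    have h0 := Complex.ofReal_sub_ne_zero_of_im_ne_zero hz t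
    have h1 : HasDerivAt (fun t : ℝ ↦ (t : ℂ) - z) 1 t :=
      (Complex.ofRealCLM.hasDerivAt (x := t)).sub_const z
    have h2 := ((h1.fun_pow (n + 1)).fun_inv (pow_ne_zero _ h0)).const_mul
      ((-1) ^ n * (n.factorial : ℂ))
    rw [iteratedDeriv_succ, ih, h2.deriv, Nat.factorial_succ]
    push_cast
    field_simp
    ring

lemma hasTemperateGrowth_ofReal_sub_inv {z : ℂ} (hz : z.im ≠ 0) :
    (fun t : ℝ ↦ ((t : ℂ) - z)⁻¹).HasTemperateGrowth := by
  refine ⟨(Complex.ofRealCLM.contDiff.sub contDiff_const).inv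
    (Complex.ofReal_sub_ne_zero_of_im_ne_zero hz), fun n ↦
    ⟨0, n.factorial * (|z.im| ^ (n + 1))⁻¹, fun t ↦ ?_⟩⟩
  have hle : |z.im| ≤ ‖(t : ℂ) - z‖ := by
    simpa using Complex.abs_im_le_norm ((t : ℂ) - z)
  have hpos : 0 < |z.im| := abs_pos.mpr hz
  rw [norm_iteratedFDeriv_eq_norm_iteratedDeriv, iteratedDeriv_ofReal_sub_inv hz]
  simp only [norm_mul, norm_pow, norm_neg, norm_one, one_pow, one_mul, norm_inv,
    Complex.norm_natCast, pow_zero, mul_one]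
  gcongr

/-- For `β > 0` and `Im z ≠ 0`, the quantity `βξ₁ + ∑_{j≥2} ξ_j² − z` never vanishes,
and division by it preserves the Schwartz space. -/
theorem stmt_8 (n : ℕ) (hn : 0 < n) (β : ℝ) (hβ : 0 < β) (z : ℂ) (hz : z.im ≠ 0) :
    (∀ ξ : EuclideanSpace ℝ (Fin n),
        ((β * ξ ⟨0, hn⟩ + ∑ i ∈ Finset.univ.erase ⟨0, hn⟩, ξ i ^ 2 : ℝ) : ℂ) - z ≠ 0) ∧
      ∀ g : SchwartzMap (EuclideanSpace ℝ (Fin n)) ℂ,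
        ∃ h : SchwartzMap (EuclideanSpace ℝ (Fin n)) ℂ,
          ∀ ξ, h ξ = g ξ /
            (((β * ξ ⟨0, hn⟩ + ∑ i ∈ Finset.univ.erase ⟨0, hn⟩, ξ i ^ 2 : ℝ) : ℂ) - z) := by
  refine ⟨fun ξ ↦ Complex.ofReal_sub_ne_zero_of_im_ne_zero hz _, fun g ↦ ?_⟩
  have hcoord (i : Fin n) : (fun ξ : EuclideanSpace ℝ (Fin n) ↦ ξ i).HasTemperateGrowth :=
    (EuclideanSpace.proj (𝕜 := ℝ) i).hasTemperateGrowth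
  have hsymbol : (fun ξ : EuclideanSpace ℝ (Fin n) ↦
      β * ξ ⟨0, hn⟩ + ∑ i ∈ Finset.univ.erase ⟨0, hn⟩, ξ i ^ 2).HasTemperateGrowth :=
    ((Function.HasTemperateGrowth.const β).fun_mul (hcoord _)).fun_add
      (.sum fun i _ ↦ (hcoord i).fun_pow 2)
  have hresolvent := (hasTemperateGrowth_ofReal_sub_inv hz).comp hsymbol
  refine ⟨_, fun ξ ↦ (SchwartzMap.smulLeftCLM_apply_apply hresolvent g ξ).trans ?_⟩
  rw [smul_eq_mul, div_eq_inv_mul, Function.comp_apply]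
end

section
/- Let n ≥ 1, β > 0, let V : ℝⁿ → ℝ be a smooth function all of whose derivatives (including V itself) are bounded, and let f : ℝ → ℂ be a smooth compactly supported function with f not identically zero. Define a : ℝⁿ × ℝⁿ → ℂ by a(x, ξ) = f(‖ξ‖² + βx₁ + V(x)). Then there is no order function m for which a ∈ S(m); that is, for every m : ℝⁿ × ℝⁿ → (0, ∞) satisfying the temperance condition that there exist C > 0 and N ≥ 0 with m(X) ≤ C(1 + ‖X − Y‖)^N m(Y) for all X, Y ∈ ℝ²ⁿ, there exists a multi-index α such that sup_{(x,ξ)} |∂^α_{x,ξ} a(x,ξ)| / m(x,ξ) = ∞. -/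
/-- The `k`-th derivative of a smooth function along the line `t ↦ p + t • v` is controlled by its
`k`-th Fréchet derivative. -/
theorem norm_iteratedDeriv_comp_line_le {E F : Type*} [NormedAddCommGroup E] [NormedSpace ℝ E]
    [NormedAddCommGroup F] [NormedSpace ℝ F] {a : E → F} (ha : ContDiff ℝ (⊤ : ℕ∞) a)
    (p v : E) (k : ℕ) (t : ℝ) :
    ‖iteratedDeriv k (fun t : ℝ => a (p + t • v)) t‖
      ≤ ‖iteratedFDeriv ℝ k a (p + t • v)‖ * ‖v‖ ^ k := by
  have hb : ContDiff ℝ (⊤ : ℕ∞) (fun z => a (p + z)) := ha.comp (contDiff_const.add contDiff_id)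
  have h := (ContinuousLinearMap.toSpanSingleton ℝ v).iteratedFDeriv_comp_right hb t
    (i := k) (by exact_mod_cast le_top)
  have hfun : (fun z => a (p + z)) ∘ (ContinuousLinearMap.toSpanSingleton ℝ v)
      = fun t : ℝ => a (p + t • v) := by
    ext t; simp
  rw [hfun, iteratedFDeriv_comp_add_left] at h
  rw [← norm_iteratedFDeriv_eq_norm_iteratedDeriv, h]
  refine (ContinuousMultilinearMap.norm_compContinuousLinearMap_le _ _).trans (le_of_eq ?_)
  simp

/-- A smooth function on the line vanishing near `0` is bounded at `T > 0` by `C * T ^ (k + 1)`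
when its derivative of order `k + 1` is bounded by `C` on `[0, T]`. -/
theorem norm_le_of_eventuallyEq_zero_of_iteratedDeriv_le {F : Type*} [NormedAddCommGroup F]
    [NormedSpace ℝ F] {g : ℝ → F} (hg : ContDiff ℝ (⊤ : ℕ∞) g) (h0 : g =ᶠ[nhds 0] 0)
    {T C : ℝ} (hT : 0 < T) (k : ℕ)
    (hC : ∀ t ∈ Set.Icc 0 T, ‖iteratedDeriv (k + 1) g t‖ ≤ C) :
    ‖g T‖ ≤ C * T ^ (k + 1) := by
  have hw : ∀ (i : ℕ), ∀ t ∈ Set.Icc 0 T,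
      iteratedDerivWithin i g (Set.Icc 0 T) t = iteratedDeriv i g t := fun i t ht =>
    iteratedDerivWithin_eq_iteratedDeriv (uniqueDiffOn_Icc hT)
      (hg.contDiffAt.of_le (by exact_mod_cast le_top)) ht
  have hz : ∀ i : ℕ, iteratedDeriv i g 0 = 0 := fun i => by
    have h := h0.iteratedDeriv_eq i
    rw [h]
    have : (0 : ℝ → F) = fun _ => 0 := rfl
    rw [this, iteratedDeriv_const]
    simp
  have h := taylor_mean_remainder_bound (f := g) (n := k) hT.le
    (hg.contDiffOn.of_le (by exact_mod_cast le_top)) (Set.right_mem_Icc.2 hT.le)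
    (C := C) (fun t ht => by rw [hw _ _ ht]; exact hC t ht)
  have htay : taylorWithinEval g k (Set.Icc 0 T) 0 T = 0 := by
    rw [taylor_within_apply]
    refine Finset.sum_eq_zero fun i _ => ?_
    rw [hw _ _ (Set.left_mem_Icc.2 hT.le), hz, smul_zero]
  rw [htay, sub_zero, sub_zero] at h
  have hC0 : 0 ≤ C := (norm_nonneg _).trans (hC 0 (Set.left_mem_Icc.2 hT.le))
  refine h.trans (div_le_self (by positivity) ?_)
  exact_mod_cast Nat.one_le_iff_ne_zero.2 (Nat.factorial_ne_zero k)

/-- A bounded continuous perturbation of `y ↦ β * y` attains every value `c`, at a point of size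
at most `(|c| + B) / β`. -/
theorem exists_mul_add_eq_of_abs_le {β B : ℝ} (hβ : 0 < β) {w : ℝ → ℝ} (hw : Continuous w)
    (hB : ∀ y, |w y| ≤ B) (c : ℝ) : ∃ y, β * y + w y = c ∧ |y| ≤ (|c| + B) / β := by
  obtain ⟨y, hy⟩ := mem_range_of_exists_le_of_exists_ge (c := c)
    (f := fun y => β * y + w y) (by fun_prop)
    ⟨(c - B) / β, by
      have := (abs_le.1 (hB ((c - B) / β))).2
      simp only [mul_div_cancel₀ _ hβ.ne']; linarith⟩
    ⟨(c + B) / β, by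
      have := (abs_le.1 (hB ((c + B) / β))).1
      simp only [mul_div_cancel₀ _ hβ.ne']; linarith⟩
  refine ⟨y, hy, ?_⟩
  have hy' : β * y = c - w y := by simp only at hy; linarith
  have hyabs : |y| * β = |c - w y| := by rw [← hy', abs_mul, abs_of_pos hβ, mul_comm]
  rw [le_div_iff₀ hβ, hyabs]
  exact (abs_sub _ _).trans (by linarith [hB y])

/-- For `β > 0`, `V ∈ C_b^∞(ℝⁿ; ℝ)` and `f ∈ C_c^∞(ℝ)` not identically zero, the symbol
`a(x,ξ) = f(‖ξ‖² + βx₁ + V(x))` belongs to no symbol class `S(m)` with a tempered order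
function `m`: for every such `m` some derivative of `a` is unbounded relative to `m`. -/
theorem stmt_9 (n : ℕ) (hn : 0 < n) (β : ℝ) (hβ : 0 < β)
    (V : EuclideanSpace ℝ (Fin n) → ℝ) (hV : ContDiff ℝ (⊤ : ℕ∞) V)
    (hVb : ∀ k : ℕ, ∃ C : ℝ, ∀ x, ‖iteratedFDeriv ℝ k V x‖ ≤ C)
    (f : ℝ → ℂ) (hf : ContDiff ℝ (⊤ : ℕ∞) f) (hfc : HasCompactSupport f) (hf0 : f ≠ 0) :
    ∀ m : EuclideanSpace ℝ (Fin n) × EuclideanSpace ℝ (Fin n) → ℝ,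
      (∀ X, 0 < m X) →
      (∃ C > 0, ∃ N : ℕ, ∀ X Y, m X ≤ C * (1 + ‖X - Y‖) ^ N * m Y) →
      ∃ k : ℕ, ∀ C : ℝ, ∃ X : EuclideanSpace ℝ (Fin n) × EuclideanSpace ℝ (Fin n),
        C * m X < ‖iteratedFDeriv ℝ k
          (fun p : EuclideanSpace ℝ (Fin n) × EuclideanSpace ℝ (Fin n) =>
            f (‖p.2‖ ^ 2 + β * p.1 ⟨0, hn⟩ + V p.1)) X‖ := by
  rintro m hm ⟨A, hA, N, htemp⟩
  by_contra! hcon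
  obtain ⟨D, hD⟩ := hcon (2 * N + 1)
  obtain ⟨B, hB⟩ := hVb 0
  simp only [norm_iteratedFDeriv_zero, Real.norm_eq_abs] at hB
  obtain ⟨s, hs⟩ := Function.ne_iff.1 hf0
  obtain ⟨M, hMpos, hM⟩ : ∃ M : ℝ, 0 < M ∧ ∀ r, M ≤ |r| → f r = 0 := by
    obtain ⟨M, hM⟩ := hfc.isCompact.isBounded.exists_pos_norm_lt
    refine ⟨M, hM.1, fun r hr => by_contra fun h => ?_⟩
    exact absurd (hM.2 r (subset_tsupport f h)) (not_lt.2 hr)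
  have hsM : |s| < M := lt_of_not_ge fun h => hs (hM s h)
  set a := fun p : EuclideanSpace ℝ (Fin n) × EuclideanSpace ℝ (Fin n) =>
            f (‖p.2‖ ^ 2 + β * p.1 ⟨0, hn⟩ + V p.1) with ha
  have hasm : ContDiff ℝ (⊤ : ℕ∞) a := by
    have h1 : ContDiff ℝ (⊤ : ℕ∞)
        (fun p : EuclideanSpace ℝ (Fin n) × EuclideanSpace ℝ (Fin n) => p.1 ⟨0, hn⟩) :=
      ((EuclideanSpace.proj (𝕜 := ℝ) (⟨0, hn⟩ : Fin n)).contDiff).comp contDiff_fst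
    exact hf.comp (((contDiff_snd.norm_sq ℝ).add (contDiff_const.mul h1)).add
      (hV.comp contDiff_fst))
  set e : EuclideanSpace ℝ (Fin n) := EuclideanSpace.single ⟨0, hn⟩ 1 with he
  have hen : ‖e‖ = 1 := by simp [he]
  have hB0 : 0 ≤ B := (abs_nonneg _).trans (hB 0)
  set K : ℝ := 1 + ((|s| + 1 + B) / β + (1 + M)) with hK
  have hDpos : 0 ≤ D := by
    have := (norm_nonneg _).trans (hD 0)
    exact nonneg_of_mul_nonneg_left this (hm 0)
  set Q : ℝ := D * (A * K ^ N * m 0) * M ^ (2 * N + 1) with hQ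
  have key : ∀ R : ℝ, 1 ≤ R → ‖f s‖ * R ≤ Q := by
    intro R hR
    have hR0 : 0 < R := by linarith
    obtain ⟨y, hy, hyb⟩ := exists_mul_add_eq_of_abs_le hβ (w := fun y => V (y • e))
      (hV.continuous.comp (by fun_prop)) (fun y => hB _) (s - R ^ 2)
    set T := M / R with hT
    have hTpos : 0 < T := by positivity
    have hTM : T ≤ M := div_le_self hMpos.le hR
    have hRT : R * T = M := by rw [hT]; field_simp
    set p : EuclideanSpace ℝ (Fin n) × EuclideanSpace ℝ (Fin n) := (y • e, (R + T) • e) with hp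
    set v : EuclideanSpace ℝ (Fin n) × EuclideanSpace ℝ (Fin n) := (0, -e) with hv
    have hvn : ‖v‖ = 1 := by simp [hv, Prod.norm_def, hen]
    have hpt : ∀ t : ℝ, p + t • v = (y • e, (R + T - t) • e) := fun t => by
      simp [hp, hv, sub_smul _ t, ← sub_eq_add_neg]
    have hval : ∀ t : ℝ, a (p + t • v) = f ((R + T - t) ^ 2 + (s - R ^ 2)) := fun t => by
      rw [hpt, ← hy, ha]
      simp [norm_smul, he, add_assoc]
    have hgz : (fun t : ℝ => a (p + t • v)) =ᶠ[nhds 0] 0 := by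
      have hs0 : 0 < M + s := by linarith [(abs_lt.1 hsM).1]
      filter_upwards [Iio_mem_nhds (show (0 : ℝ) < (M + s) / (2 * R) by positivity)] with t ht
      rw [hval]
      refine hM _ (le_trans ?_ (le_abs_self _))
      have ht' : t * (2 * R) < M + s := (lt_div_iff₀ (by positivity)).1 ht
      nlinarith [sq_nonneg (T - t)]
    have hbound : ∀ t ∈ Set.Icc 0 T, ‖iteratedDeriv (2 * N + 1) (fun t : ℝ => a (p + t • v)) t‖
        ≤ D * (A * (K * R ^ 2) ^ N * m 0) := by
      intro t ht
      refine (norm_iteratedDeriv_comp_line_le hasm p v _ t).trans ?_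
      rw [hvn, one_pow, mul_one]
      refine (hD _).trans (mul_le_mul_of_nonneg_left ?_ hDpos)
      refine (htemp _ 0).trans ?_
      have hm0 := (hm 0).le
      have hR2 : 1 ≤ R ^ 2 := one_le_pow₀ hR
      have hRR : R ≤ R ^ 2 := by nlinarith
      have hn1 : ‖y • e‖ ≤ (|s| + 1 + B) / β * R ^ 2 := by
        rw [norm_smul, hen, mul_one, Real.norm_eq_abs]
        refine hyb.trans ?_
        rw [div_mul_eq_mul_div]
        gcongr
        have h1 := abs_sub s (R ^ 2)
        rw [abs_of_nonneg (sq_nonneg R)] at h1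
        nlinarith [abs_nonneg s]
      have hn2 : ‖(R + T - t) • e‖ ≤ (1 + M) * R ^ 2 := by
        rw [norm_smul, hen, mul_one, Real.norm_eq_abs, abs_of_nonneg (by linarith [ht.2])]
        nlinarith [ht.1]
      have hX : 1 + ‖p + t • v - 0‖ ≤ K * R ^ 2 := by
        rw [sub_zero, hpt, Prod.norm_def, hK]
        have := max_le_add_of_nonneg (norm_nonneg (y • e)) (norm_nonneg ((R + T - t) • e))
        simp only at this ⊢
        nlinarith
      gcongr
    have hgsm : ContDiff ℝ (⊤ : ℕ∞) (fun t : ℝ => a (p + t • v)) :=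
      hasm.comp (contDiff_const.add (contDiff_id.smul contDiff_const))
    have hfin := norm_le_of_eventuallyEq_zero_of_iteratedDeriv_le hgsm hgz hTpos (2 * N) hbound
    rw [hval, show (R + T - T) ^ 2 + (s - R ^ 2) = s by ring] at hfin
    have : Q = D * (A * (K * R ^ 2) ^ N * m 0) * T ^ (2 * N + 1) * R := by
      rw [hQ, ← hRT]; ring_nf
    rw [this]
    gcongr
  have hfs : 0 < ‖f s‖ := norm_pos_iff.2 hs
  have h := key (max 1 (Q / ‖f s‖ + 1)) (le_max_left _ _)
  have h2 : ‖f s‖ * (Q / ‖f s‖ + 1) ≤ Q :=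
    (mul_le_mul_of_nonneg_left (le_max_right _ _) hfs.le).trans h
  rw [mul_add, mul_div_cancel₀ _ hfs.ne'] at h2
  linarith
end
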